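/- Let Δ = (T, 𝒮, ℬ) be a strong triangle blocking arrangement with vertices x₁, x₂, x₃ of T. Suppose some blocking segment passes through x₁ and some blocking segment passes through x₃. Suppose a₁a₂, b₁b₂ ∈ 𝒮 are proper initial segments with a₁ ∈ x₁x₂, b₂ ∈ x₂x₃ and a₂, b₁ ∈ x₁x₃. Then a₁a₂ and b₁b₂ are disjoint. -/

import Mathlib

open Set

noncomputable section

/-- Points of the real plane. -/
abbrev Pt := ℝ × ℝ

/-- The boundary of the triangle with vertices `x1`, `x2`, `x3`:
the union of its three edges. -/
def triBdry (x1 x2 x3 : Pt) : Set Pt :=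
  segment ℝ x1 x2 ∪ segment ℝ x2 x3 ∪ segment ℝ x3 x1

/-- The three edges of the triangle with vertices `x1`, `x2`, `x3`. -/
def triEdges (x1 x2 x3 : Pt) : Set (Set Pt) :=
  {segment ℝ x1 x2, segment ℝ x2 x3, segment ℝ x3 x1}

/-- A triangle blocking arrangement: a nondegenerate triangle `x1 x2 x3` together with two
finite collections `S` (proper initial segments) and `B` (blocking segments) of closed
segments with endpoints on the boundary of the triangle and no interior point on the
boundary, satisfying the intersection conditions (i) and (ii). `S ∪ triEdges x1 x2 x3`
is the collection of initial segments `𝒮̄`. -/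
structure TBA where
  x1 : Pt
  x2 : Pt
  x3 : Pt
  S : Set (Set Pt)
  B : Set (Set Pt)
  indep : AffineIndependent ℝ ![x1, x2, x3]
  finS : S.Finite
  finB : B.Finite
  seg_wf : ∀ s ∈ S ∪ B, ∃ a b : Pt, a ≠ b ∧ s = segment ℝ a b ∧
    a ∈ triBdry x1 x2 x3 ∧ b ∈ triBdry x1 x2 x3 ∧
    ∀ p ∈ openSegment ℝ a b, p ∉ triBdry x1 x2 x3
  /- (i) no three initial segments are concurrent … -/
  no_three_concurrent : ∀ s₁ ∈ S ∪ triEdges x1 x2 x3, ∀ s₂ ∈ S ∪ triEdges x1 x2 x3,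
    ∀ s₃ ∈ S ∪ triEdges x1 x2 x3, s₁ ≠ s₂ → s₁ ≠ s₃ → s₂ ≠ s₃ →
    ¬ ∃ p : Pt, p ∈ s₁ ∧ p ∈ s₂ ∧ p ∈ s₃
  /- … and through every intersection point of two initial segments, not both edges,
  there is a unique blocking segment … -/
  block_exists : ∀ s₁ ∈ S ∪ triEdges x1 x2 x3, ∀ s₂ ∈ S ∪ triEdges x1 x2 x3, s₁ ≠ s₂ →
    ¬ (s₁ ∈ triEdges x1 x2 x3 ∧ s₂ ∈ triEdges x1 x2 x3) →
    ∀ p : Pt, p ∈ s₁ → p ∈ s₂ → ∃! b, b ∈ B ∧ p ∈ b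
  /- … while through an intersection point of two edges there is at most one
  blocking segment. -/
  block_unique : ∀ s₁ ∈ S ∪ triEdges x1 x2 x3, ∀ s₂ ∈ S ∪ triEdges x1 x2 x3, s₁ ≠ s₂ →
    ∀ p : Pt, p ∈ s₁ → p ∈ s₂ → ∀ b₁ ∈ B, ∀ b₂ ∈ B, p ∈ b₁ → p ∈ b₂ → b₁ = b₂
  /- (ii) through every intersection point of an initial segment and a blocking segment
  there is a unique second initial segment. -/
  second_segment : ∀ s ∈ S ∪ triEdges x1 x2 x3, ∀ b ∈ B, ∀ p : Pt, p ∈ s → p ∈ b →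
    ∃! s', s' ∈ S ∪ triEdges x1 x2 x3 ∧ s' ≠ s ∧ p ∈ s'

namespace TBA

variable (Δ : TBA)

/-- The collection `𝒮̄` of initial segments. -/
def Sbar : Set (Set Pt) := Δ.S ∪ triEdges Δ.x1 Δ.x2 Δ.x3

/-- The (closed) triangle `T`. -/
def tri : Set Pt := convexHull ℝ {Δ.x1, Δ.x2, Δ.x3}

/-- The boundary `∂T`. -/
def bdry : Set Pt := triBdry Δ.x1 Δ.x2 Δ.x3

/-- A vertex of the arrangement: an intersection point of two initial segments. -/
def IsVertex (p : Pt) : Prop :=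
  ∃ s₁ ∈ Δ.Sbar, ∃ s₂ ∈ Δ.Sbar, s₁ ≠ s₂ ∧ p ∈ s₁ ∧ p ∈ s₂

/-- The segment `xy` is minimal if no vertex of the arrangement lies in its interior. -/
def MinimalSeg (x y : Pt) : Prop :=
  ∀ p ∈ openSegment ℝ x y, ¬ Δ.IsVertex p

/-- An `𝒮̄`-region: the closure of a connected component of `T \ ⋃ L` for some
subset `L` of `𝒮̄`. -/
def IsRegion (R : Set Pt) : Prop :=
  ∃ L ⊆ Δ.Sbar, ∃ p ∈ Δ.tri \ ⋃₀ L,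
    R = closure (connectedComponentIn (Δ.tri \ ⋃₀ L) p)

/-- A minimal `𝒮̄`-region: the closure of a connected component of `T \ ⋃ 𝒮̄`. -/
def IsMinRegion (R : Set Pt) : Prop :=
  ∃ p ∈ Δ.tri \ ⋃₀ Δ.Sbar,
    R = closure (connectedComponentIn (Δ.tri \ ⋃₀ Δ.Sbar) p)

/-- The set `s` contains an edge of the region `R`: it contains a nondegenerate
segment lying on the boundary of `R`. -/
def ContainsEdgeOf (_Δ : TBA) (s R : Set Pt) : Prop :=
  ∃ q₁ q₂ : Pt, q₁ ≠ q₂ ∧ segment ℝ q₁ q₂ ⊆ s ∩ frontier R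

/-- A vertex of the region `R`: a point of `R` that is the intersection of two initial
segments, each containing an edge of `R`. -/
def IsRegionVertex (R : Set Pt) (p : Pt) : Prop :=
  p ∈ R ∧ ∃ s₁ ∈ Δ.Sbar, ∃ s₂ ∈ Δ.Sbar, s₁ ≠ s₂ ∧ p ∈ s₁ ∧ p ∈ s₂ ∧
    Δ.ContainsEdgeOf s₁ R ∧ Δ.ContainsEdgeOf s₂ R

/-- A vertex `p` is internally blocked in the region `R` if the blocking segment
through `p` exists and meets the interior of `R`.  (Externally blocked means not
internally blocked.) -/
def InternallyBlocked (R : Set Pt) (p : Pt) : Prop :=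
  ∃ b ∈ Δ.B, p ∈ b ∧ (b ∩ interior R).Nonempty

/-- Two consecutive vertices of a region `R`: distinct vertices joined by an edge
lying on the boundary of `R`. -/
def Consec (R : Set Pt) (u v : Pt) : Prop :=
  u ≠ v ∧ Δ.IsRegionVertex R u ∧ Δ.IsRegionVertex R v ∧ segment ℝ u v ⊆ frontier R

/-- Condition (A): the arrangement is strong when for every minimal `𝒮̄`-region `R` and
consecutive vertices `v₁, v₂, v₃, v₄, v₅` in this order along `∂R`, if the line
`l(v₁v₂)` and the blocking segment `β(v₃)` intersect inside `T`, and `β(v₃)` meets the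
interior of `R`, then `l(v₁v₂)`, `β(v₃)` and `l(v₄v₅)` are concurrent. -/
def Strong : Prop :=
  ∀ R : Set Pt, Δ.IsMinRegion R →
  ∀ v₁ v₂ v₃ v₄ v₅ : Pt, List.Pairwise (· ≠ ·) [v₁, v₂, v₃, v₄, v₅] →
    Δ.Consec R v₁ v₂ → Δ.Consec R v₂ v₃ → Δ.Consec R v₃ v₄ → Δ.Consec R v₄ v₅ →
    ∀ b ∈ Δ.B, v₃ ∈ b → (b ∩ interior R).Nonempty →
    (∃ q ∈ Δ.tri, q ∈ affineSpan ℝ ({v₁, v₂} : Set Pt) ∧ q ∈ b) →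
    ∃ q : Pt, q ∈ b ∧ q ∈ affineSpan ℝ ({v₁, v₂} : Set Pt) ∧
      q ∈ affineSpan ℝ ({v₄, v₅} : Set Pt)

end TBA

namespace Blocking

/-- The values `a` and `b` are nonzero and have opposite signs. -/
def Opp (a b : ℝ) : Prop := (0 < a ∧ b < 0) ∨ (a < 0 ∧ 0 < b)

/-- Sign relations satisfied by a proper convex combination `c` of `a` and `b`. -/
def Btw (a c b : ℝ) : Prop :=
  (0 < a → 0 ≤ b → 0 < c) ∧ (a < 0 → b ≤ 0 → c < 0) ∧
  (0 < b → 0 ≤ a → 0 < c) ∧ (b < 0 → a ≤ 0 → c < 0) ∧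
  (0 < a → c ≤ 0 → b < 0) ∧ (a < 0 → 0 ≤ c → 0 < b) ∧
  (0 < b → c ≤ 0 → a < 0) ∧ (b < 0 → 0 ≤ c → 0 < a) ∧
  (a = 0 → b = 0 → c = 0)

theorem btw_combo {a b t : ℝ} (h0 : 0 < t) (h1 : t < 1) : Btw a ((1 - t) * a + t * b) b := by
  have h1' : 0 < 1 - t := by linarith
  refine ⟨?_, ?_, ?_, ?_, ?_, ?_, ?_, ?_, ?_⟩
  · intro ha hb; have := mul_pos h1' ha; have := mul_nonneg h0.le hb; linarith
  · intro ha hb; have := mul_neg_of_pos_of_neg h1' ha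
    have := mul_nonpos_of_nonneg_of_nonpos h0.le hb; linarith
  · intro hb ha; have := mul_nonneg h1'.le ha; have := mul_pos h0 hb; linarith
  · intro hb ha; have := mul_nonpos_of_nonneg_of_nonpos h1'.le ha
    have := mul_neg_of_pos_of_neg h0 hb; linarith
  · intro ha hc; have := mul_pos h1' ha
    by_contra hb; have := mul_nonneg h0.le (not_lt.1 hb); linarith
  · intro ha hc; have := mul_neg_of_pos_of_neg h1' ha
    by_contra hb; have := mul_nonpos_of_nonneg_of_nonpos h0.le (not_lt.1 hb); linarith
  · intro hb hc; have := mul_pos h0 hb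
    by_contra ha; have := mul_nonneg h1'.le (not_lt.1 ha); linarith
  · intro hb hc; have := mul_neg_of_pos_of_neg h0 hb
    by_contra ha; have := mul_nonpos_of_nonneg_of_nonpos h1'.le (not_lt.1 ha); linarith
  · intro ha hb; rw [ha, hb]; ring

theorem Opp.symm {a b : ℝ} (h : Opp a b) : Opp b a := by unfold Opp at *; tauto

theorem Opp.ne_left {a b : ℝ} (h : Opp a b) : a ≠ 0 := by
  rcases h with h | h <;> intro h' <;> linarith [h.1]

theorem Opp.ne_right {a b : ℝ} (h : Opp a b) : b ≠ 0 := h.symm.ne_left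

variable {E : Type*} [AddCommGroup E] [Module ℝ E] {T : Set E}

/-- `z` lies strictly between `x` and `y`. -/
def Bt (x z y : T) : Prop := (z : E) ∈ openSegment ℝ (x : E) (y : E)

theorem Bt.symm {x z y : T} (h : Bt x z y) : Bt y z x := by
  unfold Bt at *; rwa [openSegment_symm]

theorem Bt.btw {x z y : T} (h : Bt x z y) (f : E →ᵃ[ℝ] ℝ) : Btw (f x) (f z) (f y) := by
  unfold Bt at h
  rw [openSegment_eq_image_lineMap] at h
  obtain ⟨t, ⟨h0, h1⟩, h⟩ := h
  have : f (AffineMap.lineMap (x : E) (y : E) t) = (1 - t) * f x + t * f y := by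
    rw [AffineMap.apply_lineMap, AffineMap.lineMap_apply]; simp; ring
  rw [← h, this]
  exact btw_combo h0 h1

theorem Opp.exists_zero (hT : Convex ℝ T) {f : E →ᵃ[ℝ] ℝ} {x y : T} (h : Opp (f x) (f y)) :
    ∃ z, Bt x z y ∧ f z = 0 := by
  have hne : f x - f y ≠ 0 := by rcases h with ⟨h, h'⟩ | ⟨h, h'⟩ <;> intro h2 <;> linarith
  have hlm : ∀ t : ℝ, f (AffineMap.lineMap (x : E) (y : E) t) = (1 - t) * f x + t * f y := by
    intro t; rw [AffineMap.apply_lineMap, AffineMap.lineMap_apply]; simp; ring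
  have hz : AffineMap.lineMap (x : E) (y : E) (f x / (f x - f y)) ∈ openSegment ℝ (x : E) y := by
    rw [openSegment_eq_image_lineMap]
    refine ⟨_, ?_, rfl⟩
    rcases h with ⟨h, h'⟩ | ⟨h, h'⟩
    · exact ⟨div_pos h (by linarith), by rw [div_lt_one (by linarith)]; linarith⟩
    · exact ⟨div_pos_of_neg_of_neg h (by linarith), by
        rw [div_lt_one_of_neg (by linarith)]; linarith⟩
  refine ⟨⟨_, hT.openSegment_subset x.2 y.2 hz⟩, hz, ?_⟩
  rw [hlm]; field_simp; ring

theorem Bt.trans {x u z y : T} (h : Bt x u z) (h' : Bt x z y) : Bt x u y := by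
  obtain ⟨a, b, ha, hb, hab, h⟩ := h
  obtain ⟨c, d, hc, hd, hcd, h'⟩ := h'
  refine ⟨a + b * c, b * d, by positivity, by positivity, ?_, ?_⟩
  · linear_combination hab + b * hcd
  · rw [← h, ← h']; module

theorem Bt.tail {x u z y : T} (h : Bt x u z) (h' : Bt x z y) : Bt u z y := by
  obtain ⟨a, b, ha, hb, hab, h⟩ := h
  obtain ⟨c, d, hc, hd, hcd, h'⟩ := h'
  have hD : 0 < a * d + c := by positivity
  refine ⟨c / (a * d + c), a * d / (a * d + c), by positivity, by positivity, ?_, ?_⟩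
  · field_simp; ring
  · have hy : (y : E) = d⁻¹ • ((z : E) - c • (x : E)) := by
      rw [← h']; simp [hd.ne']
    rw [← h, hy]
    obtain rfl : b = 1 - a := by linarith
    obtain rfl : c = 1 - d := by linarith
    match_scalars <;> (field_simp; ring)

/-- `X` is a proper convex combination of `A`, `B` and `C`. -/
def Inn (A B C X : T) : Prop :=
  ∃ α β γ : ℝ, 0 < α ∧ 0 < β ∧ 0 < γ ∧ α + β + γ = 1 ∧
    (X : E) = α • (A : E) + β • (B : E) + γ • (C : E)

theorem Inn.rotate {A B C X : T} (h : Inn A B C X) : Inn B C A X := by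
  obtain ⟨α, β, γ, ha, hb, hc, h1, h⟩ := h
  exact ⟨β, γ, α, hb, hc, ha, by linarith, by rw [h]; abel⟩

theorem Inn.swap {A B C X : T} (h : Inn A B C X) : Inn C B A X := by
  obtain ⟨α, β, γ, ha, hb, hc, h1, h⟩ := h
  exact ⟨γ, β, α, hc, hb, ha, by linarith, by rw [h]; abel⟩

theorem affine_combo3 (f : E →ᵃ[ℝ] ℝ) (A B C : E) {α β γ : ℝ} (h : α + β + γ = 1) :
    f (α • A + β • B + γ • C) = α * f A + β * f B + γ * f C := by
  have e : ∀ x, f x = f.linear x + f 0 := fun x => by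
    have := f.map_vadd 0 x; simpa using this
  rw [e, e A, e B, e C]; simp only [map_add, map_smul, smul_eq_mul]
  linear_combination -h * f 0

theorem Bt.inn {A B C x y X : T} (hx : Bt A x B) (hy : Bt A y C) (hX : Bt x X y) :
    Inn A B C X := by
  obtain ⟨a, b, ha, hb, hab, h⟩ := hx
  obtain ⟨c, d, hc, hd, hcd, h'⟩ := hy
  obtain ⟨e, f, he, hf, hef, h''⟩ := hX
  refine ⟨e * a + f * c, e * b, f * d, by positivity, by positivity, by positivity, ?_, ?_⟩
  · linear_combination e * hab + f * hcd + hef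
  · rw [← h'', ← h, ← h']; module

/-- A line through an interior point separating `A` from `B` and `C` meets the two sides at `A`. -/
theorem Inn.exists_feet (hT : Convex ℝ T) {A B C X : T} (hX : Inn A B C X) {f : E →ᵃ[ℝ] ℝ}
    (h0 : f X = 0) (hB : Opp (f A) (f B)) (hC : Opp (f A) (f C)) :
    ∃ x y, Bt A x B ∧ Bt A y C ∧ Bt x X y ∧ f x = 0 ∧ f y = 0 := by
  obtain ⟨α, β, γ, ha, hb, hc, h1, h⟩ := hX
  have hfX : α * f A + β * f B + γ * f C = 0 := by
    rw [← affine_combo3 f _ _ _ h1, ← h, h0]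
  have key : ∀ (Y : T), Opp (f A) (f Y) → f A ≠ 0 ∧ f A - f Y ≠ 0 ∧ 0 < f A / (f A - f Y) ∧
      0 < -f Y / (f A - f Y) ∧ 0 < (f A - f Y) / f A := by
    intro Y hY
    rcases hY with ⟨h, h'⟩ | ⟨h, h'⟩
    · have : 0 < f A - f Y := by linarith
      exact ⟨h.ne', this.ne', div_pos h this, div_pos (by linarith) this, div_pos this h⟩
    · have : f A - f Y < 0 := by linarith
      exact ⟨h.ne, this.ne, div_pos_of_neg_of_neg h this, div_pos_of_neg_of_neg (by linarith) this,
        div_pos_of_neg_of_neg this h⟩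
  have foot : ∀ (Y : T), Opp (f A) (f Y) → ∃ x : T, Bt A x Y ∧ f x = 0 ∧
      (x : E) = (-f Y / (f A - f Y)) • (A : E) + (f A / (f A - f Y)) • (Y : E) := by
    intro Y hY
    obtain ⟨k0, k1, k2, k3, k4⟩ := key Y hY
    have hs : -f Y / (f A - f Y) + f A / (f A - f Y) = 1 := by field_simp; ring
    have hz : (-f Y / (f A - f Y)) • (A : E) + (f A / (f A - f Y)) • (Y : E) ∈
        openSegment ℝ (A : E) Y := ⟨_, _, k3, k2, hs, rfl⟩
    refine ⟨⟨_, hT.openSegment_subset A.2 Y.2 hz⟩, hz, ?_, rfl⟩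
    have := affine_combo3 f (A : E) (Y : E) (Y : E) (α := -f Y / (f A - f Y))
      (β := f A / (f A - f Y)) (γ := 0) (by linarith)
    rw [zero_smul, add_zero] at this
    show f _ = 0
    rw [this]; field_simp; ring
  obtain ⟨x, hx, hx0, hx'⟩ := foot B hB
  obtain ⟨y, hy, hy0, hy'⟩ := foot C hC
  obtain ⟨k0, k1, -, -, k4⟩ := key B hB
  obtain ⟨-, l1, -, -, l4⟩ := key C hC
  refine ⟨x, y, hx, hy, ⟨β * ((f A - f B) / f A), γ * ((f A - f C) / f A), by positivity,
    by positivity, ?_, ?_⟩, hx0, hy0⟩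
  · field_simp; linear_combination f A * h1 - hfX
  · rw [hx', hy', h]
    have hα : α = -(β * f B + γ * f C) / f A := by field_simp; linarith
    rw [hα]
    match_scalars <;> (field_simp; try ring)

theorem opp_of_zero {a b c : ℝ} (h : Btw a c b) (hc : c = 0) (h0 : a ≠ 0 ∨ b ≠ 0) : Opp a b := by
  subst hc; unfold Btw Opp at *
  rcases lt_trichotomy a 0 with h1 | h1 | h1 <;> rcases lt_trichotomy b 0 with h2 | h2 | h2 <;> grind

theorem opp_of_ne {f : E →ᵃ[ℝ] ℝ} {x z y : T} (h : Bt x z y) (hz : f z = 0) (hx : f x ≠ 0) :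
    Opp (f x) (f y) := opp_of_zero (h.btw f) hz (Or.inl hx)

theorem Bt.zero {f : E →ᵃ[ℝ] ℝ} {x z y : T} (h : Bt x z y) (hx : f x = 0) (hy : f y = 0) :
    f z = 0 := (h.btw f).2.2.2.2.2.2.2.2 hx hy

theorem opp_trichotomy {a b c : ℝ} (h : Opp a b) (hc : c ≠ 0) : Opp a c ∨ Opp b c := by
  unfold Opp at *; rcases hc.lt_or_gt with h | h <;> tauto

theorem opp_of_not {a b c : ℝ} (h : Opp a b) (hc : c ≠ 0) (h' : ¬ Opp b c) : Opp a c := by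
  exact (opp_trichotomy h hc).resolve_right h'

theorem opp_opp {a b c : ℝ} (h : Opp a b) (h' : Opp b c) : ¬ Opp a c := by
  unfold Opp at *; grind

theorem btw_ne {a b c : ℝ} (h : Btw a c b) (ha : a = 0) : c ≠ 0 ↔ b ≠ 0 := by
  subst ha; unfold Btw at h
  rcases lt_trichotomy b 0 with hb | hb | hb <;> rcases lt_trichotomy c 0 with hc | hc | hc <;> grind

theorem Bt.ne_of_left {f : E →ᵃ[ℝ] ℝ} {x z y : T} (h : Bt x z y) (hx : f x = 0)
    (hy : f y ≠ 0) : f z ≠ 0 := (btw_ne (h.btw f) hx).2 hy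

theorem Bt.ne_of_right {f : E →ᵃ[ℝ] ℝ} {x z y : T} (h : Bt x z y) (hx : f x ≠ 0)
    (hy : f y = 0) : f z ≠ 0 := h.symm.ne_of_left hy hx

theorem Bt.eq_of_self {x z : T} (h : Bt x z x) : z = x := by
  obtain ⟨u, v, hu, hv, huv, h⟩ := h
  rw [← add_smul, huv, one_smul] at h; exact Subtype.ext h.symm

theorem Inn.eval {A B C X : T}
    (h : Inn A B C X) (f : E →ᵃ[ℝ] ℝ) :
    ∃ α β γ : ℝ, 0 < α ∧ 0 < β ∧ 0 < γ ∧ f X = α * f A + β * f B + γ * f C := by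
  obtain ⟨α, β, γ, ha, hb, hc, h1, h⟩ := h
  exact ⟨α, β, γ, ha, hb, hc, by rw [h, affine_combo3 f _ _ _ h1]⟩

theorem Inn.ne_zero {A B C X : T}
    (h : Inn A B C X) {f : E →ᵃ[ℝ] ℝ} (hA : f A ≠ 0) (hB : f B = 0) (hC : f C = 0) : f X ≠ 0 := by
  obtain ⟨α, β, γ, ha, -, -, h⟩ := h.eval f
  rw [h, hB, hC]
  simp [ha.ne', hA]

/-- An abstract arrangement of initial lines `L i` and blocking lines `G g` over a convex set `T`,
satisfying the incidence conditions of a triangle blocking arrangement. -/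
structure LineSystem {E : Type*} [AddCommGroup E] [Module ℝ E] (T : Set E) (ι κ : Type*) where
  conv : Convex ℝ T
  L : ι → E →ᵃ[ℝ] ℝ
  G : κ → E →ᵃ[ℝ] ℝ
  proper : ι → Prop
  two : ∀ (i j : ι) (p q : T), p ≠ q → L i p = 0 → L i q = 0 → L j p = 0 → L j q = 0 → i = j
  conc : ∀ (i j k : ι) (p : T), L i p = 0 → L j p = 0 → L k p = 0 → i = j ∨ i = k ∨ j = k
  block_ex : ∀ (i j : ι) (p : T), i ≠ j → proper i → L i p = 0 → L j p = 0 → ∃ g, G g p = 0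
  block_un : ∀ (i j : ι) (g h : κ) (p : T), i ≠ j → L i p = 0 → L j p = 0 →
    G g p = 0 → G h p = 0 → g = h
  second : ∀ (i : ι) (g : κ) (p : T), L i p = 0 → G g p = 0 → ∃ j, i ≠ j ∧ L j p = 0
  gl : ∀ (i : ι) (g : κ) (p q : T), p ≠ q → L i p = 0 → L i q = 0 → G g p = 0 → G g q = 0 → False
  sep_proper : ∀ (i : ι) (p q : T), Opp (L i p) (L i q) → proper i
  strong : ∀ (i j k l : ι) (g : κ) (v u w X : T), i ≠ j → k ≠ i → l ≠ j →
    L i v = 0 → L j v = 0 → L i u = 0 → L k u = 0 → L j w = 0 → L l w = 0 →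
    (∀ n, ¬ Opp (L n v) (L n u)) → (∀ n, ¬ Opp (L n v) (L n w)) →
    G g v = 0 → Opp (G g u) (G g w) → L k X = 0 → G g X = 0 → L l X = 0

namespace LineSystem

variable {E : Type*} [AddCommGroup E] [Module ℝ E] {T : Set E} {ι κ : Type*}
  (S : LineSystem T ι κ)

/-- No initial line separates `x` and `y`. -/
def Emp (x y : T) : Prop := ∀ n, ¬ Opp (S.L n x) (S.L n y)

/-- A blocking line through `v` separates `u` and `w`. -/
def Bl (v u w : T) : Prop := ∃ g, S.G g v = 0 ∧ Opp (S.G g u) (S.G g w)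

/-- The line `n` separates `A` from `B` and from `C`. -/
def Cut (n : ι) (A B C : T) : Prop := Opp (S.L n A) (S.L n B) ∧ Opp (S.L n A) (S.L n C)

/-- The lines `p`, `q`, `r` support the sides of the triangle `A B C` opposite to its corners. -/
structure Tri (A B C : T) (p q r : ι) : Prop where
  pA : S.L p A ≠ 0
  pB : S.L p B = 0
  pC : S.L p C = 0
  qA : S.L q A = 0
  qB : S.L q B ≠ 0
  qC : S.L q C = 0
  rA : S.L r A = 0
  rB : S.L r B = 0
  rC : S.L r C ≠ 0

variable {S}

theorem Emp.symm {x y : T} (h : S.Emp x y) : S.Emp y x := fun n hn => h n hn.symm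

theorem Bl.symm {v u w : T} (h : S.Bl v u w) : S.Bl v w u := by
  obtain ⟨g, h0, h1⟩ := h; exact ⟨g, h0, h1.symm⟩

theorem Cut.symm {n : ι} {A B C : T} (h : S.Cut n A B C) : S.Cut n A C B := ⟨h.2, h.1⟩

theorem Tri.rotate {A B C : T} {p q r : ι} (h : S.Tri A B C p q r) : S.Tri B C A q r p :=
  ⟨h.qB, h.qC, h.qA, h.rB, h.rC, h.rA, h.pB, h.pC, h.pA⟩

theorem Tri.swap {A B C : T} {p q r : ι} (h : S.Tri A B C p q r) : S.Tri C B A r q p :=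
  ⟨h.rC, h.rB, h.rA, h.qC, h.qB, h.qA, h.pC, h.pB, h.pA⟩

theorem Tri.ne_AB {A B C : T} {p q r : ι} (h : S.Tri A B C p q r) : A ≠ B := by
  rintro rfl; exact h.pA h.pB

theorem Tri.ne_pq {A B C : T} {p q r : ι} (h : S.Tri A B C p q r) : p ≠ q := by
  rintro rfl; exact h.pA h.qA

theorem two' {i j : ι} (hij : i ≠ j) {p q : T} (h1 : S.L i p = 0)
    (h2 : S.L i q = 0) (h3 : S.L j p = 0) (h4 : S.L j q = 0) : p = q := by
  by_contra h; exact hij (S.two i j p q h h1 h2 h3 h4)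

theorem ne_of_opp {f : E →ᵃ[ℝ] ℝ} {x y : T} (h : Opp (f x) (f y)) : x ≠ y := by
  rintro rfl; unfold Opp at h; grind

/-- Along a segment of an initial line, separating initial lines correspond to separating
blocking lines. -/
theorem exists_equiv (e : ι) {x y : T} (hxy : x ≠ y) (hx : S.L e x = 0) (hy : S.L e y = 0) :
    Nonempty ({n // Opp (S.L n x) (S.L n y)} ≃ {g // Opp (S.G g x) (S.G g y)}) := by
  let Rl : {n // Opp (S.L n x) (S.L n y)} → {g // Opp (S.G g x) (S.G g y)} → Prop :=
    fun n g => ∃ z, Bt x z y ∧ S.L n.1 z = 0 ∧ S.G g.1 z = 0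
  have h1 : ∀ n, ∃ g, Rl n g := by
    rintro ⟨n, hn⟩
    obtain ⟨z, hz, hz0⟩ := hn.exists_zero S.conv
    have hne : n ≠ e := by rintro rfl; exact hn.ne_left hx
    obtain ⟨g, hg⟩ := S.block_ex n e z hne (S.sep_proper n x y hn) hz0 ((hz.btw _).2.2.2.2.2.2.2.2 hx hy)
    refine ⟨⟨g, opp_of_zero (hz.btw _) hg ?_⟩, z, hz, hz0, hg⟩
    by_contra! h
    exact S.gl e g x y hxy hx hy h.1 h.2
  have h2 : ∀ g, ∃ n, Rl n g := by
    rintro ⟨g, hg⟩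
    obtain ⟨z, hz, hz0⟩ := hg.exists_zero S.conv
    obtain ⟨n, hn, hnz⟩ := S.second e g z ((hz.btw _).2.2.2.2.2.2.2.2 hx hy) hz0
    refine ⟨⟨n, opp_of_zero (hz.btw _) hnz ?_⟩, z, hz, hnz, hz0⟩
    by_contra! h
    exact hn (S.two e n x y hxy hx hy h.1 h.2)
  have h3 : ∀ n n' g, Rl n g → Rl n' g → n = n' := by
    rintro ⟨n, hn⟩ ⟨n', hn'⟩ ⟨g, hg⟩ ⟨z, hz, h1, h2⟩ ⟨z', hz', h1', h2'⟩
    have he := (hz.btw _).2.2.2.2.2.2.2.2 hx hy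
    have he' := (hz'.btw _).2.2.2.2.2.2.2.2 hx hy
    have : z = z' := by
      by_contra h; exact S.gl e g z z' h he he' h2 h2'
    subst this
    rcases S.conc n n' e z h1 h1' he with h | h | h
    · exact Subtype.ext h
    · subst h; exact absurd hx hn.ne_left
    · subst h; exact absurd hx hn'.ne_left
  have h4 : ∀ n g g', Rl n g → Rl n g' → g = g' := by
    rintro ⟨n, hn⟩ ⟨g, hg⟩ ⟨g', hg'⟩ ⟨z, hz, h1, h2⟩ ⟨z', hz', h1', h2'⟩
    have he := (hz.btw _).2.2.2.2.2.2.2.2 hx hy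
    have he' := (hz'.btw _).2.2.2.2.2.2.2.2 hx hy
    have hne : n ≠ e := by rintro rfl; exact hn.ne_left hx
    have : z = z' := two' hne h1 h1' he he'
    subst this
    exact Subtype.ext (S.block_un n e g g' z hne h1 he h2 h2')
  choose f hf using h1
  choose f' hf' using h2
  exact ⟨⟨f, f', fun n => h3 _ _ _ (hf' _) (hf _), fun g => h4 _ _ _ (hf _) (hf' _)⟩⟩

/-- No block crosses a segment of an initial line that no initial line crosses. -/
theorem Emp.not_opp {e : ι} {x y : T} (h : S.Emp x y) (hx : S.L e x = 0) (hy : S.L e y = 0)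
    (g : κ) : ¬ Opp (S.G g x) (S.G g y) := by
  intro hg
  obtain ⟨φ⟩ := exists_equiv e (ne_of_opp hg) hx hy
  exact h _ (φ.symm ⟨g, hg⟩).2

theorem Emp.not_bl {e : ι} {x y v : T} (h : S.Emp x y) (hx : S.L e x = 0) (hy : S.L e y = 0) :
    ¬ S.Bl v x y := fun ⟨g, _, hg⟩ => h.not_opp hx hy g hg

open Classical in
/-- Indicator of a proposition, as an integer. -/
def ind (P : Prop) : ℤ := if P then 1 else 0

@[simp] theorem ind_true : ind True = 1 := by simp [ind]

@[simp] theorem ind_false : ind False = 0 := by simp [ind]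

theorem ind_card [Fintype ι] [Fintype κ] (e : ι) {x y : T} (hxy : x ≠ y) (hx : S.L e x = 0)
    (hy : S.L e y = 0) :
    ∑ n, ind (Opp (S.L n x) (S.L n y)) = ∑ g, ind (Opp (S.G g x) (S.G g y)) := by
  classical
  obtain ⟨φ⟩ := exists_equiv e hxy hx hy
  have := Fintype.card_congr φ
  unfold ind
  rw [Finset.sum_boole, Finset.sum_boole, ← Fintype.card_subtype, ← Fintype.card_subtype, this]

theorem opp_sum {a b c : ℝ} (ha : a ≠ 0) (hb : b ≠ 0) (hc : c ≠ 0) :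
    ind (Opp a b) + ind (Opp b c) - ind (Opp a c) = 2 * ind (Opp b a ∧ Opp b c) := by
  unfold ind Opp
  rcases ha.lt_or_gt with h1 | h1 <;> rcases hb.lt_or_gt with h2 | h2 <;>
    rcases hc.lt_or_gt with h3 | h3 <;>
    simp [h1, h2, h3, h1.not_gt, h2.not_gt, h3.not_gt]

theorem not_opp_zero_left (b : ℝ) : ¬ Opp 0 b := fun h => h.ne_left rfl
theorem not_opp_zero_right (b : ℝ) : ¬ Opp b 0 := fun h => h.ne_right rfl

theorem sum_bl [Fintype κ] {i j : ι} {v u w : T} (hij : i ≠ j) (hi : S.L i v = 0)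
    (hj : S.L j v = 0) :
    ∑ g, ind (S.G g v = 0 ∧ Opp (S.G g u) (S.G g w)) = ind (S.Bl v u w) := by
  classical
  by_cases h : S.Bl v u w
  · obtain ⟨g, hg⟩ := h
    rw [Finset.sum_eq_single g]
    · have : S.Bl v u w := ⟨g, hg⟩
      simp [hg, this]
    · intro b _ hb
      have : ¬ S.G b v = 0 := fun h => hb (S.block_un i j b g v hij hi hj h hg.1)
      simp [this]
    · simp
  · rw [Finset.sum_eq_zero]
    · simp [h]
    · intro g _
      have : ¬ (S.G g v = 0 ∧ Opp (S.G g u) (S.G g w)) := fun hg => h ⟨g, hg⟩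
      simp [this]

/-- The counting identity for a triangle `A B C`. -/
theorem Tri.count [Fintype ι] [Fintype κ] {A B C : T} {p q r : ι} (h : S.Tri A B C p q r) :
    2 * ∑ n, ind (S.Cut n B A C) = ind (S.Bl A B C) + ind (S.Bl C A B) - ind (S.Bl B A C) +
      2 * ∑ g, ind (Opp (S.G g B) (S.G g A) ∧ Opp (S.G g B) (S.G g C)) := by
  have hAB := h.ne_AB
  have hBC := h.rotate.ne_AB
  have hCA := h.rotate.rotate.ne_AB
  have hpq := h.ne_pq
  have hqr := h.rotate.ne_pq
  have hrp := h.rotate.rotate.ne_pq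
  obtain ⟨pA, pB, pC, qA, qB, qC, rA, rB, rC⟩ := h
  have e1 : ∀ n, ind (Opp (S.L n A) (S.L n B)) + ind (Opp (S.L n B) (S.L n C)) -
      ind (Opp (S.L n A) (S.L n C)) = 2 * ind (S.Cut n B A C) := by
    intro n
    by_cases hA : S.L n A = 0
    · rcases S.conc n q r A hA qA rA with rfl | rfl | h
      · simp [Cut, qA, qC, not_opp_zero_left, not_opp_zero_right]
      · simp [Cut, rA, rB, not_opp_zero_left, not_opp_zero_right]
      · exact absurd h hqr
    by_cases hB : S.L n B = 0
    · rcases S.conc n p r B hB pB rB with rfl | rfl | h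
      · simp [Cut, pB, pC, not_opp_zero_left, not_opp_zero_right]
      · simp [Cut, rA, rB, not_opp_zero_left, not_opp_zero_right]
      · exact absurd h.symm hrp
    by_cases hC : S.L n C = 0
    · rcases S.conc n p q C hC pC qC with rfl | rfl | h
      · simp [Cut, pB, pC, not_opp_zero_left, not_opp_zero_right]
      · simp [Cut, qA, qC, not_opp_zero_left, not_opp_zero_right]
      · exact absurd h hpq
    exact opp_sum hA hB hC
  have e2 : ∀ g, ind (Opp (S.G g A) (S.G g B)) + ind (Opp (S.G g B) (S.G g C)) -
      ind (Opp (S.G g A) (S.G g C)) = ind (S.G g A = 0 ∧ Opp (S.G g B) (S.G g C)) +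
      ind (S.G g C = 0 ∧ Opp (S.G g A) (S.G g B)) - ind (S.G g B = 0 ∧ Opp (S.G g A) (S.G g C)) +
      2 * ind (Opp (S.G g B) (S.G g A) ∧ Opp (S.G g B) (S.G g C)) := by
    intro g
    by_cases hA : S.G g A = 0
    · have hB : S.G g B ≠ 0 := fun hB => S.gl r g A B hAB rA rB hA hB
      have hC : S.G g C ≠ 0 := fun hC => S.gl q g C A hCA qC qA hC hA
      simp [hA, hB, hC, not_opp_zero_left, not_opp_zero_right]
    by_cases hB : S.G g B = 0
    · have hC : S.G g C ≠ 0 := fun hC => S.gl p g B C hBC pB pC hB hC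
      simp [hA, hB, hC, not_opp_zero_left, not_opp_zero_right]
    by_cases hC : S.G g C = 0
    · simp [hA, hB, hC, not_opp_zero_right]
    rw [opp_sum hA hB hC]; simp [hA, hB, hC]
  have s1 := ind_card r hAB rA rB
  have s2 := ind_card p hBC pB pC
  have s3 := ind_card q hCA.symm qA qC
  have t1 := Finset.sum_congr (rfl : (Finset.univ : Finset ι) = _) fun n _ => e1 n
  have t2 := Finset.sum_congr (rfl : (Finset.univ : Finset κ) = _) fun g _ => e2 g
  simp only [Finset.sum_add_distrib, Finset.sum_sub_distrib, ← Finset.mul_sum] at t1 t2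
  rw [sum_bl hqr qA rA, sum_bl hrp.symm pB rB, sum_bl hpq pC qC] at t2
  linarith

/-- The number of internally blocked corners of a triangle is even. -/
theorem Tri.parity [Fintype ι] [Fintype κ] {A B C : T} {p q r : ι} (h : S.Tri A B C p q r) :
    (S.Bl A B C ↔ S.Bl C A B) ↔ ¬ S.Bl B A C := by
  have := h.count
  unfold ind at this
  by_cases h1 : S.Bl A B C <;> by_cases h2 : S.Bl B A C <;> by_cases h3 : S.Bl C A B <;>
    simp only [h1, h2, h3, if_true, if_false] at this ⊢ <;> first | (exfalso; omega) | tauto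

theorem Tri.exists_cut [Fintype ι] [Fintype κ] {A B C : T} {p q r : ι} (h : S.Tri A B C p q r)
    (hA : S.Bl A B C) (hC : S.Bl C A B) : ∃ n, S.Cut n B A C := by
  by_contra! hn
  have := h.count
  have hpos : 0 ≤ ∑ g, ind (Opp (S.G g B) (S.G g A) ∧ Opp (S.G g B) (S.G g C)) :=
    Finset.sum_nonneg fun g _ => by unfold ind; split_ifs <;> norm_num
  rw [Finset.sum_eq_zero fun n _ => by simp [hn n]] at this
  have hB : ind (S.Bl B A C) ≤ 1 := by unfold ind; split_ifs <;> norm_num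
  have hA : ind (S.Bl A B C) = 1 := by simp [hA]
  have hC : ind (S.Bl C A B) = 1 := by simp [hC]
  linarith

theorem exists_block {i j : ι} (hij : i ≠ j) {x y v : T} (h : Opp (S.L i x) (S.L i y))
    (hi : S.L i v = 0) (hj : S.L j v = 0) : ∃ g, S.G g v = 0 :=
  S.block_ex i j v hij (S.sep_proper i x y h) hi hj

/-- If an initial or blocking function vanishes at `v`, its sign is constant along a ray. -/
theorem bl_ray {v u u' w : T} (h : Bt v u u') : S.Bl v u w ↔ S.Bl v u' w := by
  unfold Bl
  refine exists_congr fun g => and_congr_right fun hv => ?_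
  have := h.btw (S.G g)
  rw [hv] at this
  unfold Btw Opp at *
  grind

theorem bl_xor {i j : ι} {v u u' w : T} (hb : ∃ g, S.G g v = 0) (hiv : S.L i v = 0)
    (hjv : S.L j v = 0) (h : Bt u v u') (huv : v ≠ u) (hu : S.L i u = 0)
    (hw : S.L j w = 0) (hwv : v ≠ w) (hij : i ≠ j) :
    S.Bl v u w ↔ ¬ S.Bl v u' w := by
  obtain ⟨g, hg⟩ := hb
  have hun : ∀ h, S.G h v = 0 → h = g := fun h hh => S.block_un i j h g v hij hiv hjv hh hg
  have h1 : S.G g u ≠ 0 := fun h => S.gl i g v u huv hiv hu hg h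
  have h2 : S.G g w ≠ 0 := fun h => S.gl j g v w hwv hjv hw hg h
  have h3 := opp_of_ne h hg h1
  unfold Bl
  constructor
  · rintro ⟨g1, hg1, k1⟩ ⟨g2, hg2, k2⟩
    obtain rfl := hun g1 hg1
    obtain rfl := hun g2 hg2
    exact opp_opp h3 k2 k1
  · intro h4
    refine ⟨g, hg, opp_of_not h3 h2 fun h5 => h4 ⟨g, hg, h5⟩⟩

/-- The next vertex on the initial line `i` from `v` towards `w`. -/
theorem exists_next [Fintype ι] {i : ι} {v w : T} (hvw : w ≠ v) (hv : S.L i v = 0)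
    (hw : S.L i w = 0) {k₀ : ι} (hk₀ : k₀ ≠ i) (hkw : S.L k₀ w = 0) :
    ∃ (k : ι) (r : T), k ≠ i ∧ S.L k r = 0 ∧ S.L i r = 0 ∧ (r = w ∨ Bt v r w) ∧ S.Emp v r ∧ r ≠ v := by
  classical
  induction hN : (Finset.univ.filter fun n => Opp (S.L n v) (S.L n w)).card
    using Nat.strong_induction_on generalizing w k₀ with
  | _ N ih =>
    by_cases hE : S.Emp v w
    · exact ⟨k₀, w, hk₀, hkw, hw, Or.inl rfl, hE, hvw⟩
    unfold Emp at hE; push Not at hE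
    obtain ⟨n, hn⟩ := hE
    obtain ⟨z, hz, hz0⟩ := hn.exists_zero S.conv
    have hzv : z ≠ v := by rintro rfl; exact hn.ne_left hz0
    have hni : n ≠ i := by rintro rfl; exact hn.ne_left hv
    obtain ⟨k, r, h1, h2, h3, h4, h5⟩ := ih _ (by
      rw [← hN]
      refine Finset.card_lt_card (Finset.ssubset_iff_of_subset ?_ |>.2 ⟨n, ?_, ?_⟩)
      · intro m hm
        simp only [Finset.mem_filter, Finset.mem_univ, true_and] at hm ⊢
        have := hz.btw (S.L m)
        unfold Opp Btw at *; grind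
      · simpa using hn
      · simp [hz0, not_opp_zero_right]) hzv (Bt.zero hz hv hw) hni hz0 rfl
    exact ⟨k, r, h1, h2, h3, Or.inr (by rcases h4 with rfl | h4; exacts [hz, h4.trans hz]), h5⟩

theorem strong' {i j k l : ι} {g : κ} {v u w X : T} (hij : i ≠ j) (hki : k ≠ i) (hlj : l ≠ j)
    (hiv : S.L i v = 0) (hjv : S.L j v = 0) (hiu : S.L i u = 0) (hku : S.L k u = 0)
    (hjw : S.L j w = 0) (hlw : S.L l w = 0) (hu : S.Emp v u) (hw : S.Emp v w)
    (hg : S.G g v = 0) (ho : Opp (S.G g u) (S.G g w)) (hX : S.G g X = 0) :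
    S.L k X = 0 ↔ S.L l X = 0 :=
  ⟨fun h => S.strong i j k l g v u w X hij hki hlj hiv hjv hiu hku hjw hlw hu hw hg ho h hX,
   fun h => S.strong j i l k g v w u X hij.symm hlj hki hjv hiv hjw hlw hiu hku hw hu hg ho.symm
    h hX⟩

/-- The block through `v` passes through the intersection of the far lines of its wedge. -/
theorem block_through {i j k l : ι} {g : κ} {v u w x : T} (hij : i ≠ j) (hki : k ≠ i) (hlj : l ≠ j)
    (hkl : k ≠ l)
    (hiv : S.L i v = 0) (hjv : S.L j v = 0) (hiu : S.L i u = 0) (hku : S.L k u = 0)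
    (hjw : S.L j w = 0) (hlw : S.L l w = 0) (hu : S.Emp v u) (hw : S.Emp v w)
    (hg : S.G g v = 0) (ho : Opp (S.G g u) (S.G g w)) (hkx : S.L k x = 0) (hlx : S.L l x = 0) :
    S.G g x = 0 := by
  by_contra hx
  have key : ∀ z : T, S.L k z = 0 → S.L l z = 0 → S.G g z ≠ 0 := fun z h1 h2 hz =>
    hx (two' hkl h1 hkx h2 hlx ▸ hz)
  have hs : ∀ X : T, S.G g X = 0 → (S.L k X = 0 ↔ S.L l X = 0) := fun X hX =>
    strong' hij hki hlj hiv hjv hiu hku hjw hlw hu hw hg ho hX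
  rcases opp_trichotomy ho hx with h | h
  · obtain ⟨z, hz, hz0⟩ := h.exists_zero S.conv
    have h1 := Bt.zero hz hku hkx
    exact key z h1 ((hs z hz0).1 h1) hz0
  · obtain ⟨z, hz, hz0⟩ := h.exists_zero S.conv
    have h1 := Bt.zero hz hlw hlx
    exact key z ((hs z hz0).2 h1) h1 hz0

theorem Emp.trans {c a : ι} (hca : c ≠ a) {P r r' : T} (hcP : S.L c P = 0) (haP : S.L a P = 0)
    (har : S.L a r = 0) (hcr : S.L c r' = 0) (h : S.Emp P r) (h' : S.Emp P r') : S.Emp r r' := by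
  intro n hn
  by_cases hP : S.L n P = 0
  · rcases S.conc n c a P hP hcP haP with rfl | rfl | h
    · exact hn.ne_right hcr
    · exact hn.ne_left har
    · exact hca h
  · rcases opp_trichotomy hn hP with h1 | h1
    · exact h n h1.symm
    · exact h' n h1.symm

theorem corner_block {e c a g k' : ι} {X x1 P r r' s : T}
    (hec : e ≠ c) (hca : c ≠ a) (hag : a ≠ g) (hcg : c ≠ g) (heg : e ≠ g) (hka : k' ≠ a)
    (heX : S.L e X = 0) (hgX : S.L g X = 0) (hex : S.L e x1 = 0) (hcx : S.L c x1 = 0)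
    (hcP : S.L c P = 0) (haP : S.L a P = 0) (hgr : S.L g r = 0) (har : S.L a r = 0)
    (hgr' : S.L g r' = 0) (hcr' : S.L c r' = 0) (hXr : Bt X r r') (hXr' : r ≠ X)
    (hPr : S.Emp P r) (hPr' : S.Emp P r') (hXe : S.Emp X r)
    (hPs : Bt P r s) (hrP : r ≠ P) (hrs : S.Emp r s) (has : S.L a s = 0) (hks : S.L k' s = 0)
    (hes : S.L e s ≠ 0) (hb : ∃ b, S.G b r = 0) : False := by
  obtain ⟨b, hb⟩ := hb
  have hbP : S.G b P ≠ 0 := fun h => S.gl a b r P hrP har haP hb h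
  have hbX : S.G b X ≠ 0 := fun h => S.gl g b r X hXr' hgr hgX hb h
  have hbs := opp_of_ne hPs hb hbP
  have hbr := opp_of_ne hXr hb hbX
  have hPX : Opp (S.G b P) (S.G b X) := by
    refine (opp_of_not hbr hbP ?_).symm
    exact fun h => hPr'.not_opp hcP hcr' b h.symm
  have hbx : S.G b x1 = 0 :=
    block_through hag hca heg hec.symm har hgr haP hcP hgX heX hPr.symm hXe.symm hb hPX hcx hex
  have hrr : S.Emp r r' := hPr.trans hca hcP haP har hcr' hPr'
  have ho : Opp (S.G b s) (S.G b r') := by unfold Opp at *; grind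
  have := (strong' hag hka hcg har hgr has hks hgr' hcr' hrs hrr hb ho hbx).2 hcx
  rcases S.conc k' c e x1 this hcx hex with rfl | rfl | h
  · have := two' hca hcP hks haP has
    subst this
    exact hbs.ne_left (by have := hPs.btw (S.G b); unfold Btw Opp at *; grind)
  · exact hes hks
  · exact hec h.symm

variable (S) in
/-- Two initial lines crossing inside `A B C` either both separate `A` or both separate `C` from
the other two corners. -/
def NoCross (A B C : T) : Prop := ∀ (m n : ι) (X : T), m ≠ n → S.L m X = 0 → S.L n X = 0 →
  Inn A B C X → (S.Cut m A B C ∧ S.Cut n A B C) ∨ (S.Cut m C A B ∧ S.Cut n C A B)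

theorem wedge [Fintype ι] {A h h' x1 P r r' : T} {a d e c g g' : ι}
    (ht : S.Tri A h h' a d e) (hK : S.NoCross A h h') (hx1 : Bt A x1 h) (hP : Bt h P h')
    (hcx : S.L c x1 = 0) (hcP : S.L c P = 0) (hch : S.Cut c h A h')
    (hxh : S.Emp h x1) (hPh : S.Emp h P)
    (hga : g ≠ a) (hgr : S.L g r = 0) (hr : r = h' ∨ Bt P r h') (hPr : S.Emp P r) (hrP : r ≠ P)
    (hgc : g' ≠ c) (hgr' : S.L g' r' = 0) (hcr' : S.L c r' = 0) (hr' : Bt x1 P r')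
    (hPr' : S.Emp P r') (hdr : S.L d r' ≠ 0) (hrP' : r' ≠ P) :
    Bt P r h' ∧ S.Cut g h' A h := by
  have hex : S.L e x1 = 0 := Bt.zero hx1 ht.rA ht.rB
  have haP : S.L a P = 0 := Bt.zero hP ht.pB ht.pC
  have heP : S.L e P ≠ 0 := hP.ne_of_left ht.rB ht.rC
  have hdP : S.L d P ≠ 0 := hP.ne_of_right ht.qB ht.qC
  have hax : S.L a x1 ≠ 0 := hx1.ne_of_right ht.pA ht.pB
  have hce : c ≠ e := by rintro rfl; exact heP hcP
  have hca : c ≠ a := by rintro rfl; exact hax hcx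
  have hae : a ≠ e := ht.rotate.rotate.ne_pq.symm
  have hPx : P ≠ x1 := by rintro rfl; exact heP hex
  have hgx' : r' ≠ x1 := by
    rintro rfl; exact hPx hr'.eq_of_self
  have hge' : g' ≠ e := by
    rintro rfl; exact hgx' (two' hce hcr' hcx hgr' hex)
  obtain ⟨b, hb⟩ := exists_block hca hch.1 hcP haP
  have hbh : S.G b h ≠ 0 := fun k => S.gl a b h P (by
    rintro rfl; exact heP ht.rB) ht.pB haP k hb
  have hbh' : Opp (S.G b h) (S.G b h') := opp_of_ne hP hb hbh
  have hbx : S.G b x1 ≠ 0 := fun k => S.gl c b x1 P hPx.symm hcx hcP k hb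
  have hbx' : Opp (S.G b x1) (S.G b h') :=
    (opp_of_not hbh'.symm hbx (hxh.not_opp ht.rB hex b)).symm
  have hbr' : Opp (S.G b x1) (S.G b r') := opp_of_ne hr' hb hbx
  have hbhr : Opp (S.G b h) (S.G b r') := by
    have := hxh.not_opp ht.rB hex b
    exact (opp_of_not hbr'.symm hbh fun k => this k.symm).symm
  have hPx1 : S.Emp P x1 := hPh.trans hae.symm ht.rB ht.pB haP hex hxh
  rcases hr with rfl | hr
  · exfalso
    have hbA : S.G b A = 0 := block_through (x := A) hca hce.symm ht.ne_pq.symm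
      ht.rotate.ne_pq.symm hcP haP hcx hex ht.pC ht.qC hPx1 hPr hb hbx' ht.rA ht.qA
    have := (strong' hca.symm hae.symm hgc haP hcP ht.pB ht.rB hcr' hgr' hPh.symm hPr' hb hbhr
      hbA).1 ht.rA
    rcases S.conc g' e d A this ht.rA ht.qA with h | rfl | h
    · exact hge' h
    · exact hdr hgr'
    · exact ht.rotate.ne_pq h.symm
  have hra : S.L a r = 0 := Bt.zero hr haP ht.pC
  have her : S.L e r ≠ 0 := by
    have h1 := hP.btw (S.L e); have h2 := hr.btw (S.L e)
    have := ht.rB; have := ht.rC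
    unfold Btw at *; grind
  have hdr2 : S.L d r ≠ 0 := hr.ne_of_right hdP ht.qC
  have hgA : S.L g A ≠ 0 := fun k => by
    rcases S.conc g e d A k ht.rA ht.qA with rfl | rfl | h
    · exact her hgr
    · exact hdr2 hgr
    · exact ht.rotate.ne_pq h.symm
  have hgh : S.L g h ≠ 0 := fun k => her (by
    rw [two' hga hgr k hra ht.pB]; exact ht.rB)
  have hhr : Bt h r h' := (hr.symm.trans hP.symm).symm
  have hghh : Opp (S.L g h) (S.L g h') := opp_of_ne hhr hgr hgh
  refine ⟨hr, ?_⟩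
  by_contra hcut
  have hAh : Opp (S.L g h) (S.L g A) := by
    rcases opp_trichotomy hghh hgA with h | h
    · exact h
    · exact absurd ⟨h, hghh.symm⟩ hcut
  obtain ⟨X, hX, hgX⟩ := hAh.exists_zero S.conv
  have heX : S.L e X = 0 := Bt.zero hX ht.rB ht.rA
  have hge : g ≠ e := by rintro rfl; exact her hgr
  have hgc2 : c ≠ g := by
    rintro rfl; exact hrP (two' hga hgr hcP hra haP)
  have hbr : Opp (S.G b x1) (S.G b r) := by
    have := hbh'.symm; have := hr.btw (S.G b); unfold Btw Opp at *; grind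
  have hbX : S.G b X = 0 := block_through hca hce.symm hga hge.symm hcP haP hcx hex hra hgr
    hPx1 hPr hb hbr heX hgX
  have := (strong' hca.symm hae.symm hgc haP hcP ht.pB ht.rB hcr' hgr' hPh.symm hPr' hb hbhr
      hbX).1 heX
  have hgg : g' = g := by
    rcases S.conc g' e g X this heX hgX with h | h | h
    · exact absurd h hge'
    · exact h
    · exact absurd h.symm hge
  subst hgg
  have haX : Opp (S.L a X) (S.L a r') := by
    have h1 := hX.btw (S.L a); have h2 := hx1.btw (S.L a)
    have h3 := opp_of_ne hr' haP hax
    have := ht.pA; have := ht.pB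
    unfold Btw Opp at *; grind
  obtain ⟨z, hz, hz0⟩ := haX.exists_zero S.conv
  have : z = r := two' hga (Bt.zero hz hgX hgr') hgr hz0 hra
  subst this
  have hEXr : S.Emp X z := by
    intro n hn
    obtain ⟨y, hy, hy0⟩ := hn.exists_zero S.conv
    have hin : Inn A h h' y := (Bt.inn hX hhr hy).rotate.rotate.swap
    have hng : n ≠ g' := by rintro rfl; exact hn.ne_left hgX
    rcases hK n g' y hng hy0 (Bt.zero hy hgX hgr) hin with h | h
    · exact opp_opp hghh.symm hAh h.2.2.symm
    · exact hcut h.2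
  obtain ⟨k', s, h1, h2, h3, h4, h5, h6⟩ := exists_next (S := S) (i := a) (v := z) (w := h')
    (by rintro rfl; exact hghh.ne_right hgr) hra ht.pC (k₀ := d) ht.ne_pq.symm ht.qC
  have hPs : Bt P z s := by
    rcases h4 with rfl | h4
    · exact hr
    · exact (h4.symm.tail hr.symm).symm
  have hes : S.L e s ≠ 0 := by
    rcases h4 with rfl | h4
    · exact ht.rC
    · have h1 := hhr.btw (S.L e); have h2 := h4.btw (S.L e)
      have := ht.rB; have := ht.rC
      unfold Btw at *; grind
  exact corner_block hce.symm hca hga.symm hgc2 hge.symm h1 heX hgX hex hcx hcP haP hgr hra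
    hgr' hcr' hz (by rintro rfl; exact her heX) hPr hPr' hEXr hPs hrP h5 h3 h2 hes
    (exists_block hga hghh hgr hra)

open Classical in
variable (S) in
/-- The number of initial lines crossing the triangle `A B C`. -/
def meas [Fintype ι] (A B C : T) : ℕ := (Finset.univ.filter fun n =>
  Opp (S.L n A) (S.L n B) ∨ Opp (S.L n B) (S.L n C) ∨ Opp (S.L n C) (S.L n A)).card

theorem meas_rotate [Fintype ι] (A B C : T) : S.meas B C A = S.meas A B C := by
  unfold meas; congr 1; ext n; simp only [Finset.mem_filter]; tauto

theorem meas_swap [Fintype ι] (A B C : T) : S.meas C B A = S.meas A B C := by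
  unfold meas; congr 1; ext n; simp only [Finset.mem_filter]
  have : ∀ a b : ℝ, Opp a b ↔ Opp b a := fun a b => ⟨Opp.symm, Opp.symm⟩
  rw [this (S.L n C), this (S.L n B) (S.L n A), this (S.L n A) (S.L n C)]; tauto

theorem meas_sub [Fintype ι] {A B C x y : T} {a : ι} (hx : Bt A x B) (hy : Bt A y C)
    (hax : S.L a x = 0) (hay : S.L a y = 0) (ha : S.Cut a A B C) :
    S.meas A x y < S.meas A B C := by
  classical
  unfold meas
  refine Finset.card_lt_card (Finset.ssubset_iff_of_subset ?_ |>.2 ⟨a, ?_, ?_⟩)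
  · intro n hn
    simp only [Finset.mem_filter, Finset.mem_univ, true_and] at hn ⊢
    have h1 := hx.btw (S.L n)
    have h2 := hy.btw (S.L n)
    generalize S.L n A = u at *
    generalize S.L n B = v at *
    generalize S.L n C = w at *
    generalize S.L n x = x at *
    generalize S.L n y = y at *
    unfold Opp Btw at *
    rcases hn with (h | h) | (h | h) | (h | h) <;> grind
  · simp only [Finset.mem_filter, Finset.mem_univ, true_and]; exact Or.inl ha.1
  · simp [hax, hay, not_opp_zero_right, not_opp_zero_left]

theorem Tri.sub {A B C x y : T} {p q r a : ι} (h : S.Tri A B C p q r)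
    (hx : Bt A x B) (hy : Bt A y C)
    (hax : S.L a x = 0) (hay : S.L a y = 0) (ha : S.Cut a A B C) : S.Tri A x y a q r :=
  ⟨ha.1.ne_left, hax, hay, h.qA, hx.ne_of_left h.qA h.qB, Bt.zero hy h.qA h.qC,
    h.rA, Bt.zero hx h.rA h.rB, hy.ne_of_left h.rA h.rC⟩

variable (S) in
/-- The base corners `A` and `C` of the triangle `A B C` are internally blocked, and all smaller
such triangles satisfy the crossing property. -/
structure Based [Fintype ι] (A B C : T) (p q r : ι) : Prop where
  tri : S.Tri A B C p q r
  blA : S.Bl A B C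
  blC : S.Bl C A B
  ih : ∀ (A' B' C' : T) (p' q' r' : ι), S.meas A' B' C' < S.meas A B C → S.Tri A' B' C' p' q' r' →
    S.Bl A' B' C' → S.Bl C' A' B' → S.NoCross A' B' C'

theorem Based.swap [Fintype ι] {A B C : T} {p q r : ι} (h : S.Based A B C p q r) :
    S.Based C B A r q p :=
  ⟨h.tri.swap, h.blC.symm, h.blA.symm, fun A' B' C' p' q' r' hm =>
    h.ih A' B' C' p' q' r' (by rwa [meas_swap A B C] at hm)⟩

variable (S) in
/-- A configuration of a line `a` cutting off `A` and a line `c` cutting off `C` that cross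
at `P` inside the triangle `A B C`. -/
structure Cross (A B C : T) (a c : ι) (a1 a2 b1 b2 P : T) : Prop where
  ha1 : Bt A a1 B
  ha2 : Bt A a2 C
  hb2 : Bt C b2 B
  hb1 : Bt C b1 A
  hPa : Bt a1 P a2
  hPc : Bt b2 P b1
  hb : Bt A b1 a2
  ha : Bt C a2 b1
  aa1 : S.L a a1 = 0
  aa2 : S.L a a2 = 0
  aP : S.L a P = 0
  cb1 : S.L c b1 = 0
  cb2 : S.L c b2 = 0
  cP : S.L c P = 0
  cuta : S.Cut a A B C
  cutc : S.Cut c C B A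

theorem Cross.swap {A B C : T} {a c : ι} {a1 a2 b1 b2 P : T}
    (h : S.Cross A B C a c a1 a2 b1 b2 P) : S.Cross C B A c a b2 b1 a2 a1 P :=
  ⟨h.hb2, h.hb1, h.ha1, h.ha2, h.hPc, h.hPa, h.ha, h.hb, h.cb2, h.cb1, h.cP, h.aa2, h.aa1, h.aP,
    h.cutc, h.cuta⟩

theorem exists_cross {A B C : T} {a c : ι} {a2 : T} (cuta : S.Cut a A B C) (cutc : S.Cut c C B A)
    (ha2 : Bt A a2 C) (ha : S.L a a2 = 0) (ho : Opp (S.L c A) (S.L c a2)) :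
    ∃ a1 b1 b2 P, S.Cross A B C a c a1 a2 b1 b2 P := by
  obtain ⟨a1, ha1, ha1'⟩ := cuta.1.exists_zero S.conv
  obtain ⟨b1, hb1, hb1'⟩ := ho.exists_zero S.conv
  obtain ⟨b2, hb2, hb2'⟩ := cutc.1.exists_zero S.conv
  have h1 := ha1.btw (S.L c)
  have ho' : Opp (S.L c a1) (S.L c a2) := by
    have := cutc.1; have := cutc.2; unfold Opp Btw at *; grind
  obtain ⟨P, hP, hP'⟩ := ho'.exists_zero S.conv
  have haP := Bt.zero hP ha1' ha
  have hac : a ≠ c := by rintro rfl; exact ho'.ne_left ha1'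
  have hbC := hb1.tail ha2
  have ho2 : Opp (S.L a b2) (S.L a b1) := by
    have h1 := hb1.btw (S.L a); have h2 := hb2.btw (S.L a); have h3 := ha2.btw (S.L a)
    have := cuta.1; have := cuta.2; unfold Opp Btw at *; grind
  obtain ⟨P', hP2, hP2'⟩ := ho2.exists_zero S.conv
  obtain rfl : P' = P := two' hac hP2' haP (Bt.zero hP2 hb2' hb1') hP'
  exact ⟨a1, b1, b2, P', ha1, ha2, hb2, (hb1.trans ha2).symm, hP, hP2, hb1, hbC.symm,
    ha1', ha, haP, hb1', hb2', hP', cuta, cutc⟩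

section Cross

variable {A B C : T} {p q r a c : ι} {a1 a2 b1 b2 P : T}

theorem Cross.oppA (h : S.Cross A B C a c a1 a2 b1 b2 P) : Opp (S.L c A) (S.L c a2) := by
  have h2 := h.hb.btw (S.L c); have := h.cutc.1
  have := h.cutc.2; have := h.cb1
  unfold Opp Btw at *; grind

theorem Cross.opp1 (h : S.Cross A B C a c a1 a2 b1 b2 P) : Opp (S.L c a1) (S.L c a2) := by
  have h1 := h.ha1.btw (S.L c); have h2 := h.oppA; have := h.cutc.1
  have := h.cutc.2
  unfold Opp Btw at *; grind

theorem Cross.ne (h : S.Cross A B C a c a1 a2 b1 b2 P) : a ≠ c := by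
  rintro rfl; exact h.opp1.ne_left h.aa1

theorem Cross.triA (h : S.Cross A B C a c a1 a2 b1 b2 P) (ht : S.Tri A B C p q r) :
    S.Tri A a1 a2 a q r := ht.sub h.ha1 h.ha2 h.aa1 h.aa2 h.cuta

theorem Cross.triP (h : S.Cross A B C a c a1 a2 b1 b2 P) (ht : S.Tri A B C p q r) :
    S.Tri P b1 a2 q a c := by
  have h1 := h.triA ht
  have h2 := h.swap.triA ht.swap
  exact ⟨h.hPa.ne_of_right h1.qB h1.qC, h2.qC, h1.qC, h.aP, h.hb.ne_of_right h1.pA h1.pC, h.aa2,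
    h.cP, h.cb1, h.opp1.ne_right⟩

theorem Cross.blA [Fintype ι] (h : S.Cross A B C a c a1 a2 b1 b2 P)
    (hB : S.Based A B C p q r) : S.Bl A a1 a2 := by
  rw [bl_ray h.ha1]; exact ((bl_ray h.ha2).2 hB.blA.symm).symm

theorem Cross.ray (h : S.Cross A B C a c a1 a2 b1 b2 P) : S.Bl a2 P b1 ↔ S.Bl a2 a1 A := by
  rw [bl_ray h.hPa.symm]
  constructor
  · exact fun k => ((bl_ray h.hb.symm).1 k.symm).symm
  · exact fun k => ((bl_ray h.hb.symm).2 k.symm).symm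

theorem Cross.ray' (h : S.Cross A B C a c a1 a2 b1 b2 P) : S.Bl b1 P a2 ↔ S.Bl b1 b2 C :=
  h.swap.ray

theorem Cross.noCross [Fintype ι] (h : S.Cross A B C a c a1 a2 b1 b2 P)
    (hB : S.Based A B C p q r) (ha : S.Bl a2 a1 A) : S.NoCross A a1 a2 :=
  hB.ih _ _ _ _ _ _ (meas_sub h.ha1 h.ha2 h.aa1 h.aa2 h.cuta) (h.triA hB.tri) (h.blA hB) ha.symm

theorem Cross.noCross' [Fintype ι] [Fintype κ] (h : S.Cross A B C a c a1 a2 b1 b2 P)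
    (hB : S.Based A B C p q r) (ha : ¬ S.Bl a2 a1 A) : S.Bl a1 A a2 ∧ S.NoCross A a2 a1 := by
  have hA := h.blA hB
  have hpar := (h.triA hB.tri).parity
  have h1 : S.Bl a1 A a2 := by
    have : ¬ S.Bl a2 A a1 := fun k => ha k.symm
    tauto
  refine ⟨h1, hB.ih _ _ _ _ _ _ ?_ (h.triA hB.tri).swap.rotate.rotate hA.symm h1⟩
  rw [← meas_swap, meas_rotate]
  exact meas_sub h.ha1 h.ha2 h.aa1 h.aa2 h.cuta

theorem Cross.cutA (h : S.Cross A B C a c a1 a2 b1 b2 P) {n : ι}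
    (hK : S.NoCross A a1 a2) {X : T} (hX : Bt b1 X P) (hn : S.L n X = 0) (hnc : n ≠ c) :
    S.Cut n a2 A a1 := by
  have hin : Inn A a1 a2 X := (Bt.inn h.hb.symm h.hPa.symm hX).rotate
  rcases hK n c X hnc hn (Bt.zero hX h.cb1 h.cP) hin with k | k
  · exact absurd k.2.1 (opp_opp h.oppA h.opp1.symm)
  · exact k.1

/-- The crossing triangle cannot have its two base corners blocked. -/
theorem Cross.false_of_blocked [Fintype ι] [Fintype κ] (hB : S.Based A B C p q r)
    (h : S.Cross A B C a c a1 a2 b1 b2 P)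
    (ha : S.Bl a2 a1 A) (hc : S.Bl b1 b2 C) : False := by
  obtain ⟨n, hn⟩ := (h.triP hB.tri).swap.rotate.exists_cut (h.ray'.2 hc) (h.ray.2 ha).symm
  obtain ⟨z, hz, hz0⟩ := hn.1.exists_zero S.conv
  obtain ⟨z', hz', hz0'⟩ := hn.2.exists_zero S.conv
  have h1 := h.cutA (h.noCross hB ha) hz.symm hz0
    (by rintro rfl; exact hn.1.ne_left h.cP)
  have h2 := h.swap.cutA (h.swap.noCross hB.swap hc) hz'.symm hz0'
    (by rintro rfl; exact hn.1.ne_left h.aP)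
  have h3 := h.hb.btw (S.L n)
  have h4 := h.hb1.btw (S.L n)
  have := hn.1; have := hn.2; have := h1.1; have := h2.1
  clear hn h1 h2
  unfold Opp Btw at *; grind

/-- In the unblocked case, the sides at `P` are crossed by no initial line. -/
theorem Cross.emp [Fintype ι] [Fintype κ] (hB : S.Based A B C p q r)
    (h : S.Cross A B C a c a1 a2 b1 b2 P) (ha : ¬ S.Bl a2 a1 A) : S.Emp b1 P := by
  intro n hn
  obtain ⟨X, hX, hX0⟩ := hn.exists_zero S.conv
  have hin : Inn A a2 a1 X := (Bt.inn h.hb.symm h.hPa.symm hX).rotate.rotate.swap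
  rcases (h.noCross' hB ha).2 n c X (by rintro rfl; exact hn.ne_left h.cb1) hX0
    (Bt.zero hX h.cb1 h.cP) hin with k | k
  · have := k.2.2; have := h.oppA; have := h.opp1; unfold Opp at *; grind
  · have := k.2.1; have := h.oppA; have := h.opp1; unfold Opp at *; grind

end Cross

section

variable {A B C : T} {p q r a c : ι} {a1 a2 b1 b2 P : T}

theorem Cross.exists_wedge [Fintype ι] [Fintype κ] (hB : S.Based A B C p q r)
    (h : S.Cross A B C a c a1 a2 b1 b2 P) (he : S.Emp b1 a2)
    (ha : ¬ S.Bl a2 a1 A) (hc : ¬ S.Bl b1 b2 C) :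
    ∃ (g : ι) (y : T), g ≠ a ∧ S.L g y = 0 ∧ S.L a y = 0 ∧ S.Emp P y ∧ Bt P y a1 ∧ S.Cut g a1 A a2 := by
  have hT := (h.triA hB.tri).swap.rotate.rotate
  have hT' := (h.swap.triA hB.tri.swap)
  have hrP : S.L r P ≠ 0 := h.hPa.ne_of_left hT.qC hT.qB
  obtain ⟨g, y, hga, hgy, hay, hy, hPy, hyP⟩ := exists_next (S := S) (i := a) (v := P) (w := a1)
    (by rintro rfl; exact h.opp1.ne_left h.cP) h.aP h.aa1 (k₀ := r) hT.ne_pq.symm hT.qC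
  obtain ⟨g', y', hgc, hgy', hcy, hy', hPy', hyP'⟩ := exists_next (S := S) (i := c) (v := P)
    (w := b2) (by rintro rfl; exact h.swap.opp1.ne_left h.aP) h.cP h.cb2 (k₀ := p)
    hT'.rotate.rotate.ne_pq hT'.rB
  have hrb2 : S.L r b2 ≠ 0 := h.hb2.ne_of_right hB.tri.rC hB.tri.rB
  have hr' : Bt b1 P y' := by
    rcases hy' with rfl | k
    · exact h.hPc.symm
    · exact (k.symm.tail h.hPc).symm
  have hry : S.L r y' ≠ 0 := by
    rcases hy' with rfl | k
    · exact hrb2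
    · have h1 := k.btw (S.L r); have h2 := h.hPa.btw (S.L r); have h3 := h.hb2.btw (S.L r)
      have h4 := h.ha2.btw (S.L r)
      have := hB.tri.rA; have := hB.tri.rB; have := hB.tri.rC; have := hT.qA; have := hT.qC
      unfold Btw at *; grind
  obtain ⟨h1, h2⟩ := wedge hT (h.noCross' hB ha).2 h.hb h.hPa.symm h.cb1 h.cP
    ⟨h.oppA.symm, h.opp1.symm⟩ he.symm (h.swap.emp hB.swap hc) hga hgy hy hPy hyP hgc hgy' hcy hr'
    hPy' hry hyP'
  exact ⟨g, y, hga, hgy, hay, hPy, h1, h2⟩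


/-- Opposite wedges at the crossing point: the line `g` does not separate `A` and `C`. -/
theorem Cross.wedge_same [Fintype ι] [Fintype κ] (hB : S.Based A B C p q r)
    (h : S.Cross A B C a c a1 a2 b1 b2 P) (he : S.Emp b1 a2)
    (ha : ¬ S.Bl a2 a1 A) (hc : ¬ S.Bl b1 b2 C) {g g' : ι} {y y' : T}
    (hga : g ≠ a) (hgy : S.L g y = 0) (hay : S.L a y = 0) (hPy : S.Emp P y) (hy : Bt P y a1)
    (hg : S.Cut g a1 A a2)
    (hgc' : g' ≠ c) (hgy' : S.L g' y' = 0) (hcy' : S.L c y' = 0) (hPy' : S.Emp P y')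
    (hy' : Bt P y' b2) (hg' : S.Cut g' b2 C b1) : ¬ Opp (S.L g A) (S.L g C) := by
  intro hC
  have hT := h.triA hB.tri
  have hgP : Opp (S.L g P) (S.L g a1) := by
    have h1 := hy.btw (S.L g); have := hg.1; unfold Opp Btw at *; grind
  have hgB : Opp (S.L g A) (S.L g B) := by
    have h1 := h.ha1.btw (S.L g); have := hg.1; unfold Opp Btw at *; grind
  have hgq : g ≠ q := by rintro rfl; exact hg.2.ne_right hT.qC
  obtain ⟨b, hb⟩ := exists_block h.ne h.cuta.1 h.aP h.cP
  have hba2 : S.G b a2 ≠ 0 := fun k => S.gl a b a2 P (by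
    rintro rfl; exact h.opp1.ne_right h.cP) h.aa2 h.aP k hb
  have hbb1 : S.G b b1 ≠ 0 := fun k => S.gl c b b1 P (by
    rintro rfl; exact h.swap.opp1.ne_right h.aP) h.cb1 h.cP k hb
  have hqb1 : S.L q b1 = 0 := Bt.zero h.hb hT.qA hT.qC
  have hbs := he.not_opp hqb1 hT.qC b
  have hcq : c ≠ q := by rintro rfl; exact h.cutc.1.ne_left hB.tri.qC
  have haq : a ≠ q := hT.ne_pq
  have hgb2 : Opp (S.L g P) (S.L g b2) := by
    have h1 := h.hb2.btw (S.L g); have := hg.1; have := hg.2; unfold Opp Btw at *; grind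
  have hgC : Opp (S.L g a2) (S.L g C) := by
    have := hg.1; have := hg.2; unfold Opp at *; grind
  obtain ⟨u, hu, hu0⟩ := hgb2.exists_zero S.conv
  obtain ⟨w, hw, hw0⟩ := hgC.exists_zero S.conv
  have hby' : Opp (S.G b a2) (S.G b y') := by
    have h1 := hy'.btw (S.G b); have h2 := opp_of_ne h.hPc.symm hb hbb1
    unfold Opp Btw at *; grind
  have hby : Opp (S.G b b1) (S.G b y) := by
    have h1 := hy.btw (S.G b); have h2 := opp_of_ne h.hPa.symm hb hba2
    unfold Opp Btw at *; grind
  have hbC : ¬ Opp (S.G b a2) (S.G b C) := by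
    intro hbC
    obtain ⟨X, hX, hX0⟩ := hbC.exists_zero S.conv
    have h1 := (strong' h.ne haq.symm hgc' h.aP h.cP h.aa2 hT.qC hcy' hgy'
      (h.swap.emp hB.swap hc).symm hPy' hb hby' hX0).1 (Bt.zero hX hT.qC hB.tri.qC)
    have h2 := hX.btw (S.L g'); have h3 := h.ha.btw (S.L g')
    have := hg'.1; have := hg'.2
    unfold Opp Btw at *; grind
  have hbuw : Opp (S.G b u) (S.G b w) := by
    have h1 := hw.btw (S.G b); have h2 := hu.btw (S.G b)
    have h3 := opp_of_ne h.hPc.symm hb hbb1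
    unfold Opp Btw at *; grind
  obtain ⟨z, hz, hz0⟩ := hbuw.exists_zero S.conv
  have hgz : S.L g z = 0 := Bt.zero hz hu0 hw0
  have hqz := (strong' h.ne.symm hcq.symm hga h.cP h.aP h.cb1 hqb1 hay hgy
    (h.emp hB ha).symm hPy hb hby hz0).2 hgz
  have : z = w := two' hgq hgz hw0 hqz (Bt.zero hw hT.qC hB.tri.qC)
  subst this
  exact hbuw.ne_right hz0

theorem Cross.wedge_not_cut [Fintype ι] [Fintype κ] (hB : S.Based A B C p q r)
    (h : S.Cross A B C a c a1 a2 b1 b2 P)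
    (ha : ¬ S.Bl a2 a1 A) (hc : ¬ S.Bl b1 b2 C) {g : ι} {y : T}
    (hgy : S.L g y = 0) (hay : S.L a y = 0) (hPy : S.Emp P y) (hy : Bt P y a1)
    (hg : S.Cut g a1 A a2) : ¬ S.Cut g B A C := by
  intro hgB
  have hPa2 := (h.swap.emp hB.swap hc).symm
  obtain ⟨hbl, hK⟩ := h.noCross' hB ha
  have hT := h.triA hB.tri
  obtain ⟨v, hv, hv0⟩ := hg.1.symm.exists_zero S.conv
  obtain ⟨w, hw, hw0⟩ := hgB.2.exists_zero S.conv
  have hya : Bt a1 y a2 := hy.symm.trans h.hPa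
  have hTX : S.Tri a1 v y g a r := ⟨hg.1.ne_left, hv0, hgy, h.aa1, hv.ne_of_right hT.pA h.aa1,
    hay, hT.rB, Bt.zero hv hT.rA hT.rB, hya.ne_of_left hT.rB hT.rC⟩
  have hX1 : S.Bl a1 v y := by
    rw [bl_ray hv.symm]; exact ((bl_ray hya).2 hbl.symm).symm
  have key : ∀ n z, n ≠ g → Bt v z y → S.L n z = 0 → S.Cut n a1 A a2 := by
    intro n z hng hz hz0
    rcases hK n g z hng hz0 (Bt.zero hz hv0 hgy) (Bt.inn hv.symm hya hz).rotate with k | k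
    · exact absurd k.2.1 (opp_opp hg.1.symm hg.2)
    · exact k.1
  by_cases hX2 : S.Bl y a1 v
  · obtain ⟨n, hn⟩ := hTX.exists_cut hX1 hX2
    obtain ⟨z, hz, hz0⟩ := hn.2.exists_zero S.conv
    have hnc := key n z (by rintro rfl; exact hn.1.ne_left hv0) hz hz0
    have hnP : S.L n P = 0 := by
      by_contra k
      have h1 := hPy n; have h2 := hPa2 n
      have := hn.1; have := hn.2; have := hnc.1; have := hnc.2
      clear hn hnc
      rcases lt_or_gt_of_ne k with k | k <;> (unfold Opp at *; grind)
    rcases S.conc n a c P hnP h.aP h.cP with rfl | rfl | k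
    · exact hn.2.ne_right hay
    · have := hnc.1; have := hnc.2; have := h.oppA; unfold Opp at *; grind
    · exact h.ne k
  · have hX3 : S.Bl v a1 y := by
      have := hTX.parity; tauto
    obtain ⟨n, hn⟩ := hTX.swap.rotate.rotate.exists_cut hX1.symm hX3
    obtain ⟨z, hz, hz0⟩ := hn.2.exists_zero S.conv
    have hnc := key n z (by rintro rfl; exact hn.1.ne_left hgy) hz.symm hz0
    have havw : Opp (S.L a v) (S.L a w) := by
      have h1 := hv.btw (S.L a); have h2 := hw.btw (S.L a); have := h.aa1
      have := h.cuta.1; have := h.cuta.2; unfold Opp Btw at *; grind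
    obtain ⟨y', hy', hay'⟩ := havw.exists_zero S.conv
    have hga : g ≠ a := by rintro rfl; exact hg.1.ne_left h.aa1
    obtain rfl : y' = y := two' hga (Bt.zero hy' hv0 hw0) hgy hay' hay
    have hvB : Bt v a1 B := hv.tail h.ha1
    have hvA : Bt A v B := hv.trans h.ha1
    have hTv : S.Tri v B w p g r := ⟨hvA.ne_of_right hB.tri.pA hB.tri.pB, hB.tri.pB,
      Bt.zero hw hB.tri.pB hB.tri.pC, hv0, hgB.1.ne_left, hw0, Bt.zero hvA hB.tri.rA hB.tri.rB,
      hB.tri.rB, hw.ne_of_left hB.tri.rB hB.tri.rC⟩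
    have hY1 : S.Bl v B w := by
      rw [← bl_ray hvB]; exact ((bl_ray hy').1 hX3.symm).symm
    have hY2 : ¬ S.Bl B v w := by
      rw [bl_ray hvA.symm]
      intro k
      have := hB.tri.parity; have := hB.blA; have := hB.blC
      have := (bl_ray hw).1 k.symm
      have := this.symm
      tauto
    have hY3 : S.Bl w v B := by
      have := hTv.parity; tauto
    have hm : S.meas v B w < S.meas A B C := by
      rw [← meas_rotate v B w, ← meas_rotate A B C]
      exact meas_sub hw hvA.symm hw0 hv0 hgB.symm
    obtain ⟨z2, hz2, hz20⟩ := hn.1.symm.exists_zero S.conv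
    have h1 := hv.btw (S.L n); have h2 := h.ha1.btw (S.L n)
    rcases hB.ih _ _ _ _ _ _ hm hTv hY1 hY3 n a z2 (by rintro rfl; exact hn.1.ne_left hay) hz20
      (Bt.zero hz2 h.aa1 hay) (Bt.inn hvB hy' hz2) with k | k
    · have := k.1.1; have := hn.1; have := hn.2; have := hnc.1
      clear hn k hnc hg hgB
      unfold Opp Btw at *; grind
    · have := k.2.2; have := hw.btw (S.L a); have := h.cuta.1; have := h.cuta.2
      unfold Opp Btw at *; grind

/-- The crossing triangle cannot be minimal with two unblocked base corners. -/
theorem Cross.false_of_emp [Fintype ι] [Fintype κ] (hB : S.Based A B C p q r)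
    (h : S.Cross A B C a c a1 a2 b1 b2 P) (he : S.Emp b1 a2)
    (ha : ¬ S.Bl a2 a1 A) (hc : ¬ S.Bl b1 b2 C) : False := by
  obtain ⟨g, y, hga, hgy, hay, hPy, hy, hg⟩ := h.exists_wedge hB he ha hc
  obtain ⟨g', y', hgc', hgy', hcy', hPy', hy', hg'⟩ := h.swap.exists_wedge hB.swap he.symm hc ha
  have h1 := h.wedge_same hB he ha hc hga hgy hay hPy hy hg hgc' hgy' hcy' hPy' hy' hg'
  have h2 := h.wedge_not_cut hB ha hc hgy hay hPy hy hg
  have hgB : Opp (S.L g A) (S.L g B) := by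
    have h1 := h.ha1.btw (S.L g); have := hg.1; unfold Opp Btw at *; grind
  have hgC : S.L g C ≠ 0 := fun k => by
    rcases S.conc g p q C k hB.tri.pC hB.tri.qC with h1 | h1 | h1
    · subst h1; exact hgB.ne_right hB.tri.pB
    · subst h1; exact hg.2.ne_right (h.triA hB.tri).qC
    · exact hB.tri.ne_pq h1
  rcases opp_trichotomy hgB hgC with hC | hC
  · exact h1 hC
  · exact h2 ⟨hgB.symm, hC⟩

theorem Cross.exists_smaller [Fintype ι] (hB : S.Tri A B C p q r)
    (h : S.Cross A B C a c a1 a2 b1 b2 P) {n : ι} {z : T} (hn : Opp (S.L n b1) (S.L n a2))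
    (hz : Bt b1 z a2) (hz0 : S.L n z = 0) (hcut : S.Cut n A B C) :
    ∃ a1' b2' P', S.Cross A B C n c a1' z b1 b2' P' ∧
      ∀ m, Opp (S.L m b1) (S.L m z) → Opp (S.L m b1) (S.L m a2) := by
  have hbz : Bt A b1 z := (hz.symm.tail h.hb.symm).symm
  have hzC : Bt A z C := (hz.symm.trans h.hb.symm).symm.trans h.ha2
  have ho : Opp (S.L c A) (S.L c z) := opp_of_ne hbz h.cb1 h.oppA.ne_left
  obtain ⟨a1', b1', b2', P', h'⟩ := exists_cross hcut h.cutc hzC hz0 ho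
  have hcq : c ≠ q := by rintro rfl; exact h.cutc.1.ne_left hB.qC
  have hqz : S.L q z = 0 := Bt.zero hzC hB.qA hB.qC
  obtain rfl : b1' = b1 := two' hcq h'.cb1 h.cb1 (Bt.zero h'.hb hB.qA hqz)
    (Bt.zero hbz hB.qA hqz)
  refine ⟨a1', b2', P', h', fun m hm => ?_⟩
  have := hz.btw (S.L m); unfold Opp Btw at *; grind

theorem Cross.false [Fintype ι] [Fintype κ] (hB : S.Based A B C p q r)
    (h : S.Cross A B C a c a1 a2 b1 b2 P) : False := by
  classical
  induction hN : (Finset.univ.filter fun n => Opp (S.L n b1) (S.L n a2)).card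
    using Nat.strong_induction_on generalizing a c a1 a2 b1 b2 P with
  | _ N ih =>
  have hqa : S.L q a2 = 0 := (h.triA hB.tri).qC
  have hqb : S.L q b1 = 0 := Bt.zero h.hb hB.tri.qA hqa
  by_cases he : S.Emp b1 a2
  · have hp := (h.triP hB.tri).parity
    have h0 : ¬ S.Bl P b1 a2 := he.not_bl hqb hqa
    have h1 : S.Bl b1 P a2 ↔ S.Bl a2 P b1 := by
      tauto
    rw [h.ray, h.ray'] at h1
    by_cases ha : S.Bl a2 a1 A
    · exact h.false_of_blocked hB ha (h1.2 ha)
    · exact h.false_of_emp hB he ha (fun k => ha (h1.1 k))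
  · unfold Emp at he
    push Not at he
    obtain ⟨n, hn⟩ := he
    obtain ⟨z, hz, hz0⟩ := hn.exists_zero S.conv
    have hnAC : Opp (S.L n A) (S.L n C) := by
      have h1 := h.hb.btw (S.L n); have h2 := h.ha.btw (S.L n); have h3 := hz.btw (S.L n)
      unfold Opp Btw at *; grind
    have hnB : S.L n B ≠ 0 := fun k => by
      rcases S.conc n p r B k hB.tri.pB hB.tri.rB with h1 | h1 | h1
      · subst h1; exact hnAC.ne_right hB.tri.pC
      · subst h1; exact hnAC.ne_left hB.tri.rA
      · exact hB.tri.swap.rotate.rotate.ne_pq h1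
    rcases opp_trichotomy hnAC hnB with hB' | hB'
    · obtain ⟨a1', b2', P', h', hm⟩ := h.exists_smaller hB.tri hn hz hz0 ⟨hB', hnAC⟩
      refine ih _ ?_ h' rfl
      rw [← hN]
      refine Finset.card_lt_card (Finset.ssubset_iff_of_subset (fun m => ?_) |>.2 ⟨n, ?_, ?_⟩)
      · simpa using hm m
      · simpa using hn
      · simp [hz0, not_opp_zero_right]
    · obtain ⟨a1', b2', P', h', hm⟩ := h.swap.exists_smaller hB.tri.swap hn.symm hz.symm hz0
        ⟨hB', hnAC.symm⟩
      refine ih _ ?_ h'.swap rfl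
      rw [← hN]
      refine Finset.card_lt_card (Finset.ssubset_iff_of_subset (fun m => ?_) |>.2 ⟨n, ?_, ?_⟩)
      · simpa using fun k => (hm m k.symm).symm
      · simpa using hn
      · simp [hz0, not_opp_zero_left]

/-- A line cutting off `A` and a line cutting off `C` do not cross inside `A B C`. -/
theorem Based.not_cut_cut [Fintype ι] [Fintype κ] (hB : S.Based A B C p q r) {X : T}
    (hX : Inn A B C X) (ha : S.L a X = 0) (hc : S.L c X = 0) (cuta : S.Cut a A B C)
    (cutc : S.Cut c C B A) : False := by
  obtain ⟨a1, a2, ha1, ha2, hXa, haa1, haa2⟩ := hX.exists_feet S.conv ha cuta.1 cuta.2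
  have hac : a ≠ c := by rintro rfl; exact opp_opp cuta.2 cutc.1 cuta.1
  have hca1 : Opp (S.L c C) (S.L c a1) := by
    have := ha1.btw (S.L c); have := cutc.1; have := cutc.2; unfold Opp Btw at *; grind
  have hca2 := opp_of_ne hXa hc hca1.ne_right
  obtain ⟨_, _, _, _, h⟩ := exists_cross cuta cutc ha2 haa2 (by
    have := cutc.2; unfold Opp at *; grind)
  exact h.false hB

end

section

variable {A B C : T} {p q r a m : ι} {a1 a2 m1 m2 P : T}

/-- Blocking is the same in opposite sectors at a crossing. -/
theorem Bl.opposite {z u u' w w' : T} (h : S.Bl z u w) (hu : Bt u z u') (hw : Bt w z w') :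
    S.Bl z u' w' := by
  obtain ⟨b, hb, ho⟩ := h
  have h1 := opp_of_ne hu hb ho.ne_left
  have h2 := opp_of_ne hw hb ho.ne_right
  exact ⟨b, hb, by unfold Opp at *; grind⟩

theorem Based.ih_corner [Fintype ι] (hB : S.Based A B C p q r) (hbA : S.Bl A a1 a2)
    (h1 : Bt A a1 B) (h2 : Bt A a2 C) (ha1 : S.L a a1 = 0) (ha2 : S.L a a2 = 0)
    (cut : S.Cut a A B C) (hbl : S.Bl a2 A a1) : S.NoCross A a1 a2 :=
  hB.ih _ _ _ _ _ _ (meas_sub h1 h2 ha1 ha2 cut) (hB.tri.sub h1 h2 ha1 ha2 cut) hbA hbl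

/-- Among the lines with property `Q`, one meeting the segment from `y` to `v` closest to `y`. -/
theorem exists_innermost [Fintype ι] {Q : ι → Prop} {y v : T} (hex : ∃ n, Q n)
    (hQ : ∀ n, Q n → Opp (S.L n y) (S.L n v)) :
    ∃ n z, Q n ∧ Bt y z v ∧ S.L n z = 0 ∧ ∀ n', Q n' → ¬ Opp (S.L n' y) (S.L n' z) := by
  classical
  obtain ⟨n, hn⟩ := hex
  obtain ⟨z, hz, hz0⟩ := (hQ n hn).exists_zero S.conv
  induction hN : (Finset.univ.filter fun n => Opp (S.L n y) (S.L n z)).card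
    using Nat.strong_induction_on generalizing n z with
  | _ N ih =>
  by_cases h : ∀ n', Q n' → ¬ Opp (S.L n' y) (S.L n' z)
  · exact ⟨n, z, hn, hz, hz0, h⟩
  · push Not at h
    obtain ⟨n', hn', ho⟩ := h
    obtain ⟨z', hz', hz0'⟩ := ho.exists_zero S.conv
    refine ih _ ?_ n' hn' z' (hz'.trans hz) hz0' rfl
    rw [← hN]
    refine Finset.card_lt_card (Finset.ssubset_iff_of_subset (fun k => ?_) |>.2 ⟨n', ?_, ?_⟩)
    · simp only [Finset.mem_filter, Finset.mem_univ, true_and]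
      have := hz'.btw (S.L k); unfold Opp Btw at *; grind
    · simpa using ho
    · simp [hz0', not_opp_zero_right]

variable (S) in
/-- A configuration of a line `a` cutting off `A` and a line `m` cutting off `B` that cross
at `P` inside the triangle `A B C`. -/
structure CrossB (A B C : T) (a m : ι) (a1 a2 m1 m2 P : T) : Prop where
  ha1 : Bt A a1 B
  ha2 : Bt A a2 C
  hm1 : Bt B m1 A
  hm2 : Bt B m2 C
  hPa : Bt a1 P a2
  hPm : Bt m1 P m2
  hb : Bt A m1 a1
  aa1 : S.L a a1 = 0
  aa2 : S.L a a2 = 0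
  aP : S.L a P = 0
  mm1 : S.L m m1 = 0
  mm2 : S.L m m2 = 0
  mP : S.L m P = 0
  cuta : S.Cut a A B C
  cutm : S.Cut m B A C

theorem exists_crossB (cuta : S.Cut a A B C) (cutm : S.Cut m B A C)
    (ha1 : Bt A a1 B) (aa1 : S.L a a1 = 0) (ho : Opp (S.L m A) (S.L m a1)) :
    ∃ a2 m1 m2 P, S.CrossB A B C a m a1 a2 m1 m2 P := by
  obtain ⟨a2, ha2, aa2⟩ := cuta.2.exists_zero S.conv
  obtain ⟨m1, hm1, mm1⟩ := ho.exists_zero S.conv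
  obtain ⟨m2, hm2, mm2⟩ := cutm.2.exists_zero S.conv
  have ho' : Opp (S.L m a1) (S.L m a2) := by
    have := ha2.btw (S.L m); have := cutm.1; have := cutm.2; unfold Opp Btw at *; grind
  obtain ⟨P, hP, mP⟩ := ho'.exists_zero S.conv
  have aP := Bt.zero hP aa1 aa2
  have ham : a ≠ m := by rintro rfl; exact ho'.ne_left aa1
  have ho2 : Opp (S.L a m1) (S.L a m2) := by
    have h1 := hm1.btw (S.L a); have h2 := hm2.btw (S.L a)
    have := cuta.1; have := cuta.2; unfold Opp Btw at *; grind
  obtain ⟨P', hP', aP'⟩ := ho2.exists_zero S.conv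
  obtain rfl : P' = P := two' ham aP' aP (Bt.zero hP' mm1 mm2) mP
  exact ⟨a2, m1, m2, P', ha1, ha2, (hm1.trans ha1).symm, hm2, hP, hP', hm1, aa1, aa2, aP, mm1, mm2,
    mP, cuta, cutm⟩

theorem CrossB.oppA (h : S.CrossB A B C a m a1 a2 m1 m2 P) : Opp (S.L m A) (S.L m a1) := by
  have h1 := h.ha1.btw (S.L m); have h2 := h.hb.btw (S.L m); have := h.mm1; have := h.cutm.1
  unfold Opp Btw at *; grind

theorem CrossB.opp2 (h : S.CrossB A B C a m a1 a2 m1 m2 P) : Opp (S.L m a1) (S.L m a2) := by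
  have h1 := h.oppA; have h2 := h.ha2.btw (S.L m); have := h.cutm.1; have := h.cutm.2
  unfold Opp Btw at *; grind

theorem CrossB.oppa (h : S.CrossB A B C a m a1 a2 m1 m2 P) : Opp (S.L a m1) (S.L a m2) := by
  have h1 := h.hb.btw (S.L a); have h2 := h.hm2.btw (S.L a); have := h.cuta.1; have := h.cuta.2
  have := h.aa1; unfold Opp Btw at *; grind

theorem CrossB.ne (h : S.CrossB A B C a m a1 a2 m1 m2 P) : a ≠ m := by
  rintro rfl; exact h.oppA.ne_right h.aa1

theorem CrossB.triA (h : S.CrossB A B C a m a1 a2 m1 m2 P) (ht : S.Tri A B C p q r) :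
    S.Tri A a1 a2 a q r := ht.sub h.ha1 h.ha2 h.aa1 h.aa2 h.cuta

theorem CrossB.triB (h : S.CrossB A B C a m a1 a2 m1 m2 P) (ht : S.Tri A B C p q r) :
    S.Tri B m2 m1 m r p := ht.rotate.sub h.hm2 h.hm1 h.mm2 h.mm1 h.cutm.symm

theorem CrossB.triP (h : S.CrossB A B C a m a1 a2 m1 m2 P) (ht : S.Tri A B C p q r) :
    S.Tri m1 a1 P a m r :=
  ⟨h.oppa.ne_left, h.aa1, h.aP, h.mm1, h.oppA.ne_right, h.mP, (h.triB ht).qC, (h.triA ht).rB,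
    h.hPa.ne_of_left (h.triA ht).rB (h.triA ht).rC⟩

theorem CrossB.blA [Fintype ι] (h : S.CrossB A B C a m a1 a2 m1 m2 P)
    (hB : S.Based A B C p q r) : S.Bl A a1 a2 := by
  rw [bl_ray h.ha1]; exact ((bl_ray h.ha2).2 hB.blA.symm).symm

theorem CrossB.not_blB [Fintype ι] [Fintype κ] (h : S.CrossB A B C a m a1 a2 m1 m2 P)
    (hB : S.Based A B C p q r) : ¬ S.Bl B m1 m2 := by
  rw [bl_ray h.hm1]
  intro k
  have k := ((bl_ray h.hm2).1 k.symm).symm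
  have := hB.tri.parity; have := hB.blA; have := hB.blC
  tauto

theorem CrossB.ray (h : S.CrossB A B C a m a1 a2 m1 m2 P) : S.Bl a1 m1 P ↔ S.Bl a1 A a2 := by
  rw [bl_ray h.hb.symm]
  exact ⟨fun k => ((bl_ray h.hPa).1 k.symm).symm, fun k => ((bl_ray h.hPa).2 k.symm).symm⟩

theorem CrossB.ray' (h : S.CrossB A B C a m a1 a2 m1 m2 P) : S.Bl m1 a1 P ↔ S.Bl m1 B m2 := by
  rw [bl_ray (h.hb.tail h.ha1)]
  exact ⟨fun k => ((bl_ray h.hPm).1 k.symm).symm, fun k => ((bl_ray h.hPm).2 k.symm).symm⟩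

theorem CrossB.false_of_blocked [Fintype ι] [Fintype κ] (hB : S.Based A B C p q r)
    (h : S.CrossB A B C a m a1 a2 m1 m2 P)
    (h1 : S.Bl m1 a1 P) (h2 : S.Bl a1 m1 P) : False := by
  have h1' := h.ray'.1 h1
  have h2' := h.ray.1 h2
  obtain ⟨n, hn⟩ := (h.triP hB.tri).swap.rotate.rotate.exists_cut h1.symm h2
  have hTB := (h.triB hB.tri).rotate.rotate
  have hm2 : S.Bl m2 m1 B := by
    have := hTB.parity; have := h.not_blB hB; tauto
  have hKm : S.NoCross m1 B m2 := by
    refine hB.ih _ _ _ _ _ _ ?_ hTB h1' hm2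
    rw [← meas_rotate m1 B m2, ← meas_rotate A B C]
    exact meas_sub h.hm2 h.hm1 h.mm2 h.mm1 h.cutm.symm
  have hKa : S.NoCross A a2 a1 := by
    refine hB.ih _ _ _ _ _ _ ?_ (h.triA hB.tri).swap.rotate.rotate (h.blA hB).symm h2'
    rw [← meas_swap, meas_rotate]
    exact meas_sub h.ha1 h.ha2 h.aa1 h.aa2 h.cuta
  have hP1 := h.hb.tail h.ha1
  obtain ⟨z, hz, hz0⟩ := hn.2.symm.exists_zero S.conv
  obtain ⟨z', hz', hz0'⟩ := hn.1.symm.exists_zero S.conv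
  have k1 := hKm n a z (by rintro rfl; exact hn.1.ne_left h.aP) hz0 (Bt.zero hz h.aa1 h.aP)
    (Bt.inn hP1 h.hPm hz)
  have k2 := hKa n m z' (by rintro rfl; exact hn.1.ne_left h.mP) hz0' (Bt.zero hz' h.mm1 h.mP)
    (Bt.inn h.hb.symm h.hPa hz').rotate
  have hnm : Opp (S.L n m1) (S.L n B) := by
    rcases k1 with k | k
    · exact k.1.1
    · have := k.2.2; have := h.hm2.btw (S.L a); have := h.cuta.1; have := h.cuta.2
      clear k2; unfold Opp Btw at *; grind
  have hna : Opp (S.L n a1) (S.L n A) := by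
    rcases k2 with k | k
    · have := k.2.1; have := h.oppA; have := h.opp2; clear k1; unfold Opp at *; grind
    · exact k.1.1
  have h3 := hn.1; have h4 := hn.2; have h5 := h.ha1.btw (S.L n)
  clear hn
  unfold Opp Btw at *; grind

/-- In the unblocked case, the third corner is blocked and the crossing triangle is empty. -/
theorem CrossB.unblocked [Fintype ι] [Fintype κ] (hB : S.Based A B C p q r)
    (h : S.CrossB A B C a m a1 a2 m1 m2 P) (h2 : ¬ S.Bl a1 A a2) :
    S.Bl a2 A a1 ∧ S.NoCross A a1 a2 ∧ S.Emp m1 P := by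
  have h3 : S.Bl a2 A a1 := by
    have := (h.triA hB.tri).parity; have := h.blA hB; tauto
  have hK := hB.ih_corner (h.blA hB) h.ha1 h.ha2 h.aa1 h.aa2 h.cuta h3
  refine ⟨h3, hK, fun n hn => ?_⟩
  obtain ⟨z, hz, hz0⟩ := hn.exists_zero S.conv
  have := h.oppA; have := h.opp2
  rcases hK n m z (by rintro rfl; exact hn.ne_left h.mm1) hz0 (Bt.zero hz h.mm1 h.mP)
    (Bt.inn h.hb.symm h.hPa hz).rotate.rotate.swap with k | k
  · have := k.2.2; unfold Opp at *; grind
  · have := k.2.1; unfold Opp at *; grind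

theorem CrossB.exists_wedge [Fintype ι] [Fintype κ] (hB : S.Based A B C p q r)
    (h : S.CrossB A B C a m a1 a2 m1 m2 P) (he : S.Emp m1 a1) (h2 : ¬ S.Bl a1 A a2) :
    ∃ (g : ι) (y : T), g ≠ a ∧ S.L g y = 0 ∧ S.L a y = 0 ∧ S.Emp P y ∧ S.Emp P a1 ∧ Bt P y a2 ∧
      S.Cut g a2 A a1 := by
  obtain ⟨h3, hK, hm1P⟩ := h.unblocked hB h2
  have hT := h.triA hB.tri
  have hTB := h.triB hB.tri
  have hmr : m ≠ r := by rintro rfl; exact h.cutm.1.ne_left hB.tri.rB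
  have ha1P : S.Emp a1 P := (Emp.trans hmr h.mm1 hTB.qC hT.rB h.mP he hm1P)
  obtain ⟨g, y, hga, hgy, hay, hy, hPy, hyP⟩ := exists_next (S := S) (i := a) (v := P) (w := a2)
    (by rintro rfl; exact h.opp2.ne_right h.mP) h.aP h.aa2 (k₀ := q) hT.ne_pq.symm hT.qC
  obtain ⟨g', y', hgc, hgy', hcy, hy', hPy', hyP'⟩ := exists_next (S := S) (i := m) (v := P)
    (w := m2) (by rintro rfl; exact h.oppa.ne_right h.aP) h.mP h.mm2 (k₀ := p)
    hTB.rotate.rotate.ne_pq hTB.rB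
  have hr' : Bt m1 P y' := by
    rcases hy' with rfl | k
    · exact h.hPm
    · exact (k.symm.tail h.hPm.symm).symm
  have hqy : S.L q y' ≠ 0 := by
    have hm2 : S.L q m2 ≠ 0 := h.hm2.ne_of_right hB.tri.qB hB.tri.qC
    rcases hy' with rfl | k
    · exact hm2
    · have h1 := k.btw (S.L q); have h2 := h.hPa.btw (S.L q); have h3 := h.hm2.btw (S.L q)
      have h4 := h.ha1.btw (S.L q)
      have := hB.tri.qA; have := hB.tri.qB; have := hB.tri.qC; have := hT.qC
      unfold Btw at *; grind
  obtain ⟨k1, k2⟩ := wedge hT hK h.hb h.hPa h.mm1 h.mP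
    ⟨h.oppA.symm, h.opp2⟩ he.symm ha1P hga hgy hy hPy hyP hgc hgy' hcy hr' hPy' hqy hyP'
  exact ⟨g, y, hga, hgy, hay, hPy, ha1P.symm, k1, k2⟩

theorem CrossB.exists_smaller [Fintype ι] (hB : S.Tri A B C p q r)
    (h : S.CrossB A B C a m a1 a2 m1 m2 P) {n : ι} {z : T} (hn : Opp (S.L n m1) (S.L n a1))
    (hz : Bt m1 z a1) (hz0 : S.L n z = 0) (hnAB : Opp (S.L n A) (S.L n B)) (hnC : S.L n C ≠ 0) :
    ∃ a' m' a1' a2' m1' m2' P', S.CrossB A B C a' m' a1' a2' m1' m2' P' ∧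
      (∀ k, Opp (S.L k m1') (S.L k a1') → Opp (S.L k m1) (S.L k a1)) ∧
      ¬ Opp (S.L n m1') (S.L n a1') := by
  have hrm1 : S.L r m1 = 0 := (h.triB hB).qC
  have hra1 : S.L r a1 = 0 := (h.triA hB).rB
  have hrz : S.L r z = 0 := Bt.zero hz hrm1 hra1
  rcases opp_trichotomy hnAB hnC with k | k
  · have hAz : Bt A z a1 := (hz.symm.trans h.hb.symm).symm
    have hm1z : Bt A m1 z := (hz.symm.tail h.hb.symm).symm
    obtain ⟨a2', m1', m2', P', h'⟩ := exists_crossB ⟨hnAB, k⟩ h.cutm (hAz.trans h.ha1) hz0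
      (opp_of_ne hm1z h.mm1 h.oppA.ne_left)
    have hmr : m ≠ r := by rintro rfl; exact h.cutm.1.ne_left hB.rB
    obtain rfl : m1' = m1 := two' hmr h'.mm1 h.mm1 (h'.triB hB).qC hrm1
    refine ⟨n, m, z, a2', m1', m2', P', h', fun k hk => ?_, fun k => k.ne_right hz0⟩
    have := hz.btw (S.L k); unfold Opp Btw at *; grind
  · have hAz : Bt A z a1 := (hz.symm.trans h.hb.symm).symm
    obtain ⟨a2', m1', m2', P', h'⟩ := exists_crossB h.cuta ⟨hnAB.symm, k⟩ h.ha1 h.aa1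
      (by have := hAz.btw (S.L n); have := h.hb.btw (S.L n); have := h.ha1.btw (S.L n)
          unfold Opp Btw at *; grind)
    have hnr : n ≠ r := by rintro rfl; exact hnAB.ne_left hB.rA
    obtain rfl : m1' = z := two' hnr h'.mm1 hz0 (h'.triB hB).qC hrz
    refine ⟨a, n, a1, a2', m1', m2', P', h', fun k hk => ?_, fun k => k.ne_left hz0⟩
    have := hz.btw (S.L k); unfold Opp Btw at *; grind


theorem CrossB.false_of_wedge [Fintype ι] [Fintype κ] (hB : S.Based A B C p q r)
    (h : S.CrossB A B C a m a1 a2 m1 m2 P) (h2 : ¬ S.Bl a1 A a2) {g : ι} {y : T} (hga : g ≠ a)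
    (hgy : S.L g y = 0) (hay : S.L a y = 0) (hPy : S.Emp P y) (hPa1 : S.Emp P a1)
    (hy : Bt P y a2) (hg : S.Cut g a2 A a1) : False := by
  obtain ⟨h3, hK, -⟩ := h.unblocked hB h2
  have hT := h.triA hB.tri
  have hgC : Opp (S.L g C) (S.L g A) := by
    have := h.ha2.btw (S.L g); have := hg.1; have := hg.2; unfold Opp Btw at *; grind
  have hgB : S.L g B ≠ 0 := fun k => by
    rcases S.conc g p r B k hB.tri.pB hB.tri.rB with h1 | h1 | h1
    · subst h1; exact hgC.ne_left hB.tri.pC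
    · subst h1; exact hgC.ne_right hB.tri.rA
    · exact hB.tri.swap.rotate.rotate.ne_pq h1
  have hya : Bt a1 y a2 := (hy.symm.trans h.hPa.symm).symm
  rcases opp_trichotomy hgC hgB with hgB | hgB
  · exact hB.not_cut_cut (Bt.inn h.ha1 h.ha2 hya) hay hgy h.cuta ⟨hgB, hgC⟩
  obtain ⟨v, hv, hv0⟩ := hg.1.exists_zero S.conv
  have hqv : S.L q v = 0 := Bt.zero hv hT.qC hT.qA
  have hTX : S.Tri a2 v y g a q := ⟨hg.1.ne_left, hv0, hgy, h.aa2, hv.ne_of_left h.aa2 hT.pA, hay,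
    hT.qC, hqv, hya.ne_of_right hT.qB hT.qC⟩
  have hX1 : S.Bl a2 v y := by
    rw [bl_ray hv]; exact ((bl_ray hya.symm).2 h3.symm).symm
  have key : ∀ n z, n ≠ g → Bt v z y → S.L n z = 0 → S.Cut n a2 A a1 := by
    intro n z hng hz hz0
    rcases hK n g z hng hz0 (Bt.zero hz hv0 hgy) (Bt.inn hv hya.symm hz).rotate with k | k
    · exact absurd k.2.1 (opp_opp hg.1.symm hg.2)
    · exact k.1
  have hX2 : ¬ S.Bl y a2 v := by
    intro hX2
    obtain ⟨n, hn⟩ := hTX.exists_cut hX1 hX2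
    obtain ⟨z, hz, hz0⟩ := hn.2.exists_zero S.conv
    have hnc := key n z (by rintro rfl; exact hn.1.ne_left hv0) hz hz0
    have hnP : S.L n P = 0 := by
      by_contra k
      have h1 := hPy n; have h2 := hPa1 n
      have := hn.1; have := hn.2; have := hnc.1; have := hnc.2
      clear hn hnc
      rcases lt_or_gt_of_ne k with k | k <;> (unfold Opp at *; grind)
    rcases S.conc n a m P hnP h.aP h.mP with rfl | rfl | k
    · exact hn.2.ne_right hay
    · have := hnc.1; have := hnc.2; have := h.oppA; unfold Opp at *; grind
    · exact h.ne k
  have hX3 : S.Bl v a2 y := by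
    have := hTX.parity; tauto
  have hav : S.L a v ≠ 0 := hTX.qB
  have hgq : g ≠ q := by rintro rfl; exact hgC.ne_left hB.tri.qC
  have hXT := hTX.swap.rotate.rotate
  obtain ⟨n, z, hn, hz, hz0, hmin⟩ := exists_innermost (S := S) (Q := fun n => S.Cut n y a2 v)
    (hXT.exists_cut hX1.symm hX3) (fun n hn => hn.2)
  have hng : n ≠ g := by rintro rfl; exact hn.1.ne_left hgy
  have hnq : n ≠ q := by rintro rfl; exact hn.1.ne_right hT.qC
  have hna : n ≠ a := by rintro rfl; exact hn.1.ne_left hay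
  have hnc := key n z hng hz.symm hz0
  have hgz : S.L g z = 0 := Bt.zero hz hgy hv0
  obtain ⟨y2, hy2, hy20⟩ := hn.1.exists_zero S.conv
  have hay2 : S.L a y2 = 0 := Bt.zero hy2 hay h.aa2
  obtain ⟨q2, hq2, hq20⟩ : ∃ w, Bt A w v ∧ S.L n w = 0 :=
    Opp.exists_zero S.conv (by
      have := hn.1; have := hn.2; have := hnc.1; clear hn hnc hg; unfold Opp at *; grind)
  have hqq2 : S.L q q2 = 0 := Bt.zero hq2 hT.qA hqv
  have hgy2 : Opp (S.L g q2) (S.L g y2) := by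
    have := hq2.btw (S.L g); have := hy2.btw (S.L g); have := hg.1; have := hg.2
    clear hn hnc hg; unfold Opp Btw at *; grind
  have hzm : Bt q2 z y2 := by
    obtain ⟨z', hz', hz'0⟩ := hgy2.exists_zero S.conv
    obtain rfl : z' = z := two' hng (Bt.zero hz' hq20 hy20) hz0 hz'0 hgz
    exact hz'
  have haz : S.L a z ≠ 0 := hz.ne_of_left hay hav
  have hTs : S.Tri y y2 z n g a := ⟨hn.1.ne_left, hy20, hz0, hgy, hgy2.ne_right, hgz, hay, hay2, haz⟩
  have h4 : ¬ S.Bl y y2 z := by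
    rw [bl_ray hy2]
    intro k
    exact hX2 ((bl_ray hz).1 k.symm).symm
  have h5 : ¬ S.Bl z y y2 := by
    intro h5
    obtain ⟨n', hn'⟩ : ∃ n', S.Cut n' y y2 z := by
      have := hTs.parity
      exact hTs.swap.rotate.exists_cut (by tauto) h5.symm
    refine hmin n' ⟨?_, ?_⟩ hn'.2
    · have := hy2.btw (S.L n'); have := hn'.1; clear hn hnc hg hn'; unfold Opp Btw at *; grind
    · have := hz.btw (S.L n'); have := hn'.2; clear hn hnc hg hn'; unfold Opp Btw at *; grind
  have h6 : ¬ S.Bl z v q2 := fun k => h5 (k.opposite hz.symm hzm)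
  have hprop : ∃ b, S.G b v = 0 := exists_block hgq hg.1 hv0 hqv
  have hq2v : Bt a2 v q2 := (hq2.tail hv.symm).symm
  have hgqy : S.L q y ≠ 0 := hTX.rC
  have h7 : ¬ S.Bl v q2 z := by
    have h := bl_xor hprop hqv hv0 hq2v (by rintro rfl; exact hg.1.ne_left hv0) hT.qC hgy
      (by rintro rfl; exact hgqy hqv) hgq.symm
    exact fun k => h.1 hX3 ((bl_ray hz.symm).1 k.symm).symm
  have hTq : S.Tri q2 v z g n q := ⟨hgy2.ne_left, hv0, hgz, hq20, hn.2.ne_right, hz0, hqq2, hqv,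
    hz.ne_of_right hgqy hqv⟩
  have h8 : ¬ S.Bl q2 v z := by
    have := hTq.parity
    have : ¬ S.Bl z q2 v := fun k => h6 k.symm
    have : ¬ S.Bl v z q2 := fun k => h7 k.symm
    tauto
  have h9 : S.Bl q2 A z := by
    have h := bl_xor (exists_block hnq hn.1 hq20 hqq2) hqq2 hq20 hq2.symm hTq.ne_AB hqv hz0
      hTq.rotate.rotate.ne_AB.symm hnq.symm
    by_contra k
    exact h8 (h.2 k)
  have hnAC : Opp (S.L n A) (S.L n C) := by
    have := h.ha2.btw (S.L n); have := hnc.1; clear hn hnc hg; unfold Opp Btw at *; grind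
  have hnB : S.L n B ≠ 0 := fun k => by
    rcases S.conc n p r B k hB.tri.pB hB.tri.rB with h1 | h1 | h1
    · subst h1; exact hnAC.ne_right hB.tri.pC
    · subst h1; exact hnAC.ne_left hB.tri.rA
    · exact hB.tri.swap.rotate.rotate.ne_pq h1
  rcases opp_trichotomy hnAC hnB with hnB | hnB
  · obtain ⟨n1, hn1, hn10⟩ : ∃ n1, Bt a1 n1 B ∧ S.L n n1 = 0 := Opp.exists_zero S.conv (by
      have := hnc.1; have := hnc.2; clear hn hnc hg; unfold Opp at *; grind)
    have hAn1 : Bt A n1 B := (hn1.symm.trans h.ha1.symm).symm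
    have hAa1 : Bt A a1 n1 := (hn1.symm.tail h.ha1.symm).symm
    have han1 : Opp (S.L a A) (S.L a n1) := opp_of_ne hAa1 h.aa1 hT.pA
    have haq2 : Opp (S.L a q2) (S.L a n1) := by
      have := hq2.btw (S.L a); have := hv.btw (S.L a); have := h.aa2
      clear hn hnc hg; unfold Opp Btw at *; grind
    have hAq2 : Bt A q2 C := (hq2.trans hv.symm).trans h.ha2
    have hq2n : Bt q2 y2 n1 := by
      obtain ⟨z', hz', hz'0⟩ := haq2.exists_zero S.conv
      obtain rfl : z' = y2 := two' hna (Bt.zero hz' hq20 hn10) hy20 hz'0 hay2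
      exact hz'
    have hbA : S.Bl A n1 q2 := by
      rw [bl_ray hAn1]; exact ((bl_ray hAq2).2 hB.blA.symm).symm
    have hbq : S.Bl q2 A n1 := ((bl_ray (hzm.trans hq2n)).1 h9.symm).symm
    have hKn := hB.ih_corner hbA hAn1 hAq2 hn10 hq20 ⟨hnB, hnAC⟩ hbq
    rcases hKn a g y hga.symm hay hgy (Bt.inn hAa1.symm hq2n.symm (hy2.symm.tail hya.symm).symm).swap.rotate with k | k
    · have := k.1.2; clear k hn hnc hg; unfold Opp at *; grind
    · have := k.1.1; clear k hn hnc hg; unfold Opp at *; grind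
  · exact hB.not_cut_cut (Bt.inn h.ha1 h.ha2 (hy2.symm.trans hya.symm).symm) hay2 hy20 h.cuta
      ⟨hnB, hnAC.symm⟩

theorem CrossB.false [Fintype ι] [Fintype κ] (hB : S.Based A B C p q r)
    (h : S.CrossB A B C a m a1 a2 m1 m2 P) : False := by
  classical
  induction hN : (Finset.univ.filter fun n => Opp (S.L n m1) (S.L n a1)).card
    using Nat.strong_induction_on generalizing a m a1 a2 m1 m2 P with
  | _ N ih =>
  by_cases he : S.Emp m1 a1
  · have h0 : ¬ S.Bl P m1 a1 := he.not_bl (h.triB hB.tri).qC (h.triA hB.tri).rB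
    have hp := (h.triP hB.tri).parity
    by_cases ha : S.Bl a1 m1 P
    · have : S.Bl m1 a1 P := by tauto
      exact h.false_of_blocked hB this ha
    · rw [h.ray] at ha
      obtain ⟨g, y, h1, h2, h3, h4, h5, h6, h7⟩ := h.exists_wedge hB he ha
      exact h.false_of_wedge hB ha h1 h2 h3 h4 h5 h6 h7
  · unfold Emp at he
    push Not at he
    obtain ⟨n, hn⟩ := he
    obtain ⟨z, hz, hz0⟩ := hn.exists_zero S.conv
    have hnAB : Opp (S.L n A) (S.L n B) := by
      have h1 := h.hb.btw (S.L n); have h2 := h.ha1.btw (S.L n); have h3 := hz.btw (S.L n)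
      unfold Opp Btw at *; grind
    have hnC : S.L n C ≠ 0 := fun k => by
      rcases S.conc n p q C k hB.tri.pC hB.tri.qC with h1 | h1 | h1
      · subst h1; exact hnAB.ne_right hB.tri.pB
      · subst h1; exact hnAB.ne_left hB.tri.qA
      · exact hB.tri.ne_pq h1
    obtain ⟨a', m', a1', a2', m1', m2', P', h', hm, hnn⟩ := h.exists_smaller hB.tri hn hz hz0 hnAB hnC
    refine ih _ ?_ h' rfl
    rw [← hN]
    refine Finset.card_lt_card (Finset.ssubset_iff_of_subset (fun m => ?_) |>.2 ⟨n, ?_, ?_⟩)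
    · simpa using hm m
    · simpa using hn
    · simpa using hnn

/-- A line cutting off `A` and a line cutting off `B` do not cross inside `A B C`. -/
theorem Based.not_cut_cutB [Fintype ι] [Fintype κ] (hB : S.Based A B C p q r) {X : T}
    (hX : Inn A B C X) (ha : S.L a X = 0) (hm : S.L m X = 0) (cuta : S.Cut a A B C)
    (cutm : S.Cut m B A C) : False := by
  obtain ⟨a1, a2, ha1, ha2, hXa, haa1, haa2⟩ := hX.exists_feet S.conv ha cuta.1 cuta.2
  have ham : a ≠ m := by rintro rfl; exact opp_opp cuta.1 cutm.2 cuta.2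
  have hca2 : Opp (S.L m B) (S.L m a2) := by
    have := ha2.btw (S.L m); have := cutm.1; have := cutm.2; unfold Opp Btw at *; grind
  have hca1 := opp_of_ne hXa.symm hm hca2.ne_right
  obtain ⟨_, _, _, _, h⟩ := exists_crossB cuta cutm ha1 haa1 (by
    have := cutm.1; unfold Opp at *; grind)
  exact h.false hB

end

section

variable {A B C : T} {p q r l m n : ι} {v w vl wl vm wm vn wn P x y : T}

variable (S) in
/-- The line `m` separates `B` from `A` and `C`, meeting the sides at `v` and `w`. -/
structure Cutter (A B C : T) (m : ι) (v w : T) : Prop where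
  hv : Bt B v A
  hw : Bt B w C
  mv : S.L m v = 0
  mw : S.L m w = 0
  cut : S.Cut m B A C

theorem Cutter.swap (h : S.Cutter A B C m v w) : S.Cutter C B A m w v :=
  ⟨h.hw, h.hv, h.mw, h.mv, h.cut.symm⟩

theorem Cut.exists_cutter (h : S.Cut m B A C) : ∃ v w, S.Cutter A B C m v w := by
  obtain ⟨v, hv, hv0⟩ := h.1.exists_zero S.conv
  obtain ⟨w, hw, hw0⟩ := h.2.exists_zero S.conv
  exact ⟨v, w, hv, hw, hv0, hw0, h⟩

theorem Cutter.tri (h : S.Cutter A B C m v w) (ht : S.Tri A B C p q r) : S.Tri v B w p m r :=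
  (ht.rotate.sub h.hw h.hv h.mw h.mv h.cut.symm).rotate.rotate

theorem Cutter.bl_iff [Fintype ι] [Fintype κ] (hB : S.Based A B C p q r)
    (h : S.Cutter A B C m v w) : S.Bl w v B ↔ S.Bl v B w := by
  have h1 : ¬ S.Bl B v w := by
    rw [bl_ray h.hv]
    intro k
    have k := ((bl_ray h.hw).1 k.symm).symm
    have := hB.tri.parity; have := hB.blA; have := hB.blC
    tauto
  have := (h.tri hB.tri).parity
  tauto

theorem Cutter.meas_lt [Fintype ι] (h : S.Cutter A B C m v w) :
    S.meas v B w < S.meas A B C := by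
  rw [← meas_rotate v B w, ← meas_rotate A B C]
  exact meas_sub h.hw h.hv h.mw h.mv h.cut.symm

theorem Cutter.noCross [Fintype ι] [Fintype κ] (hB : S.Based A B C p q r)
    (h : S.Cutter A B C m v w) (hu : S.Bl v B w) : S.NoCross v B w :=
  hB.ih _ _ _ _ _ _ h.meas_lt (h.tri hB.tri) hu ((h.bl_iff hB).2 hu)

theorem Cutter.oppA (hl : S.Cutter A B C l vl wl) (h : Opp (S.L n vl) (S.L n B)) :
    Opp (S.L n B) (S.L n A) := by
  have := hl.hv.btw (S.L n); unfold Opp Btw at *; grind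

/-- A line crossing a line cutting off `B` also cuts off `B`. -/
theorem Cutter.of_cut [Fintype ι] [Fintype κ] (hB : S.Based A B C p q r)
    (hl : S.Cutter A B C l vl wl) (h : S.Cut n vl B wl) : S.Cut n B A C := by
  have hA := hl.oppA h.1
  have hC : S.L n C ≠ 0 := fun k => by
    rcases S.conc n p q C k hB.tri.pC hB.tri.qC with h1 | h1 | h1
    · subst h1; exact hA.ne_left hB.tri.pB
    · subst h1; exact hA.ne_right hB.tri.qA
    · exact hB.tri.ne_pq h1
  rcases opp_trichotomy hA hC with k | k
  · exact ⟨hA, k⟩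
  · obtain ⟨X, hX, hX0⟩ := h.2.exists_zero S.conv
    exact (hB.not_cut_cutB (Bt.inn hl.hv hl.hw hX).rotate.rotate.swap hX0 (Bt.zero hX hl.mv hl.mw)
      ⟨hA.symm, k⟩ hl.cut).elim

/-- A line separating a point of the left side from `B` meets the side in between. -/
theorem Cutter.eq_left (ht : S.Tri A B C p q r) (hn : S.Cutter A B C n vn wn)
    (hx : S.L r x = 0) (hnx : S.L n x = 0) : x = vn := by
  refine two' (i := r) (j := n) ?_ hx ?_ hnx hn.mv
  · rintro rfl; exact hn.cut.1.ne_left ht.rB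
  · exact hn.hv.zero ht.rB ht.rA

/-- Crossing is symmetric, with the sides interchanged. -/
theorem Cutter.cross_symm (ht : S.Tri A B C p q r) (hl : S.Cutter A B C l vl wl)
    (hn : S.Cutter A B C n vn wn) (h : S.Cut n vl B wl) :
    Bt vl vn B ∧ Bt wl wn C ∧ S.Cut l wn B vn := by
  obtain ⟨z, hz, hz0⟩ := h.1.exists_zero S.conv
  have hzv := hn.eq_left ht (hz.zero (hl.hv.zero ht.rB ht.rA) ht.rB) hz0
  subst hzv
  have h1 : Opp (S.L n wl) (S.L n C) := by
    have := h.1; have := h.2; have := hn.cut.1; have := hn.cut.2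
    clear h; unfold Opp at *; grind
  obtain ⟨y, hy, hy0⟩ := h1.exists_zero S.conv
  have hyv := hn.swap.eq_left ht.swap (hy.zero (hl.hw.zero ht.pB ht.pC) ht.pC) hy0
  subst hyv
  refine ⟨hz, hy, ?_⟩
  have h2 := hz.btw (S.L l); have h3 := hy.btw (S.L l)
  have h4 := hl.mv; have h5 := hl.mw; have h6 := hl.cut.1; have h7 := hl.cut.2
  clear h h1 hl hn
  unfold Cut Opp Btw at *; grind

/-- A line separating the left ends of two crossing lines crosses one of them. -/
theorem Cutter.between [Fintype ι] [Fintype κ] (hB : S.Based A B C p q r)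
    (hl : S.Cutter A B C l vl wl) (hm : S.Cutter A B C m vm wm) (h : S.Cut m vl B wl)
    (ho : Opp (S.L n vl) (S.L n vm)) :
    ∃ z wn, S.Cutter A B C n z wn ∧ Bt vl z vm ∧ (S.Cut n vl B wl ∨
      (S.Cut m z B wn ∧ Opp (S.L n wl) (S.L n B) ∧ Bt wl wn B)) := by
  obtain ⟨hvm, -, -⟩ := hl.cross_symm hB.tri hm h
  obtain ⟨z, hz, hz0⟩ := ho.exists_zero S.conv
  have hnB : Opp (S.L n vl) (S.L n B) := by
    have := hvm.btw (S.L n); unfold Opp Btw at *; grind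
  have hnl : S.L n wl ≠ 0 := fun k => by
    rcases S.conc n l p wl k hl.mw (hl.hw.zero hB.tri.pB hB.tri.pC) with e | e | e
    · subst e; exact hnB.ne_left hl.mv
    · subst e; exact hnB.ne_right hB.tri.pB
    · subst e; exact hl.cut.1.ne_left hB.tri.pB
  have hcut : S.Cut n B A C ∧ (S.Cut n vl B wl ∨ Opp (S.L n wl) (S.L n B)) := by
    rcases opp_trichotomy hnB hnl with k | k
    · exact ⟨hl.of_cut hB ⟨hnB, k⟩, Or.inl ⟨hnB, k⟩⟩
    · refine ⟨⟨hl.oppA hnB, ?_⟩, Or.inr k.symm⟩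
      have := hl.hw.btw (S.L n); unfold Opp Btw at *; grind
  obtain ⟨x, wn, hc⟩ := hcut.1.exists_cutter
  have hx := hc.eq_left hB.tri (hz.zero (hl.hv.zero hB.tri.rB hB.tri.rA)
      (hm.hv.zero hB.tri.rB hB.tri.rA)) hz0
  subst hx
  refine ⟨z, wn, hc, hz, hcut.2.imp_right fun k => ?_⟩
  obtain ⟨y, hy, hy0⟩ := k.exists_zero S.conv
  have hy' := hc.swap.eq_left hB.tri.swap (hy.zero (hl.hw.zero hB.tri.pB hB.tri.pC) hB.tri.pB) hy0
  subst hy'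
  refine ⟨?_, k, hy⟩
  have h1 := hy.btw (S.L m); have h2 := hz.btw (S.L m)
  have h3 := h.1; have h4 := h.2; have h5 := hm.mv
  clear hcut hnB k h
  unfold Cut Opp Btw at *; grind

end

section

variable {A B C : T} {p q r l m n : ι} {v w vl wl vm wm vn wn P x y : T}

theorem Cutter.exists_crossing (ht : S.Tri A B C p q r) (hl : S.Cutter A B C l vl wl)
    (hm : S.Cutter A B C m vm wm) (h : S.Cut m vl B wl) :
    ∃ P, Bt vl P wl ∧ Bt vm P wm ∧ S.L l P = 0 ∧ S.L m P = 0 := by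
  obtain ⟨P, hP, hP0⟩ := h.2.exists_zero S.conv
  obtain ⟨P', hP', hP0'⟩ := (hl.cross_symm ht hm h).2.2.2.exists_zero S.conv
  have hlm : l ≠ m := by rintro rfl; exact h.1.ne_left hl.mv
  have := two' hlm (hP.zero hl.mv hl.mw) hP0' hP0 (hP'.zero hm.mw hm.mv)
  subst this
  exact ⟨P, hP, hP'.symm, hP0', hP0⟩

theorem Cutter.exists_adjacent [Fintype ι] [Fintype κ] (hB : S.Based A B C p q r)
    (hl : S.Cutter A B C l vl wl) (ul : S.Bl vl B wl) (h : ∃ m, S.Cut m vl B wl) :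
    ∃ m vm wm, S.Cutter A B C m vm wm ∧ S.Cut m vl B wl ∧ S.Emp vl vm := by
  obtain ⟨m, z, hm, hz, hz0, hinn⟩ :=
    exists_innermost (y := vl) (v := B) h fun n hn => hn.1
  obtain ⟨vm, wm, hmc⟩ := (hl.of_cut hB hm).exists_cutter
  have := hmc.eq_left hB.tri (hz.zero (hl.hv.zero hB.tri.rB hB.tri.rA) hB.tri.rB) hz0
  subst this
  refine ⟨m, z, wm, hmc, hm, fun n hn => ?_⟩
  obtain ⟨y, wn, hnc, hy, hn' | ⟨hn1, hn2, hw⟩⟩ := hl.between hB hmc hm hn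
  · exact hinn n hn' hn
  · obtain ⟨X, hX, hX0⟩ := hn1.2.exists_zero S.conv
    have hyB := hy.trans hz
    have hi : Inn vl B wl X := (Bt.inn hyB.symm hw.symm hX).swap.rotate
    have hmn : m ≠ n := by rintro rfl; exact hn.ne_right hz0
    have hk := hl.noCross hB ul m n X hmn hX0 (hX.zero hnc.mv hnc.mw) hi
    unfold Cut Opp at *
    grind

variable (S) in
/-- The configuration at a cutting line `l` crossed by a line `m` adjacent to its left end, together
with the line `n` cutting off their crossing closest to `l`. -/
structure Knot (A B C : T) (l : ι) (vl wl : T) (m : ι) (vm wm : T) (n : ι) (vn wn P x y : T) :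
    Prop where
  hl : S.Cutter A B C l vl wl
  hm : S.Cutter A B C m vm wm
  hn : S.Cutter A B C n vn wn
  ul : S.Bl vl B wl
  un : S.Bl vn B wn
  lm : S.Cut m vl B wl
  ln : S.Cut n vl B wl
  hP : Bt vl P wl
  hPm : Bt vm P wm
  lP : S.L l P = 0
  mP : S.L m P = 0
  hx : Bt vl x P
  lx : S.L l x = 0
  nx : S.L n x = 0
  hy : Bt vm y P
  my : S.L m y = 0
  ny : S.L n y = 0
  hxy : Bt x y vn
  cutP : S.Cut n P vl vm
  lm_emp : S.Emp vl vm
  lx_emp : S.Emp vl x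
  xy_emp : S.Emp x y
  my_emp : S.Emp vm y
  blm : S.Bl vm vl P
  block : ∃ b, S.G b x = 0 ∧ S.G b vm = 0

/-- A crossing line with adjacent left end cuts off an empty quadrilateral. -/
theorem Cutter.exists_corner [Fintype ι] [Fintype κ] (hB : S.Based A B C p q r)
    (hl : S.Cutter A B C l vl wl) (ul : S.Bl vl B wl) (hm : S.Cutter A B C m vm wm)
    (h : S.Cut m vl B wl) (he : S.Emp vl vm) (hP : Bt vl P wl)
    (lP : S.L l P = 0) (mP : S.L m P = 0) :
    S.Bl vm vl P ∧ ∃ n x y, S.Cut n P vl vm ∧ Bt vl x P ∧ Bt vm y P ∧ S.L n x = 0 ∧ S.L n y = 0 ∧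
      S.Cut n vl B wl ∧ S.Emp vl x ∧ S.Emp x y ∧ S.Emp vm y := by
  have hvm := (hl.cross_symm hB.tri hm h).1
  have hlm := (hl.cross_symm hB.tri hm h).2.2
  have rl := hl.hv.zero hB.tri.rB hB.tri.rA
  have rm := hm.hv.zero hB.tri.rB hB.tri.rA
  have hlr : l ≠ r := by rintro rfl; exact hl.cut.1.ne_left hB.tri.rB
  have hmr : m ≠ r := by rintro rfl; exact hm.cut.1.ne_left hB.tri.rB
  have hml : m ≠ l := by rintro rfl; exact h.1.ne_left hl.mv
  have lvm := hlm.2.ne_right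
  have ht : S.Tri vl P vm m r l :=
    ⟨h.1.ne_left, mP, hm.mv, rl, hP.ne_of_left rl (hl.hw.ne_of_left hB.tri.rB hB.tri.rC), rm,
      hl.mv, lP, lvm⟩
  have b1 : S.Bl vl P vm := by
    rw [bl_ray hP]; exact ((bl_ray hvm).2 ul).symm
  have b2 : S.Bl vm vl P := by
    have := ht.parity; have := he.not_bl (v := P) rl rm; tauto
  refine ⟨b2, ?_⟩
  obtain ⟨n, x, hn, hx, nx, hinn⟩ :=
    exists_innermost (Q := fun n => S.Cut n P vl vm) (ht.exists_cut b1 b2) fun n hn => hn.1.symm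
  obtain ⟨y, hy, ny⟩ := hn.2.symm.exists_zero S.conv
  have my := hy.zero hm.mv mP
  have lx := hx.zero hl.mv lP
  have hmn : m ≠ n := by rintro rfl; exact hn.1.ne_left mP
  have hln : l ≠ n := by rintro rfl; exact hn.1.ne_left lP
  have ln : S.Cut n vl B wl := by
    have := hl.noCross hB ul m n y hmn my ny (Bt.inn hvm hP hy)
    unfold Cut Opp at *; grind
  have hK : S.NoCross vl P vm := by
    refine hB.ih _ _ _ _ _ _ ?_ ht b1 b2
    rw [← meas_swap, meas_rotate]
    exact (meas_sub hvm hP hm.mv mP h).trans hl.meas_lt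
  have exy : S.Emp x y := by
    intro k hk
    obtain ⟨X, hX, kX⟩ := hk.exists_zero S.conv
    have hkn : k ≠ n := by rintro rfl; exact hk.ne_left nx
    have := hK k n X hkn kX (hX.zero nx ny) (Bt.inn hx.symm hy.symm hX).swap.rotate
    unfold Cut Opp at *; grind
  have elx : S.Emp vl x := by
    intro k hk
    have hkr : k ≠ r := by rintro rfl; exact hk.ne_left rl
    have hkm : k ≠ m := by
      rintro rfl
      have := hx.btw (S.L k); unfold Opp Btw at *; grind
    have hkn : k ≠ n := by rintro rfl; exact hk.ne_right nx
    have k1 : S.L k vm ≠ 0 := fun h0 => by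
      rcases S.conc k m r vm h0 hm.mv rm with e | e | e <;> contradiction
    have k2 : S.L k y ≠ 0 := fun h0 => by
      rcases S.conc k m n y h0 my ny with e | e | e <;> contradiction
    refine hinn k ?_ hk
    have h1 := he k; have h2 := exy k; have h3 := hx.btw (S.L k); have h4 := hy.btw (S.L k)
    clear hinn
    unfold Cut Opp Btw at *; grind
  refine ⟨n, x, y, hn, hx, hy, nx, ny, ln, elx, exy, fun k hk => ?_⟩
  have hkr : k ≠ r := by rintro rfl; exact hk.ne_left rm
  have hkl : k ≠ l := by
    rintro rfl
    have := hy.btw (S.L k); unfold Opp Btw at *; grind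
  have hkn : k ≠ n := by rintro rfl; exact hk.ne_right ny
  have k1 : S.L k vl ≠ 0 := fun h0 => by
    rcases S.conc k l r vl h0 hl.mv rl with e | e | e <;> contradiction
  have k2 : S.L k x ≠ 0 := fun h0 => by
    rcases S.conc k l n x h0 lx nx with e | e | e <;> contradiction
  have h1 := he k; have h2 := exy k; have h3 := elx k
  clear hinn
  unfold Opp at *; grind

theorem Cutter.exists_knot [Fintype ι] [Fintype κ] (hB : S.Based A B C p q r)
    (hl : S.Cutter A B C l vl wl) (ul : S.Bl vl B wl) (h : ∃ m, S.Cut m vl B wl) :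
    ∃ m vm wm n vn wn P x y, S.Knot A B C l vl wl m vm wm n vn wn P x y := by
  obtain ⟨m, vm, wm, hm, hml, he⟩ := hl.exists_adjacent hB ul h
  obtain ⟨P, hP, hPm, lP, mP⟩ := hl.exists_crossing hB.tri hm hml
  obtain ⟨b2, n, x, y, hn, hx, hy, nx, ny, ln, elx, exy, emy⟩ :=
    hl.exists_corner hB ul hm hml he hP lP mP
  obtain ⟨vn, wn, hnc⟩ := (hl.of_cut hB ln).exists_cutter
  obtain ⟨hvn, hwn, hnl⟩ := hl.cross_symm hB.tri hnc ln
  have hvm := (hl.cross_symm hB.tri hm hml).1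
  have rl := hl.hv.zero hB.tri.rB hB.tri.rA
  have rm := hm.hv.zero hB.tri.rB hB.tri.rA
  have rn := hnc.hv.zero hB.tri.rB hB.tri.rA
  have lx := hx.zero hl.mv lP
  have my := hy.zero hm.mv mP
  have hlr : l ≠ r := by rintro rfl; exact hl.cut.1.ne_left hB.tri.rB
  have hmr : m ≠ r := by rintro rfl; exact hm.cut.1.ne_left hB.tri.rB
  have hnr : n ≠ r := by rintro rfl; exact hnc.cut.1.ne_left hB.tri.rB
  have hmn : m ≠ n := by rintro rfl; exact hn.1.ne_left mP
  have hln : l ≠ n := by rintro rfl; exact hn.1.ne_left lP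
  have hxl := hx.trans hP
  have ht : S.Tri vl x vn n r l :=
    ⟨ln.1.ne_left, nx, hnc.mv, rl, hxl.ne_of_left rl (hl.hw.ne_of_left hB.tri.rB hB.tri.rC), rn,
      hl.mv, lx, hnl.2.ne_right⟩
  have b1 : S.Bl vl x vn := by
    rw [bl_ray hxl]; exact ((bl_ray hvn).2 ul).symm
  have b3 : ¬ S.Bl vn vl x := fun k => by
    obtain ⟨k, hk⟩ := ht.exists_cut b1 k
    exact elx k hk.1.symm
  have b4 : S.Bl x vl vn := by
    have := ht.parity; tauto
  have hxy : Bt x y vn := by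
    obtain ⟨z, hz, hz0⟩ : ∃ z, Bt x z vn ∧ S.L m z = 0 := by
      refine Opp.exists_zero S.conv ?_
      have h1 := hx.btw (S.L m); have h2 := hvm.btw (S.L n)
      have h3 : Opp (S.L n vm) (S.L n B) := by
        have := hn.1; have := hn.2; have := ln.1; unfold Opp Btw at *; grind
      obtain ⟨z, hz, hz0⟩ := h3.exists_zero S.conv
      have := hnc.eq_left hB.tri (hz.zero rm hB.tri.rB) hz0
      subst this
      have h4 := hz.btw (S.L m); have h5 := hm.mv; have h6 := hml.1
      clear hn ln h3
      unfold Opp Btw at *; grind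
    exact two' hmn hz0 my (hz.zero nx hnc.mv) ny ▸ hz
  have hvx : Bt vn x wn := by
    obtain ⟨z, hz, hz0⟩ := hnl.2.symm.exists_zero S.conv
    exact two' hln hz0 lx (hz.zero hnc.mv hnc.mw) nx ▸ hz
  refine ⟨m, vm, wm, n, vn, wn, P, x, y, hl, hm, hnc, ul, ?_, hml, ln, hP, hPm, lP, mP, hx, lx, nx, hy,
    my, ny, hxy, hn, he, elx, exy, emy, b2, ?_⟩
  · have hx' : vn ≠ x := by rintro rfl; exact hnl.2.ne_right lx
    have hv' : vn ≠ vl := by rintro rfl; exact hnl.2.ne_right hl.mv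
    have h1 := (bl_xor (exists_block hnr ln.1 hnc.mv rn) rn hnc.mv hvn hv' rl nx hx' hnr.symm)
    have h2 : S.Bl vn B x := by tauto
    exact ((bl_ray hvx).1 h2.symm).symm
  · obtain ⟨b, hb, ho⟩ := ((bl_ray hxy).2 b4.symm).symm
    exact ⟨b, hb, block_through hln hlr.symm hmn hmr.symm lx nx hl.mv rl ny my elx.symm exy hb ho
      rm hm.mv⟩

end

section

variable {A B C : T} {p q r l m n m' n' : ι}
  {v w vl wl vm wm vn wn P x y vm' wm' vn' wn' P' x' y' : T}

/-- In two mirrored knots at `l` and `n` with `l` lowest, the mirrored knot returns to `l`. -/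
theorem Knot.return_eq (ht : S.Tri A B C p q r)
    (K : S.Knot A B C l vl wl m vm wm n vn wn P x y)
    (K' : S.Knot C B A n wn vn m' wm' vm' n' wn' vn' P' x' y')
    (hlow : ¬ Opp (S.L n' A) (S.L n' vl)) : n' = l := by
  by_contra hne
  obtain ⟨hvn, hwn, hnl⟩ := K.hl.cross_symm ht K.hn K.ln
  have hln : l ≠ n := by rintro rfl; exact K.ln.1.ne_left K.hl.mv
  have hnn : n' ≠ n := by rintro rfl; exact K'.ln.1.ne_left K'.hl.mv
  have hlr : l ≠ r := by rintro rfl; exact K.hl.cut.1.ne_left ht.rB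
  have hnr : n' ≠ r := by rintro rfl; exact K'.hn.cut.1.ne_left ht.rB
  have rl := K.hl.hv.zero ht.rB ht.rA
  have h1 : S.L n' vl ≠ 0 := fun h0 => by
    rcases S.conc n' l r vl h0 K.hl.mv rl with e | e | e <;> contradiction
  have h2 : S.L l x' ≠ 0 := fun h0 => by
    rcases S.conc n' l n x' K'.nx h0 K'.lx with e | e | e <;> contradiction
  have h3 : Opp (S.L l x') (S.L l vn) := by
    have := K'.lx_emp l; have := hnl.2; unfold Opp at *; grind
  obtain ⟨z, hz, hz0⟩ := h3.exists_zero S.conv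
  have := two' hln hz0 K.lx (hz.zero K'.lx K.hn.mv) K.nx
  subst this
  refine K.lx_emp n' ?_
  have h4 := hz.btw (S.L n'); have h5 := K'.ln.1; have h6 := K'.ln.2
  have h7 := K'.hn.cut.1; have h8 := K'.hn.cut.2; have h9 := K'.nx
  clear K K' hnl h3
  unfold Opp Btw at *; grind

/-- The second crossing lines of two mirrored knots coincide. -/
theorem Knot.eq_of_return [Fintype ι] [Fintype κ] (hB : S.Based A B C p q r)
    (K : S.Knot A B C l vl wl m vm wm n vn wn P x y)
    (K' : S.Knot C B A n wn vn m' wm' vm' l wl vl P' x y') : m' = m := by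
  have ht := hB.tri
  by_contra hne
  obtain ⟨hvn, hwn, hnl⟩ := K.hl.cross_symm ht K.hn K.ln
  have hln : l ≠ n := by rintro rfl; exact K.ln.1.ne_left K.hl.mv
  have hlr : l ≠ r := by rintro rfl; exact K.hl.cut.1.ne_left ht.rB
  have hmr : m ≠ r := by rintro rfl; exact K.hm.cut.1.ne_left ht.rB
  have hml : m ≠ l := by rintro rfl; exact K.lm.1.ne_left K.hl.mv
  have hmn : m ≠ n := by rintro rfl; exact K.cutP.1.ne_left K.mP
  have hmr' : m' ≠ r := by rintro rfl; exact K'.hm.cut.1.ne_left ht.rB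
  have hmp' : m' ≠ p := by rintro rfl; exact K'.hm.cut.1.ne_left ht.pB
  have hmn' : m' ≠ n := by rintro rfl; exact K'.lm.1.ne_left K'.hl.mv
  have hml' : m' ≠ l := by rintro rfl; exact K'.cutP.1.ne_left K'.mP
  have rl := K.hl.hv.zero ht.rB ht.rA
  have rm := K.hm.hv.zero ht.rB ht.rA
  have hy' := K'.hy.trans K'.hPm
  have hyP' := K'.hy.tail K'.hPm
  -- `m'` cuts the apex of the triangle cut off by `l`
  have hlm' : S.Cut l wm' B vm' := by
    have h1 := K'.cutP; have h2 := hnl; have h3 := hyP'.btw (S.L l); have h4 := K'.ny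
    clear K K' hnl
    unfold Cut Opp Btw at *; grind
  obtain ⟨-, hvl', hm'⟩ := K'.hm.cross_symm ht.swap K.hl.swap hlm'
  have hvm' := (K.hl.cross_symm ht K'.hm.swap hm').1
  obtain ⟨z, hyl, hz0⟩ := hm'.2.exists_zero S.conv
  have := two' hml' hz0 K'.my (hyl.zero K.hl.mv K.hl.mw) K'.ny
  subst this
  have m'x : S.L m' x ≠ 0 := fun h0 => by
    rcases S.conc m' l n x h0 K.lx K.nx with e | e | e <;> contradiction
  have m'y : S.L m' y ≠ 0 := fun h0 => by
    rcases S.conc m' m n y h0 K.my K.ny with e | e | e <;> contradiction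
  have hxo : Opp (S.L m' x) (S.L m' wl) := by
    have := K.lx_emp m'; have := hm'.1; have := hm'.2; unfold Opp at *; grind
  have hyo : Opp (S.L m' y) (S.L m' vn) := by
    have := K.xy_emp m'; have := K.lx_emp m'
    have := K'.lm.1; have := K'.lm.2; have := hm'.1; have := hm'.2; unfold Opp at *; grind
  have hxl : Bt z x vl := by
    obtain ⟨y, hy, hy0⟩ := hxo.exists_zero S.conv
    have := two' hml' hy0 hz0 (hy.zero K.lx K.hl.mw) K'.ny
    subst this
    exact hy.symm.tail (K.hx.trans K.hP).symm
  have hxy : Bt x y P' := by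
    obtain ⟨Q, hQ, hQ0⟩ := hyo.exists_zero S.conv
    have := two' hmn' hQ0 K'.mP (hQ.zero K.ny K.hn.mv) K'.lP
    subst this
    exact (hQ.symm.tail K.hxy.symm).symm
  have hi : Inn vl z vm' y := (Bt.inn hxl hyP' hxy).swap.rotate
  have htri : S.Tri vl z vm' m' r l :=
    ⟨hm'.1.ne_left, hz0, K'.hm.mw, rl, hyl.ne_of_left rl (K.hl.hw.ne_of_left ht.rB ht.rC),
      hvm'.zero rl ht.rB, K.hl.mv, K'.ny, hlm'.2.ne_right⟩
  have b1 : S.Bl vl z vm' := by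
    rw [bl_ray hyl]; exact ((bl_ray hvm').2 K.ul).symm
  have b2 : S.Bl vm' vl z := by
    have hpB := K'.hm.hv.zero ht.pB ht.pC
    have hn1 : wm' ≠ wn := by rintro rfl; exact K'.lm.1.ne_left K'.hm.mv
    have hn2 : wm' ≠ P' := (ne_of_opp K'.cutP.2).symm
    have hn3 : vm' ≠ vl := by rintro rfl; exact hm'.1.ne_left K'.hm.mw
    have hn4 : vm' ≠ wm' := (ne_of_opp hlm'.2).symm
    have e1 := (bl_xor (exists_block hmp' K'.hm.cut.1 K'.hm.mv hpB) hpB K'.hm.mv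
      (K'.hl.cross_symm ht.swap K'.hm K'.lm).1 hn1 (K.hn.hw.zero ht.pB ht.pC) K'.mP hn2
      hmp'.symm).1 K'.blm
    have e2 : ¬ S.Bl vm' B wm' := fun h =>
      e1 (((bl_ray K'.hPm).2 (((K'.hm.bl_iff hB.swap).1 h.symm).symm)).symm)
    have e3 := (bl_xor (exists_block hmr' K'.hm.cut.1 K'.hm.mw (hvm'.zero rl ht.rB))
      (hvm'.zero rl ht.rB) K'.hm.mw hvm' hn3 rl K'.hm.mv hn4 hmr'.symm).2 e2
    exact ((bl_ray hy'.symm).2 e3.symm).symm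
  have hK : S.NoCross vl z vm' := by
    refine hB.ih _ _ _ _ _ _ ?_ htri b1 b2
    rw [← meas_swap, meas_rotate]
    exact (meas_sub hvm' hyl K'.hm.mw hz0 hm').trans K.hl.meas_lt
  have := hK m n y hmn K.my K.ny hi
  have h1 := hxl.btw (S.L n); have h2 := hyP'.btw (S.L n); have h3 := K.nx; have h4 := K'.lP
  clear hxo hyo K K'
  unfold Cut Opp Btw at *; grind

theorem Based.not_left [Fintype ι] [Fintype κ] (hB : S.Based A B C p q r)
    (hl : S.Cutter A B C l vl wl) (ul : S.Bl vl B wl) (h : ∃ m, S.Cut m vl B wl) : False := by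
  have ht := hB.tri
  obtain ⟨l, z, ⟨vl, wl, hl, ul, h⟩, hz, hz0, hlow⟩ :=
    exists_innermost (S := S) (y := A) (v := B) (Q := fun l => ∃ vl wl, S.Cutter A B C l vl wl ∧
      S.Bl vl B wl ∧ ∃ m, S.Cut m vl B wl) ⟨l, vl, wl, hl, ul, h⟩
      (fun n ⟨_, _, h, _⟩ => h.cut.1.symm)
  have := hl.eq_left ht (hz.zero ht.rA ht.rB) hz0
  subst this
  obtain ⟨m, vm, wm, n, vn, wn, P, x, y, K⟩ := hl.exists_knot hB ul h
  obtain ⟨-, -, hnl⟩ := K.hl.cross_symm ht K.hn K.ln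
  obtain ⟨m', wm', vm', n', wn', vn', P', x', y', K'⟩ :=
    K.hn.swap.exists_knot hB.swap (((K.hn.bl_iff hB).2 K.un).symm) ⟨l, hnl⟩
  have hn' : n' = l := by
    refine K.return_eq ht K' (hlow n' ⟨vn', wn', K'.hn.swap, ?_, n, ?_⟩)
    · exact ((K'.hn.bl_iff hB.swap).2 K'.un).symm
    · exact (K'.hl.cross_symm ht.swap K'.hn K'.ln).2.2
  subst hn'
  have rl := K.hl.hv.zero ht.rB ht.rA
  have h1 := K'.hn.eq_left ht.swap (K.hl.hw.zero ht.pB ht.pC) K.hl.mw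
  have h2 := K'.hn.swap.eq_left ht rl K.hl.mv
  subst h1 h2
  have hln : n' ≠ n := by rintro rfl; exact K.ln.1.ne_left K.hl.mv
  have h4 := two' hln K.lx K'.nx K.nx K'.lx
  subst h4
  have hm' := K.eq_of_return hB K'
  subst hm'
  have h3 := K'.hm.eq_left ht.swap (K.hm.hw.zero ht.pB ht.pC) K.hm.mw
  subst h3
  obtain ⟨b, hb, hbv⟩ := K.block
  obtain ⟨b', hb', hbw⟩ := K'.block
  have := S.block_un n' n b b' _ hln K.lx K.nx hb hb'
  subst this
  refine S.gl m' b vm wm ?_ K.hm.mv K.hm.mw hbv hbw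
  exact (ne_of_opp (K.hl.cross_symm ht K.hm K.lm).2.2.2).symm

end

section

variable {A B C : T} {p q r l m n : ι} {v w vl wl vm wm vn wn P x y : T}

theorem Based.not_adjacent [Fintype ι] [Fintype κ] (hB : S.Based A B C p q r)
    (hl : S.Cutter A B C l vl wl) (hm : S.Cutter A B C m vm wm) (h : S.Cut m vl B wl)
    (he : S.Emp vl vm) : False := by
  have ht := hB.tri
  obtain ⟨P, hP, hPm, lP, mP⟩ := hl.exists_crossing ht hm h
  obtain ⟨hvm, -, hlm⟩ := hl.cross_symm ht hm h
  have rl := hl.hv.zero ht.rB ht.rA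
  have rm := hm.hv.zero ht.rB ht.rA
  have hmr : m ≠ r := by rintro rfl; exact hm.cut.1.ne_left ht.rB
  have htri : S.Tri vl P vm m r l :=
    ⟨h.1.ne_left, mP, hm.mv, rl, hP.ne_of_left rl (hl.hw.ne_of_left ht.rB ht.rC), rm,
      hl.mv, lP, hlm.2.ne_right⟩
  have hpar := htri.parity
  have hb := he.not_bl (v := P) rl rm
  by_cases hu : S.Bl vl B wl
  · exact hB.not_left hl hu ⟨m, h⟩
  · have h1 : ¬ S.Bl vl P vm := fun k => hu ((bl_ray hvm).1 ((bl_ray hP).1 k).symm)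
    have h2 : ¬ S.Bl vm vl P := by tauto
    have hne : vm ≠ vl := by rintro rfl; exact h.1.ne_left hm.mv
    have h3 := bl_xor (exists_block hmr h.1 hm.mv rm) rm hm.mv hvm hne rl mP
      (by rintro rfl; exact hlm.2.ne_right lP) hmr.symm
    have h4 : S.Bl vm B P := by tauto
    have h5 := ((bl_ray hPm).1 h4.symm).symm
    exact hB.swap.not_left hm.swap ((hm.bl_iff hB).2 h5).symm ⟨l, hlm⟩

/-- Two lines cutting off `B` do not cross. -/
theorem Based.not_cross [Fintype ι] [Fintype κ] (hB : S.Based A B C p q r)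
    (hl : S.Cutter A B C l vl wl) (hm : S.Cutter A B C m vm wm) (h : S.Cut m vl B wl) : False := by
  classical
  induction hN : (Finset.univ.filter fun n => Opp (S.L n vl) (S.L n vm)).card
    using Nat.strong_induction_on generalizing l m vl wl vm wm with
  | _ N ih =>
  refine hB.not_adjacent hl hm h fun n hn => ?_
  obtain ⟨z, wn, hnc, hz, hn'⟩ := hl.between hB hm h hn
  rw [← hN] at ih
  rcases hn' with h1 | ⟨h1, -, -⟩
  · refine ih _ ?_ hl hnc h1 rfl
    refine Finset.card_lt_card (Finset.ssubset_iff_of_subset (fun k => ?_) |>.2 ⟨n, ?_, ?_⟩)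
    · simp only [Finset.mem_filter, Finset.mem_univ, true_and]
      have := hz.btw (S.L k); unfold Opp Btw at *; grind
    · simpa using hn
    · simp [hnc.mv, not_opp_zero_right]
  · refine ih _ ?_ hnc hm h1 rfl
    refine Finset.card_lt_card (Finset.ssubset_iff_of_subset (fun k => ?_) |>.2 ⟨n, ?_, ?_⟩)
    · simp only [Finset.mem_filter, Finset.mem_univ, true_and]
      have := hz.btw (S.L k); unfold Opp Btw at *; grind
    · simpa using hn
    · simp [hnc.mv, not_opp_zero_left]

theorem Based.not_cutB_cutB [Fintype ι] [Fintype κ] (hB : S.Based A B C p q r) (hlm : l ≠ m)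
    (hX : Inn A B C x) (lx : S.L l x = 0) (mx : S.L m x = 0) (hl : S.Cut l B A C)
    (hm : S.Cut m B A C) : False := by
  have ht := hB.tri
  obtain ⟨vl, wl, hl⟩ := hl.exists_cutter
  obtain ⟨vm, wm, hm⟩ := hm.exists_cutter
  obtain ⟨w, v, hw, hv, hvw, lw, lv⟩ := hX.rotate.exists_feet S.conv lx hl.cut.2 hl.cut.1
  have := hl.eq_left ht (hv.zero ht.rB ht.rA) lv
  subst this
  have := hl.swap.eq_left ht.swap (hw.zero ht.pB ht.pC) lw
  subst this
  have hmv : S.L m v ≠ 0 := fun h0 => by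
    rcases S.conc l m r v hl.mv h0 (hv.zero ht.rB ht.rA) with e | e | e
    · exact hlm e
    · subst e; exact hl.cut.1.ne_left ht.rB
    · subst e; exact hm.cut.1.ne_left ht.rB
  have ho := opp_of_ne hvw.symm mx hmv
  rcases opp_trichotomy ho hm.cut.1.ne_left with h | h
  · exact hB.not_cross hl hm ⟨h, ho⟩
  · exact hB.swap.not_cross hl.swap hm.swap ⟨h, ho.symm⟩

/-- A line through an interior point of a triangle of lines cuts off one of its corners. -/
theorem Tri.cut_of_inn (ht : S.Tri A B C p q r) (hX : Inn A B C x) (hn : S.L n x = 0) :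
    S.Cut n A B C ∨ S.Cut n B A C ∨ S.Cut n C B A := by
  have key : ∀ {A B C : T} {p q r : ι}, S.Tri A B C p q r → Inn A B C x → S.L n A ≠ 0 :=
    fun ht hX h0 => by
      rcases S.conc n _ _ _ h0 ht.qA ht.rA with e | e | e
      · subst e; exact hX.rotate.ne_zero ht.qB ht.qC ht.qA hn
      · subst e; exact hX.rotate.rotate.ne_zero ht.rC ht.rA ht.rB hn
      · subst e; exact ht.rC ht.qC
  have hA := key ht hX; have hB := key ht.rotate hX.rotate; have hC := key ht.swap hX.swap
  obtain ⟨α, β, γ, ha, hb, hc, h⟩ := hX.eval (S.L n)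
  rw [hn] at h
  have h1 : ¬ (0 < S.L n A ∧ 0 < S.L n B ∧ 0 < S.L n C) := fun ⟨h1, h2, h3⟩ => by
    have := mul_pos ha h1; have := mul_pos hb h2; have := mul_pos hc h3; linarith
  have h2 : ¬ (S.L n A < 0 ∧ S.L n B < 0 ∧ S.L n C < 0) := fun ⟨h1, h2, h3⟩ => by
    have := mul_neg_of_pos_of_neg ha h1; have := mul_neg_of_pos_of_neg hb h2
    have := mul_neg_of_pos_of_neg hc h3; linarith
  clear h
  unfold Cut Opp
  grind

theorem noCross_of_bl [Fintype ι] [Fintype κ] (ht : S.Tri A B C p q r) (hA : S.Bl A B C)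
    (hC : S.Bl C A B) : S.NoCross A B C := by
  induction hN : S.meas A B C using Nat.strong_induction_on generalizing A B C p q r with
  | _ N ih =>
  have hB : S.Based A B C p q r :=
    ⟨ht, hA, hC, fun A' B' C' p' q' r' h ht' h1 h2 => ih _ (hN ▸ h) ht' h1 h2 rfl⟩
  intro m n X hmn hm hn hX
  have hc := ht.cut_of_inn hX hm
  have hc' := ht.cut_of_inn hX hn
  rcases hc with h | h | h <;> rcases hc' with h' | h' | h'
  · exact Or.inl ⟨h, h'⟩
  · exact (hB.not_cut_cutB hX hm hn h h').elim
  · exact (hB.not_cut_cut hX hm hn h h').elim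
  · exact (hB.not_cut_cutB hX hn hm h' h).elim
  · exact (hB.not_cutB_cutB hmn hX hm hn h h').elim
  · exact (hB.swap.not_cut_cutB hX.swap hn hm h' h.symm).elim
  · exact (hB.not_cut_cut hX hn hm h' h).elim
  · exact (hB.swap.not_cut_cutB hX.swap hm hn h h'.symm).elim
  · exact Or.inr ⟨h.symm, h'.symm⟩

end

end LineSystem

section Cell

variable {ι : Type*} {f : ι → (ℝ × ℝ) →ᵃ[ℝ] ℝ} {p₀ x y : ℝ × ℝ} {a b : ι}

/-- The open cell containing `p₀` in the complement of the lines `f m = 0`. -/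
def cell (f : ι → (ℝ × ℝ) →ᵃ[ℝ] ℝ) (p₀ : ℝ × ℝ) : Set (ℝ × ℝ) := {x | ∀ m, 0 < f m x * f m p₀}

/-- The closed cell containing `p₀` in the complement of the lines `f m = 0`. -/
def closedCell (f : ι → (ℝ × ℝ) →ᵃ[ℝ] ℝ) (p₀ : ℝ × ℝ) : Set (ℝ × ℝ) :=
  {x | ∀ m, 0 ≤ f m x * f m p₀}

theorem continuous_affine (g : (ℝ × ℝ) →ᵃ[ℝ] ℝ) : Continuous g :=
  AffineMap.continuous_of_finiteDimensional g

theorem affine_combo (g : (ℝ × ℝ) →ᵃ[ℝ] ℝ) {s t : ℝ} (h : s + t = 1) (x y : ℝ × ℝ) :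
    g (s • x + t • y) = s * g x + t * g y := Convex.combo_affine_apply h

theorem affine_add_smul_sub (g : (ℝ × ℝ) →ᵃ[ℝ] ℝ) (t : ℝ) (x y z : ℝ × ℝ) :
    g (x + t • (y - z)) = g x + t * (g y - g z) := by
  have h := g.map_vadd x (t • (y - z))
  rw [vadd_eq_add, vadd_eq_add] at h
  rw [add_comm, h, map_smul, show y - z = y -ᵥ z from rfl, AffineMap.linearMap_vsub]
  simp [add_comm]

theorem isOpen_cell [Finite ι] : IsOpen (cell f p₀) := by
  rw [cell, ofPred_forall]
  exact isOpen_iInter_of_finite fun m =>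
    isOpen_lt continuous_const ((continuous_affine _).mul continuous_const)

theorem isClosed_closedCell : IsClosed (closedCell f p₀) := by
  rw [closedCell, ofPred_forall]
  exact isClosed_iInter fun m => isClosed_le continuous_const
    ((continuous_affine _).mul continuous_const)

theorem combo_mem_cell {s t : ℝ} (hs : 0 ≤ s) (ht : 0 < t) (h : s + t = 1) (hx : x ∈ closedCell f p₀)
    (hy : y ∈ cell f p₀) : s • x + t • y ∈ cell f p₀ := fun m => by
  rw [affine_combo _ h]
  have := mul_nonneg hs (hx m); have := mul_pos ht (hy m); linarith

theorem convex_closedCell : Convex ℝ (closedCell f p₀) := fun x hx y hy s t hs ht h m => by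
  rw [affine_combo _ h]
  have := mul_nonneg hs (hx m); have := mul_nonneg ht (hy m); linarith

theorem cell_subset : cell f p₀ ⊆ closedCell f p₀ := fun _ h m => (h m).le

theorem convex_cell : Convex ℝ (cell f p₀) := fun x hx y hy s t hs ht h => by
  rcases ht.eq_or_lt with rfl | ht
  · simpa [show s = 1 by linarith] using hx
  · exact combo_mem_cell hs ht h (cell_subset hx) hy

theorem self_mem_cell (h : ∀ m, f m p₀ ≠ 0) : p₀ ∈ cell f p₀ := fun m => mul_self_pos.2 (h m)

theorem closure_cell (h : ∀ m, f m p₀ ≠ 0) : closure (cell f p₀) = closedCell f p₀ := by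
  refine (closure_minimal cell_subset isClosed_closedCell).antisymm fun x hx => ?_
  have h1 : openSegment ℝ x p₀ ⊆ cell f p₀ := by
    rintro _ ⟨s, t, hs, ht, hst, rfl⟩
    exact combo_mem_cell hs.le ht hst hx (self_mem_cell h)
  refine closure_mono h1 ?_
  rw [closure_openSegment]
  exact left_mem_segment ℝ x p₀

theorem interior_closedCell [Finite ι] (h : ∀ m, f m p₀ ≠ 0) :
    interior (closedCell f p₀) = cell f p₀ := by
  rw [← closure_cell h, convex_cell.interior_closure_eq_interior_of_nonempty_interior,
    isOpen_cell.interior_eq]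
  rw [isOpen_cell.interior_eq]
  exact ⟨_, self_mem_cell h⟩

theorem mem_frontier_closedCell [Finite ι] (h : ∀ m, f m p₀ ≠ 0) (hx : x ∈ closedCell f p₀)
    (hax : f a x = 0) : x ∈ frontier (closedCell f p₀) := by
  rw [isClosed_closedCell.frontier_eq, interior_closedCell h]
  exact ⟨hx, fun k => by simpa [hax] using k a⟩

theorem connectedComponentIn_eq_cell (h : ∀ m, f m p₀ ≠ 0) {U : Set (ℝ × ℝ)}
    (hU : ∀ x ∈ U, ∀ m, f m x ≠ 0) (hc : cell f p₀ ⊆ U) :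
    connectedComponentIn U p₀ = cell f p₀ := by
  have hp := self_mem_cell h
  refine subset_antisymm (fun x hx m => ?_)
    (convex_cell.isPreconnected.subset_connectedComponentIn hp hc)
  by_contra hneg
  have hpre : IsPreconnected (connectedComponentIn U p₀) := isPreconnected_connectedComponentIn
  have hcont : ContinuousOn (fun y => f m y * f m p₀) (connectedComponentIn U p₀) :=
    ((continuous_affine _).mul continuous_const).continuousOn
  obtain ⟨y, hy, hy0⟩ := hpre.intermediate_value hx (mem_connectedComponentIn (hc hp)) hcont
    ⟨not_lt.1 hneg, (hp m).le⟩
  have := hU y (connectedComponentIn_subset _ _ hy) m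
  simp_all

/-- From a point of the closed cell, one may move a little in any direction which does not
decrease the functions vanishing there. -/
theorem exists_pos_move [Finite ι] (hx : x ∈ closedCell f p₀) (y z : ℝ × ℝ)
    (h : ∀ m, f m x = 0 → 0 ≤ (f m y - f m z) * f m p₀) :
    ∃ t : ℝ, 0 < t ∧ x + t • (y - z) ∈ closedCell f p₀ := by
  have h1 : ∀ m, ∀ᶠ t : ℝ in nhdsWithin 0 (Ioi 0), 0 ≤ f m (x + t • (y - z)) * f m p₀ := by
    intro m
    by_cases hm : 0 < f m x * f m p₀
    · have hc : Continuous fun t : ℝ => f m (x + t • (y - z)) * f m p₀ :=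
        ((continuous_affine _).comp (by fun_prop)).mul continuous_const
      have := hc.continuousAt (x := 0) |>.eventually (lt_mem_nhds (a := 0) (by simpa using hm))
      exact (this.filter_mono nhdsWithin_le_nhds).mono fun t ht => ht.le
    · by_cases hp : f m p₀ = 0
      · simp [hp]
      · have h0 : f m x = 0 := by
          have := (hx m).antisymm (not_lt.1 hm)
          exact (mul_eq_zero.1 this.symm).resolve_right hp
        filter_upwards [self_mem_nhdsWithin] with t ht
        rw [affine_add_smul_sub, h0, zero_add, mul_assoc]
        exact mul_nonneg (le_of_lt ht) (h m h0)
  obtain ⟨t, ht, ht'⟩ := ((Filter.eventually_all.2 h1).and self_mem_nhdsWithin).exists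
  exact ⟨t, ht', ht⟩

/-- At a point of the closed cell lying on exactly two of the lines, if one of them contains an edge
of the cell, so does the other one. -/
theorem exists_edge [Finite ι] (h : ∀ m, f m p₀ ≠ 0) (hx : x ∈ closedCell f p₀)
    (hax : f a x = 0) (hbx : f b x = 0) (hab : ∀ m, f m x = 0 → m = a ∨ m = b)
    (hay : f a y = 0) (hby : f b y ≠ 0) :
    ∃ z ∈ closedCell f p₀, f b z = 0 ∧ f a z ≠ 0 := by
  have hp := (self_mem_cell h)
  set t := f b p₀ / f b y with ht
  have hty : t * f b y = f b p₀ := by rw [ht]; field_simp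
  set z := p₀ - t • (y - x) with hz
  have e : ∀ m, f m z = f m p₀ - t * (f m y - f m x) := fun m => by
    rw [hz, sub_eq_add_neg, ← neg_smul, affine_add_smul_sub]; ring
  have ha : f a z = f a p₀ := by rw [e, hay, hax]; ring
  have hb : f b z = 0 := by rw [e, hbx, sub_zero, hty, sub_self]
  obtain ⟨ε, hε, hm⟩ := exists_pos_move hx z x (fun m hm => by
    rcases hab m hm with rfl | rfl
    · rw [ha, hm, sub_zero]; exact (hp m).le
    · rw [hb, hm]; simp)
  refine ⟨_, hm, ?_, ?_⟩
  · rw [affine_add_smul_sub, hb, hbx]; ring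
  · rw [affine_add_smul_sub, ha, hax]
    simpa using ⟨hε.ne', h a⟩

/-- The far end of an edge of the cell lies on a further line. -/
theorem exists_far_end [Finite ι] (h : ∀ m, f m p₀ ≠ 0) (hc : IsCompact (closedCell f p₀))
    (hax : f a x = 0) (hbx : f b x = 0)
    (hy : y ∈ closedCell f p₀) (hby : f b y = 0) (hay : f a y ≠ 0) :
    ∃ z ∈ closedCell f p₀, f b z = 0 ∧ f a z ≠ 0 ∧ ∃ m, m ≠ b ∧ f m z = 0 := by
  have hK : IsCompact (closedCell f p₀ ∩ {z | f b z = 0}) :=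
    hc.inter_right (isClosed_eq (continuous_affine _) continuous_const)
  obtain ⟨z, ⟨hz, hzb⟩, hmax⟩ := hK.exists_isMaxOn ⟨y, hy, hby⟩
    (f := fun z => f a z * f a p₀) ((continuous_affine _).mul continuous_const).continuousOn
  have hpos : 0 < f a y * f a p₀ := (hy a).lt_of_ne (mul_ne_zero hay (h a)).symm
  have hza : 0 < f a z * f a p₀ := hpos.trans_le (hmax ⟨hy, hby⟩)
  refine ⟨z, hz, hzb, fun k => by simp [k] at hza, ?_⟩
  by_contra! hm
  have hzb : f b z = 0 := hzb
  obtain ⟨ε, hε, hmem⟩ := exists_pos_move hz z x (fun m hmz => by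
    have : m = b := by by_contra k; exact hm m k hmz
    subst this; rw [hmz, hbx]; simp)
  have := hmax ⟨hmem, by
    show f b _ = 0
    rw [affine_add_smul_sub, hzb, hbx]; ring⟩
  simp only [mem_ofPred_eq, affine_add_smul_sub, hax] at this
  nlinarith

end Cell

/-- The affine function vanishing on the line through `a` and `b`. -/
def lineFn (a b : ℝ × ℝ) : (ℝ × ℝ) →ᵃ[ℝ] ℝ where
  toFun q := (b.1 - a.1) * (q.2 - a.2) - (b.2 - a.2) * (q.1 - a.1)
  linear := (b.1 - a.1) • LinearMap.snd ℝ ℝ ℝ - (b.2 - a.2) • LinearMap.fst ℝ ℝ ℝ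
  map_vadd' p v := by simp; ring

theorem lineFn_apply (a b q : ℝ × ℝ) :
    lineFn a b q = (b.1 - a.1) * (q.2 - a.2) - (b.2 - a.2) * (q.1 - a.1) := rfl

theorem lineFn_left (a b : ℝ × ℝ) : lineFn a b a = 0 := by simp [lineFn_apply]

theorem lineFn_right (a b : ℝ × ℝ) : lineFn a b b = 0 := by simp [lineFn_apply]; ring

theorem exists_param {a b p q x : ℝ × ℝ} (hab : a ≠ b) (hpq : p ≠ q) (hp : lineFn a b p = 0)
    (hq : lineFn a b q = 0) (hx : lineFn a b x = 0) : ∃ t : ℝ, x = p + t • (q - p) := by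
  simp only [lineFn_apply] at hp hq hx
  have h : (q.1 - p.1) * (x.2 - p.2) = (q.2 - p.2) * (x.1 - p.1) := by
    by_cases h1 : b.1 - a.1 = 0
    · have h2 : b.2 - a.2 ≠ 0 := fun h2 => hab (Prod.ext (by linarith) (by linarith))
      refine mul_left_cancel₀ h2 ?_
      linear_combination (p.2 - x.2) * (hq - hp) - (p.2 - q.2) * (hx - hp)
    · refine mul_left_cancel₀ h1 ?_
      linear_combination (q.1 - p.1) * (hx - hp) - (x.1 - p.1) * (hq - hp)
  by_cases h1 : q.1 - p.1 = 0
  · have h2 : q.2 - p.2 ≠ 0 := fun h2 => hpq (Prod.ext (by linarith) (by linarith))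
    refine ⟨(x.2 - p.2) / (q.2 - p.2), Prod.ext ?_ ?_⟩
    · simp only [Prod.fst_add, Prod.smul_fst, Prod.fst_sub, smul_eq_mul, h1, mul_zero, add_zero]
      have : (q.2 - p.2) * (x.1 - p.1) = 0 := by rw [← h, h1, zero_mul]
      have := (mul_eq_zero.1 this).resolve_left h2
      linarith
    · simp only [Prod.snd_add, Prod.smul_snd, Prod.snd_sub, smul_eq_mul]
      field_simp; ring
  · refine ⟨(x.1 - p.1) / (q.1 - p.1), Prod.ext ?_ ?_⟩
    · simp only [Prod.fst_add, Prod.smul_fst, Prod.fst_sub, smul_eq_mul]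
      field_simp; ring
    · simp only [Prod.snd_add, Prod.smul_snd, Prod.snd_sub, smul_eq_mul]
      field_simp; linarith

theorem eq_zero_of_lineFn {a b p q x : ℝ × ℝ} (hab : a ≠ b) (hpq : p ≠ q) (hp : lineFn a b p = 0)
    (hq : lineFn a b q = 0) (hx : lineFn a b x = 0) (g : (ℝ × ℝ) →ᵃ[ℝ] ℝ) (hgp : g p = 0)
    (hgq : g q = 0) : g x = 0 := by
  obtain ⟨t, rfl⟩ := exists_param hab hpq hp hq hx
  rw [affine_add_smul_sub, hgp, hgq]; ring

theorem lineFn_eq_zero_iff {a b p q x : ℝ × ℝ} (hab : a ≠ b) (hpq : p ≠ q) (hp : lineFn a b p = 0)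
    (hq : lineFn a b q = 0) :
    lineFn a b x = 0 ↔ x ∈ affineSpan ℝ ({p, q} : Set (ℝ × ℝ)) := by
  constructor
  · intro hx
    obtain ⟨t, rfl⟩ := exists_param hab hpq hp hq hx
    rw [add_comm, ← vsub_eq_sub, ← vadd_eq_add, ← AffineMap.lineMap_apply]
    exact AffineMap.lineMap_mem_affineSpan_pair _ _ _
  · intro hx
    obtain ⟨t, rfl⟩ := mem_affineSpan_pair_iff_exists_lineMap_eq.1 hx
    rw [AffineMap.lineMap_apply, vadd_eq_add, vsub_eq_sub, add_comm, affine_add_smul_sub, hp, hq]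
    ring

theorem lineFn_rotate (a b c : ℝ × ℝ) : lineFn b c a = lineFn a b c := by
  simp only [lineFn_apply]; ring

theorem bary {a b c : ℝ × ℝ} (h : lineFn a b c ≠ 0) (q : ℝ × ℝ) :
    q = (lineFn b c q / lineFn a b c) • a + (lineFn c a q / lineFn a b c) • b +
      (lineFn a b q / lineFn a b c) • c ∧
    lineFn b c q / lineFn a b c + lineFn c a q / lineFn a b c + lineFn a b q / lineFn a b c = 1 := by
  refine ⟨Prod.ext ?_ ?_, ?_⟩
  · simp only [Prod.fst_add, Prod.smul_fst, smul_eq_mul]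
    field_simp
    simp only [lineFn_apply]; ring
  · simp only [Prod.snd_add, Prod.smul_snd, smul_eq_mul]
    field_simp
    simp only [lineFn_apply]; ring
  · field_simp
    simp only [lineFn_apply]; ring

theorem convex_halfPlane (d : ℝ) (g : (ℝ × ℝ) →ᵃ[ℝ] ℝ) : Convex ℝ {q | 0 ≤ d * g q} := by
  intro x hx y hy s t hs ht hst
  change 0 ≤ d * g (s • x + t • y)
  rw [affine_combo g hst, mul_add, mul_left_comm, mul_left_comm d t]
  exact add_nonneg (mul_nonneg hs hx) (mul_nonneg ht hy)

theorem mul_nonneg_of_mem_hull {a b c q : ℝ × ℝ} (hq : q ∈ convexHull ℝ {a, b, c}) :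
    0 ≤ lineFn a b c * lineFn a b q := by
  refine convexHull_min (t := {q | 0 ≤ lineFn a b c * lineFn a b q}) ?_ (convex_halfPlane _ _) hq
  rintro x (rfl | rfl | rfl)
  · change 0 ≤ lineFn x b c * lineFn x b x
    rw [lineFn_left, mul_zero]
  · change 0 ≤ lineFn a x c * lineFn a x x
    rw [lineFn_right, mul_zero]
  · exact mul_self_nonneg (lineFn a b x)

theorem hull_rotate (a b c : ℝ × ℝ) :
    convexHull ℝ ({b, c, a} : Set (ℝ × ℝ)) = convexHull ℝ {a, b, c} := by
  congr 1; ext; simp; tauto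

theorem mem_hull {a b c q : ℝ × ℝ} (h : lineFn a b c ≠ 0) (h1 : 0 ≤ lineFn a b c * lineFn b c q)
    (h2 : 0 ≤ lineFn a b c * lineFn c a q) (h3 : 0 ≤ lineFn a b c * lineFn a b q) :
    q ∈ convexHull ℝ {a, b, c} := by
  have aux : ∀ {x : ℝ}, 0 ≤ lineFn a b c * x → 0 ≤ x / lineFn a b c := fun {x} hx => by
    rw [← mul_div_mul_left _ _ h]; exact div_nonneg hx (mul_self_nonneg _)
  obtain ⟨e, hs⟩ := bary h q
  rw [e]
  have hsub := subset_convexHull ℝ ({a, b, c} : Set (ℝ × ℝ))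
  have := (convex_convexHull ℝ ({a, b, c} : Set (ℝ × ℝ))).sum_mem (t := Finset.univ (α := Fin 3))
    (w := ![lineFn b c q / lineFn a b c, lineFn c a q / lineFn a b c, lineFn a b q / lineFn a b c])
    (z := ![a, b, c]) (by intro i _; fin_cases i <;> simp [aux h1, aux h2, aux h3])
    (by simpa [Fin.sum_univ_three] using hs)
    (by intro i _; apply hsub; fin_cases i <;> simp)
  simpa [Fin.sum_univ_three] using this

theorem mem_segment_iff {a b c q : ℝ × ℝ} (h : lineFn a b c ≠ 0)
    (hq : q ∈ convexHull ℝ {a, b, c}) : lineFn a b q = 0 ↔ q ∈ segment ℝ a b := by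
  constructor
  · intro h0
    have h1 := mul_nonneg_of_mem_hull (a := b) (b := c) (c := a) (by rwa [hull_rotate])
    have h2 := mul_nonneg_of_mem_hull (a := c) (b := a) (c := b)
      (by rwa [hull_rotate, hull_rotate])
    rw [lineFn_rotate] at h1
    rw [lineFn_rotate, lineFn_rotate] at h2
    obtain ⟨e, hs⟩ := bary h q
    rw [h0] at e hs
    simp only [zero_div, zero_smul, add_zero] at e hs
    refine ⟨_, _, ?_, ?_, hs, e.symm⟩
    · rw [← mul_div_mul_left _ _ h]; exact div_nonneg h1 (mul_self_nonneg _)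
    · rw [← mul_div_mul_left _ _ h]; exact div_nonneg h2 (mul_self_nonneg _)
  · rintro ⟨s, t, -, -, hst, rfl⟩
    rw [affine_combo _ hst, lineFn_left, lineFn_right]; simp

end Blocking

namespace TBA

open Blocking

variable (Δ : TBA)

theorem area_ne_zero : lineFn Δ.x1 Δ.x2 Δ.x3 ≠ 0 := by
  intro h
  have h1 : Δ.x1 ≠ Δ.x2 := fun e => by
    have := Δ.indep.injective (a₁ := 0) (a₂ := 1) (by simpa using e); simp at this
  have := affineIndependent_iff_not_collinear_set.1 Δ.indep
  refine this ((collinear_iff_of_mem (p₀ := Δ.x1) (by simp)).2 ⟨Δ.x2 - Δ.x1, ?_⟩)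
  obtain ⟨t, ht⟩ := exists_param h1 h1 (lineFn_left _ _) (lineFn_right _ _) h
  rintro p (rfl | rfl | rfl)
  · exact ⟨0, by simp⟩
  · exact ⟨1, by simp⟩
  · exact ⟨t, by rw [ht]; simp [add_comm]⟩

/-- The affine function `f` is the equation of a line cutting the triangle in the set `s`. -/
def IsFn (s : Set Pt) (f : Pt →ᵃ[ℝ] ℝ) : Prop :=
  s ⊆ Δ.tri ∧ (∃ a b, a ∈ s ∧ b ∈ s ∧ a ≠ b ∧ f = lineFn a b) ∧ ∀ q ∈ Δ.tri, f q = 0 ↔ q ∈ s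

theorem edge_aux {a b c : Pt} (h : lineFn a b c ≠ 0) (hT : Δ.tri = convexHull ℝ {a, b, c}) :
    Δ.IsFn (segment ℝ a b) (lineFn a b) := by
  refine ⟨?_, ⟨a, b, left_mem_segment _ _ _, right_mem_segment _ _ _, ?_, rfl⟩, fun q hq => mem_segment_iff h (hT ▸ hq)⟩
  · rw [hT]
    exact (convex_convexHull _ _).segment_subset (subset_convexHull _ _ (by simp))
      (subset_convexHull _ _ (by simp))
  · rintro rfl
    exact h (by simp [lineFn_apply])

theorem isFn_12 : Δ.IsFn (segment ℝ Δ.x1 Δ.x2) (lineFn Δ.x1 Δ.x2) :=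
  Δ.edge_aux Δ.area_ne_zero rfl

theorem isFn_23 : Δ.IsFn (segment ℝ Δ.x2 Δ.x3) (lineFn Δ.x2 Δ.x3) :=
  Δ.edge_aux (by rw [lineFn_rotate]; exact Δ.area_ne_zero) (hull_rotate _ _ _).symm

theorem isFn_31 : Δ.IsFn (segment ℝ Δ.x3 Δ.x1) (lineFn Δ.x3 Δ.x1) :=
  Δ.edge_aux (by rw [lineFn_rotate, lineFn_rotate]; exact Δ.area_ne_zero)
    (by rw [hull_rotate, hull_rotate]; rfl)

theorem nonneg_12 {q : Pt} (hq : q ∈ Δ.tri) :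
    0 ≤ lineFn Δ.x1 Δ.x2 Δ.x3 * lineFn Δ.x1 Δ.x2 q := mul_nonneg_of_mem_hull hq

theorem nonneg_23 {q : Pt} (hq : q ∈ Δ.tri) :
    0 ≤ lineFn Δ.x1 Δ.x2 Δ.x3 * lineFn Δ.x2 Δ.x3 q := by
  rw [← lineFn_rotate]; exact mul_nonneg_of_mem_hull (by rw [hull_rotate]; exact hq)

theorem nonneg_31 {q : Pt} (hq : q ∈ Δ.tri) :
    0 ≤ lineFn Δ.x1 Δ.x2 Δ.x3 * lineFn Δ.x3 Δ.x1 q := by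
  rw [← lineFn_rotate, ← lineFn_rotate]
  exact mul_nonneg_of_mem_hull (by rw [hull_rotate, hull_rotate]; exact hq)

/-- The edges of the triangle lie on lines of which the triangle is on one side. -/
theorem edge_spec {e : Set Pt} (he : e ∈ triEdges Δ.x1 Δ.x2 Δ.x3) : ∃ h : Pt →ᵃ[ℝ] ℝ,
    Δ.IsFn e h ∧ ∀ q ∈ Δ.tri, 0 ≤ lineFn Δ.x1 Δ.x2 Δ.x3 * h q := by
  rcases he with rfl | rfl | rfl
  exacts [⟨_, Δ.isFn_12, fun _ => Δ.nonneg_12⟩, ⟨_, Δ.isFn_23, fun _ => Δ.nonneg_23⟩,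
    ⟨_, Δ.isFn_31, fun _ => Δ.nonneg_31⟩]

theorem mem_bdry_iff {x : Pt} : x ∈ Δ.bdry ↔ ∃ e ∈ triEdges Δ.x1 Δ.x2 Δ.x3, x ∈ e := by
  simp [bdry, triBdry, triEdges, or_assoc]

theorem bdry_subset : Δ.bdry ⊆ Δ.tri := fun x hx => by
  obtain ⟨e, he, hx⟩ := Δ.mem_bdry_iff.1 hx
  obtain ⟨h, hf, -⟩ := Δ.edge_spec he
  exact hf.1 hx

theorem convex_tri : Convex ℝ Δ.tri := convex_convexHull _ _

/-- A segment with endpoints on the boundary and interior off the boundary cannot be prolonged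
inside the triangle. -/
theorem not_prolong {a b q : Pt} (ha : a ∈ Δ.tri) (hb : b ∈ Δ.bdry) (hq : q ∈ Δ.tri)
    (hab : ∀ p ∈ openSegment ℝ a b, p ∉ Δ.bdry) {t : ℝ} (ht : 1 < t) (e : q = a + t • (b - a)) :
    False := by
  obtain ⟨E, hE, hbE⟩ := Δ.mem_bdry_iff.1 hb
  obtain ⟨h, hf, hs⟩ := Δ.edge_spec hE
  have hb0 := (hf.2.2 b (hf.1 hbE)).2 hbE
  have h1 := hs a ha
  have h2 := hs q hq
  rw [e, affine_add_smul_sub, hb0] at h2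
  have h3 : lineFn Δ.x1 Δ.x2 Δ.x3 * h a = 0 := by nlinarith
  have ha0 := (mul_eq_zero.1 h3).resolve_left Δ.area_ne_zero
  have hm : (1 / 2 : ℝ) • a + (1 / 2 : ℝ) • b ∈ openSegment ℝ a b :=
    ⟨1 / 2, 1 / 2, by norm_num, by norm_num, by norm_num, rfl⟩
  refine hab _ hm (Δ.mem_bdry_iff.2 ⟨E, hE, (hf.2.2 _ ?_).1 ?_⟩)
  · exact Δ.convex_tri.segment_subset ha (Δ.bdry_subset hb) (openSegment_subset_segment _ _ _ hm)
  · rw [affine_combo h (by norm_num), ha0, hb0]; simp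

theorem seg_isFn {a b : Pt} (hne : a ≠ b) (ha : a ∈ Δ.bdry) (hb : b ∈ Δ.bdry)
    (hab : ∀ p ∈ openSegment ℝ a b, p ∉ Δ.bdry) : Δ.IsFn (segment ℝ a b) (lineFn a b) := by
  refine ⟨Δ.convex_tri.segment_subset (Δ.bdry_subset ha) (Δ.bdry_subset hb),
    ⟨a, b, left_mem_segment _ _ _, right_mem_segment _ _ _, hne, rfl⟩, fun q hq => ⟨fun h0 => ?_, ?_⟩⟩
  · obtain ⟨t, rfl⟩ := exists_param hne hne (lineFn_left _ _) (lineFn_right _ _) h0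
    rcases lt_or_ge 1 t with h1 | h1
    · exact (Δ.not_prolong (Δ.bdry_subset ha) hb hq hab h1 rfl).elim
    rcases lt_or_ge t 0 with h2 | h2
    · exact (Δ.not_prolong (t := 1 - t) (Δ.bdry_subset hb) ha hq
        (by rwa [openSegment_symm]) (by linarith) (by module)).elim
    · exact ⟨1 - t, t, by linarith, h2, by ring, by module⟩
  · rintro ⟨s, t, -, -, hst, rfl⟩
    rw [affine_combo _ hst, lineFn_left, lineFn_right]; simp

theorem exists_isFn {s : Set Pt} (hs : s ∈ Δ.Sbar ∪ Δ.B) : ∃ f, Δ.IsFn s f := by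
  have : s ∈ Δ.S ∪ Δ.B ∨ s ∈ triEdges Δ.x1 Δ.x2 Δ.x3 := by
    rcases hs with (h | h) | h
    · exact Or.inl (Or.inl h)
    · exact Or.inr h
    · exact Or.inl (Or.inr h)
  rcases this with h | h
  · obtain ⟨a, b, h1, rfl, h2, h3, h4⟩ := Δ.seg_wf s h
    exact ⟨_, Δ.seg_isFn h1 h2 h3 h4⟩
  · obtain ⟨f, hf, -⟩ := Δ.edge_spec h; exact ⟨f, hf⟩

/-- An equation of the line carrying the segment `s`. -/
def fn (s : Set Pt) : Pt →ᵃ[ℝ] ℝ := Classical.epsilon (Δ.IsFn s)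

theorem fn_spec {s : Set Pt} (hs : s ∈ Δ.Sbar ∪ Δ.B) : Δ.IsFn s (Δ.fn s) :=
  Classical.epsilon_spec (Δ.exists_isFn hs)

variable {Δ}

theorem IsFn.eq_zero {s : Set Pt} {f g : Pt →ᵃ[ℝ] ℝ} (hf : Δ.IsFn s f) {p q x : Pt} (hpq : p ≠ q)
    (hp : f p = 0) (hq : f q = 0) (hx : f x = 0) (hgp : g p = 0) (hgq : g q = 0) : g x = 0 := by
  obtain ⟨-, ⟨a, b, -, -, hab, rfl⟩, -⟩ := hf
  exact eq_zero_of_lineFn hab hpq hp hq hx g hgp hgq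

theorem IsFn.eq_of_two {s t : Set Pt} {f g : Pt →ᵃ[ℝ] ℝ} (hf : Δ.IsFn s f) (hg : Δ.IsFn t g)
    {p q : Pt} (hpq : p ≠ q) (hp : p ∈ s) (hq : q ∈ s) (hp' : p ∈ t) (hq' : q ∈ t) : s = t := by
  have z1 := (hf.2.2 p (hf.1 hp)).2 hp
  have z2 := (hf.2.2 q (hf.1 hq)).2 hq
  have z3 := (hg.2.2 p (hf.1 hp)).2 hp'
  have z4 := (hg.2.2 q (hf.1 hq)).2 hq'
  ext x
  constructor <;> intro hx
  · have hT := hf.1 hx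
    exact (hg.2.2 x hT).1 (hf.eq_zero hpq z1 z2 ((hf.2.2 x hT).2 hx) z3 z4)
  · have hT := hg.1 hx
    exact (hf.2.2 x hT).1 (hg.eq_zero hpq z3 z4 ((hg.2.2 x hT).2 hx) z1 z2)

theorem isFn_coe (i : Δ.Sbar) : Δ.IsFn i (Δ.fn i) := Δ.fn_spec (Or.inl i.2)

theorem isFn_coe_B (g : Δ.B) : Δ.IsFn g (Δ.fn g) := Δ.fn_spec (Or.inr g.2)

theorem IsFn.mem {s : Set Pt} {f : Pt →ᵃ[ℝ] ℝ} (hf : Δ.IsFn s f) {p : Δ.tri} (hp : f p = 0) :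
    (p : Pt) ∈ s := (hf.2.2 p p.2).1 hp

theorem IsFn.eq_zero_of_mem {s : Set Pt} {f : Pt →ᵃ[ℝ] ℝ} (hf : Δ.IsFn s f) {p : Pt}
    (hp : p ∈ s) : f p = 0 := (hf.2.2 p (hf.1 hp)).2 hp

/-- An affine function taking opposite signs at two points vanishes strictly between them. -/
theorem exists_zero {f : Pt →ᵃ[ℝ] ℝ} {p q : Pt} (h : Opp (f p) (f q)) :
    ∃ z ∈ openSegment ℝ p q, f z = 0 := by
  obtain ⟨z, hz, h0⟩ := Opp.exists_zero (T := univ) convex_univ (f := f) (x := ⟨p, trivial⟩)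
    (y := ⟨q, trivial⟩) h
  exact ⟨z, hz, h0⟩

theorem not_opp_edge {e : Set Pt} (he : e ∈ triEdges Δ.x1 Δ.x2 Δ.x3) {f : Pt →ᵃ[ℝ] ℝ}
    (hf : Δ.IsFn e f) {p q : Pt} (hp : p ∈ Δ.tri) (hq : q ∈ Δ.tri) : ¬ Opp (f p) (f q) := by
  intro h
  obtain ⟨k, hk, hs⟩ := Δ.edge_spec he
  obtain ⟨z, hz, hz0⟩ := exists_zero h
  have hzT := Δ.convex_tri.segment_subset hp hq (openSegment_subset_segment _ _ _ hz)
  have hkz := (hk.2.2 z hzT).2 ((hf.2.2 z hzT).1 hz0)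
  obtain ⟨s, t, hs0, ht0, hst, rfl⟩ := hz
  rw [affine_combo _ hst] at hkz
  have h1 := hs p hp
  have h2 := hs q hq
  have h3 : lineFn Δ.x1 Δ.x2 Δ.x3 * k p = 0 := by
    have : s * (lineFn Δ.x1 Δ.x2 Δ.x3 * k p) + t * (lineFn Δ.x1 Δ.x2 Δ.x3 * k q) = 0 := by
      linear_combination lineFn Δ.x1 Δ.x2 Δ.x3 * hkz
    nlinarith [mul_nonneg hs0.le h1, mul_nonneg ht0.le h2]
  have h4 := (hf.2.2 p hp).2 ((hk.2.2 p hp).1 ((mul_eq_zero.1 h3).resolve_left Δ.area_ne_zero))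
  rw [h4] at h
  rcases h with h | h <;> exact lt_irrefl _ h.1

theorem exists_second (i : Δ.Sbar) (g : Δ.B) {p : Pt} (hi : p ∈ i.1) (hg : p ∈ g.1) :
    ∃ j : Δ.Sbar, i ≠ j ∧ p ∈ j.1 := by
  obtain ⟨s, ⟨h1, h2, h3⟩, -⟩ := Δ.second_segment i i.2 g g.2 p hi hg
  exact ⟨⟨s, h1⟩, fun e => h2 (by rw [e]), h3⟩

instance : Finite Δ.Sbar := by
  refine (Δ.finS.union ?_).to_subtype
  simp [triEdges]

instance : Finite Δ.B := Δ.finB.to_subtype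

theorem eq_of_mem_of_mem (i j : Δ.Sbar) {p q : Pt} (hpq : p ≠ q) (h1 : p ∈ i.1) (h2 : q ∈ i.1)
    (h3 : p ∈ j.1) (h4 : q ∈ j.1) : i = j :=
  Subtype.ext ((isFn_coe i).eq_of_two (isFn_coe j) hpq h1 h2 h3 h4)

/-- An initial segment and a blocking segment share at most one point. -/
theorem eq_of_mem_block (i : Δ.Sbar) (g : Δ.B) {p q : Pt} (h1 : p ∈ i.1) (h2 : q ∈ i.1)
    (h3 : p ∈ g.1) (h4 : q ∈ g.1) : p = q := by
  by_contra hpq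
  have e : i.1 = g.1 := (isFn_coe i).eq_of_two (isFn_coe_B g) hpq h1 h2 h3 h4
  let x : ℕ → Pt := fun n => p + (1 / ((n : ℝ) + 1)) • (q - p)
  have hx : ∀ n, x n ∈ i.1 := fun n => by
    have hT : x n ∈ Δ.tri := by
      refine Δ.convex_tri.add_smul_sub_mem ((isFn_coe i).1 h1) ((isFn_coe i).1 h2) ⟨by positivity, ?_⟩
      rw [div_le_one (by positivity)]; linarith [(Nat.cast_nonneg n : (0 : ℝ) ≤ n)]
    refine ((isFn_coe i).2.2 _ hT).1 ?_
    rw [affine_add_smul_sub, (isFn_coe i).eq_zero_of_mem h1, (isFn_coe i).eq_zero_of_mem h2]; simp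
  choose j hij hj using fun n => exists_second i g (hx n) (e ▸ hx n)
  obtain ⟨n, m, hnm, hjj⟩ := Finite.exists_ne_map_eq_of_infinite j
  refine hij n (eq_of_mem_of_mem i (j n) (p := x n) (q := x m) (fun h => hnm ?_) (hx n) (hx m) (hj n) (hjj ▸ hj m))
  have h5 : (1 / ((n : ℝ) + 1)) • (q - p) = (1 / ((m : ℝ) + 1)) • (q - p) := add_left_cancel h
  have h6 := smul_left_injective ℝ (sub_ne_zero.2 (Ne.symm hpq)) h5
  have : (n : ℝ) = m := by simpa using h6
  exact_mod_cast this

/-- The equations of the initial segments. -/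
def eqn (Δ : TBA) (m : Δ.Sbar) : Pt →ᵃ[ℝ] ℝ := Δ.fn m

theorem eqn_eq_zero_iff (m : Δ.Sbar) {x : Pt} (hx : x ∈ Δ.tri) : Δ.eqn m x = 0 ↔ x ∈ m.1 :=
  (isFn_coe m).2.2 x hx

theorem eqn_eq_zero (m : Δ.Sbar) {x : Pt} (hx : x ∈ m.1) : Δ.eqn m x = 0 :=
  (isFn_coe m).eq_zero_of_mem hx

theorem eqn_combo_eq_zero (m : Δ.Sbar) {x y z : Pt} (hx : Δ.eqn m x = 0) (hy : Δ.eqn m y = 0)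
    (hz : z ∈ segment ℝ x y) : Δ.eqn m z = 0 := by
  obtain ⟨s, t, -, -, hst, rfl⟩ := hz
  rw [affine_combo _ hst, hx, hy]; simp

theorem eqn_two {i j : Δ.Sbar} {p q : Pt} (hp : p ∈ Δ.tri) (hq : q ∈ Δ.tri) (hpq : p ≠ q)
    (h1 : Δ.eqn i p = 0) (h2 : Δ.eqn i q = 0) (h3 : Δ.eqn j p = 0) (h4 : Δ.eqn j q = 0) : i = j :=
  eq_of_mem_of_mem i j hpq ((eqn_eq_zero_iff i hp).1 h1) ((eqn_eq_zero_iff i hq).1 h2)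
    ((eqn_eq_zero_iff j hp).1 h3) ((eqn_eq_zero_iff j hq).1 h4)

theorem eqn_conc (i j k : Δ.Sbar) {p : Pt} (hp : p ∈ Δ.tri) (h1 : Δ.eqn i p = 0)
    (h2 : Δ.eqn j p = 0) (h3 : Δ.eqn k p = 0) : i = j ∨ i = k ∨ j = k := by
  by_contra! h
  exact Δ.no_three_concurrent i i.2 j j.2 k k.2 (fun e => h.1 (Subtype.ext e))
    (fun e => h.2.1 (Subtype.ext e)) (fun e => h.2.2 (Subtype.ext e))
    ⟨p, (eqn_eq_zero_iff i hp).1 h1, (eqn_eq_zero_iff j hp).1 h2, (eqn_eq_zero_iff k hp).1 h3⟩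

variable {p₀ : Pt}

theorem nonneg_of_mem_closedCell (hp : p₀ ∈ Δ.tri) (h : ∀ m, Δ.eqn m p₀ ≠ 0) {e : Set Pt}
    (he : e ∈ triEdges Δ.x1 Δ.x2 Δ.x3) {k : Pt →ᵃ[ℝ] ℝ} (hk : Δ.IsFn e k) {d : ℝ}
    (hd : ∀ q ∈ Δ.tri, 0 ≤ d * k q) {x : Pt} (hx : x ∈ closedCell Δ.eqn p₀) : 0 ≤ d * k x := by
  by_contra! hneg
  let m : Δ.Sbar := ⟨e, Or.inr he⟩
  have h0 : k p₀ ≠ 0 := fun h0 => h m (eqn_eq_zero m ((hk.2.2 p₀ hp).1 h0))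
  have hopp : Opp (k x) (k p₀) := by
    have := hd p₀ hp
    rcases lt_trichotomy d 0 with hd' | rfl | hd'
    · exact Or.inl ⟨by nlinarith, lt_of_le_of_ne (by nlinarith) h0⟩
    · simp at hneg
    · exact Or.inr ⟨by nlinarith, lt_of_le_of_ne (by nlinarith) h0.symm⟩
  obtain ⟨z, ⟨s, t, hs, ht, hst, rfl⟩, hz⟩ := exists_zero hopp
  have h1 := combo_mem_cell hs.le ht hst hx (self_mem_cell h) m
  obtain ⟨-, ⟨a, b, ha, hb, hab, rfl⟩, -⟩ := id hk
  have h2 : Δ.eqn m (s • x + t • p₀) = 0 :=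
    hk.eq_zero hab (lineFn_left _ _) (lineFn_right _ _) hz (eqn_eq_zero m ha) (eqn_eq_zero m hb)
  rw [h2] at h1; simp at h1

theorem closedCell_subset_tri (hp : p₀ ∈ Δ.tri) (h : ∀ m, Δ.eqn m p₀ ≠ 0) :
    closedCell Δ.eqn p₀ ⊆ Δ.tri := fun _ hx =>
  mem_hull Δ.area_ne_zero
    (nonneg_of_mem_closedCell hp h (by simp [triEdges]) Δ.isFn_23 (fun _ => Δ.nonneg_23) hx)
    (nonneg_of_mem_closedCell hp h (by simp [triEdges]) Δ.isFn_31 (fun _ => Δ.nonneg_31) hx)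
    (nonneg_of_mem_closedCell hp h (by simp [triEdges]) Δ.isFn_12 (fun _ => Δ.nonneg_12) hx)

theorem isCompact_closedCell (hp : p₀ ∈ Δ.tri) (h : ∀ m, Δ.eqn m p₀ ≠ 0) :
    IsCompact (closedCell Δ.eqn p₀) := by
  have hc : IsCompact Δ.tri := Set.Finite.isCompact_convexHull ℝ (Set.toFinite _)
  exact hc.of_isClosed_subset isClosed_closedCell (closedCell_subset_tri hp h)

theorem isMinRegion_closedCell (hp : p₀ ∈ Δ.tri) (h : ∀ m, Δ.eqn m p₀ ≠ 0) :
    Δ.IsMinRegion (closedCell Δ.eqn p₀) := by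
  have hsub : cell Δ.eqn p₀ ⊆ Δ.tri \ ⋃₀ Δ.Sbar := fun x hx => by
    refine ⟨closedCell_subset_tri hp h (cell_subset hx), ?_⟩
    rintro ⟨s, hs, hxs⟩
    have h1 := hx ⟨s, hs⟩
    rw [eqn_eq_zero ⟨s, hs⟩ hxs] at h1; simp at h1
  refine ⟨p₀, hsub (self_mem_cell h), ?_⟩
  rw [connectedComponentIn_eq_cell h (fun x hx m h0 => ?_) hsub, closure_cell h]
  exact hx.2 ⟨m, m.2, (eqn_eq_zero_iff m hx.1).1 h0⟩

theorem segment_subset_frontier (h : ∀ m, Δ.eqn m p₀ ≠ 0) {x y : Pt}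
    (hx : x ∈ closedCell Δ.eqn p₀) (hy : y ∈ closedCell Δ.eqn p₀) {m : Δ.Sbar}
    (h1 : Δ.eqn m x = 0) (h2 : Δ.eqn m y = 0) : segment ℝ x y ⊆ frontier (closedCell Δ.eqn p₀) :=
  fun _ hz => mem_frontier_closedCell h (convex_closedCell.segment_subset hx hy hz)
    (eqn_combo_eq_zero m h1 h2 hz)

theorem containsEdgeOf_closedCell (hp : p₀ ∈ Δ.tri) (h : ∀ m, Δ.eqn m p₀ ≠ 0) {x y : Pt}
    (hx : x ∈ closedCell Δ.eqn p₀) (hy : y ∈ closedCell Δ.eqn p₀) (hxy : x ≠ y) {m : Δ.Sbar}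
    (h1 : Δ.eqn m x = 0) (h2 : Δ.eqn m y = 0) : Δ.ContainsEdgeOf m (closedCell Δ.eqn p₀) :=
  ⟨x, y, hxy, fun _ hz => ⟨(eqn_eq_zero_iff m (closedCell_subset_tri hp h
    (convex_closedCell.segment_subset hx hy hz))).1 (eqn_combo_eq_zero m h1 h2 hz),
    segment_subset_frontier h hx hy h1 h2 hz⟩⟩

theorem isRegionVertex_closedCell (hp : p₀ ∈ Δ.tri) (h : ∀ m, Δ.eqn m p₀ ≠ 0) {x y z : Pt}
    (hx : x ∈ closedCell Δ.eqn p₀) (hy : y ∈ closedCell Δ.eqn p₀)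
    (hz : z ∈ closedCell Δ.eqn p₀) (hxy : x ≠ y) (hxz : x ≠ z) {m n : Δ.Sbar} (hmn : m ≠ n)
    (h1 : Δ.eqn m x = 0) (h2 : Δ.eqn m y = 0) (h3 : Δ.eqn n x = 0) (h4 : Δ.eqn n z = 0) :
    Δ.IsRegionVertex (closedCell Δ.eqn p₀) x :=
  ⟨hx, m, m.2, n, n.2, fun e => hmn (Subtype.ext e),
    (eqn_eq_zero_iff m (closedCell_subset_tri hp h hx)).1 h1,
    (eqn_eq_zero_iff n (closedCell_subset_tri hp h hx)).1 h3,
    containsEdgeOf_closedCell hp h hx hy hxy h1 h2, containsEdgeOf_closedCell hp h hx hz hxz h3 h4⟩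

/-- Walking along the boundary of a minimal region: beyond the edge `vu` on `i` there is an edge
from `u` along the other segment `k` through `u`. -/
theorem exists_next (hp : p₀ ∈ Δ.tri) (h : ∀ m, Δ.eqn m p₀ ≠ 0) {u v : Pt}
    (hu : u ∈ closedCell Δ.eqn p₀) (hv : v ∈ closedCell Δ.eqn p₀) (huv : u ≠ v) {i k : Δ.Sbar}
    (hik : i ≠ k) (h1 : Δ.eqn i v = 0) (h2 : Δ.eqn i u = 0) (h3 : Δ.eqn k u = 0) :
    ∃ x ∈ closedCell Δ.eqn p₀, Δ.eqn k x = 0 ∧ Δ.eqn i x ≠ 0 ∧ u ≠ x ∧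
      Δ.IsRegionVertex (closedCell Δ.eqn p₀) u ∧ Δ.IsRegionVertex (closedCell Δ.eqn p₀) x := by
  have hT := closedCell_subset_tri hp h
  have h4 : Δ.eqn k v ≠ 0 := fun h4 => hik (eqn_two (hT hu) (hT hv) huv h2 h1 h3 h4)
  obtain ⟨y, hy, hky, hiy⟩ := exists_edge h hu h2 h3
    (fun m hm => by rcases eqn_conc m i k (hT hu) hm h2 h3 with h | h | h <;> tauto) h1 h4
  obtain ⟨x, hx, hkx, hix, m, hmk, hmx⟩ := exists_far_end h (isCompact_closedCell hp h) h2 h3 hy hky hiy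
  have hux : u ≠ x := by rintro rfl; exact hix h2
  have h5 : Δ.eqn m u ≠ 0 := fun h5 => hmk (eqn_two (hT hu) (hT hx) hux h5 hmx h3 hkx)
  obtain ⟨y', hy', hmy', hky'⟩ := exists_edge h hx hkx hmx
    (fun n hn => by rcases eqn_conc n k m (hT hx) hn hkx hmx with h | h | h <;> tauto) h3 h5
  refine ⟨x, hx, hkx, hix, hux, ?_, ?_⟩
  · exact isRegionVertex_closedCell hp h hu hv hx huv hux hik h2 h1 h3 hkx
  · exact isRegionVertex_closedCell hp h hx hu hy' hux.symm (by rintro rfl; exact hky' hkx)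
      hmk.symm hkx h3 hmx hmy'

/-- A blocking segment does not cross an edge of a minimal region. -/
theorem not_opp_block (hp : p₀ ∈ Δ.tri) (h : ∀ m, Δ.eqn m p₀ ≠ 0) {u x : Pt}
    (hu : u ∈ closedCell Δ.eqn p₀) (hx : x ∈ closedCell Δ.eqn p₀) (hux : u ≠ x) {k : Δ.Sbar}
    (h1 : Δ.eqn k u = 0) (h2 : Δ.eqn k x = 0) (g : Δ.B) : ¬ Opp (Δ.fn g u) (Δ.fn g x) := by
  intro hopp
  have hT := closedCell_subset_tri hp h
  obtain ⟨y, hy, hy0⟩ := exists_zero hopp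
  have hy' := openSegment_subset_segment _ _ _ hy
  have hyT := Δ.convex_tri.segment_subset (hT hu) (hT hx) hy'
  obtain ⟨j, hkj, hj⟩ := exists_second k g
    ((eqn_eq_zero_iff k hyT).1 (eqn_combo_eq_zero k h1 h2 hy')) (((isFn_coe_B g).2.2 y hyT).1 hy0)
  have hj0 := eqn_eq_zero j hj
  obtain ⟨s, t, hs, ht, hst, rfl⟩ := hy
  rw [affine_combo _ hst] at hj0
  have h3 := mul_nonneg hs.le (hu j)
  have h4 := mul_nonneg ht.le (hx j)
  have h5 : s * (Δ.eqn j u * Δ.eqn j p₀) + t * (Δ.eqn j x * Δ.eqn j p₀) = 0 := by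
    linear_combination Δ.eqn j p₀ * hj0
  have h6 : s * (Δ.eqn j u * Δ.eqn j p₀) = 0 := by linarith
  have h7 : t * (Δ.eqn j x * Δ.eqn j p₀) = 0 := by linarith
  simp only [mul_eq_zero, hs.ne', ht.ne', h j, false_or, or_false] at h6 h7
  exact hkj (eqn_two (hT hu) (hT hx) hux h1 h2 h6 h7)

theorem block_eqn_unique (k : Δ.Sbar) (g : Δ.B) {p q : Pt} (hp : p ∈ Δ.tri) (hq : q ∈ Δ.tri)
    (h1 : Δ.eqn k p = 0) (h2 : Δ.eqn k q = 0) (h3 : Δ.fn g p = 0) (h4 : Δ.fn g q = 0) : p = q :=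
  eq_of_mem_block k g ((eqn_eq_zero_iff k hp).1 h1) ((eqn_eq_zero_iff k hq).1 h2)
    (((isFn_coe_B g).2.2 p hp).1 h3) (((isFn_coe_B g).2.2 q hq).1 h4)

theorem mem_affineSpan_iff (k : Δ.Sbar) {p q x : Pt} (hpq : p ≠ q) (hp : Δ.eqn k p = 0)
    (hq : Δ.eqn k q = 0) : x ∈ affineSpan ℝ ({p, q} : Set Pt) ↔ Δ.eqn k x = 0 := by
  obtain ⟨-, ⟨a, b, -, -, hab, h⟩, -⟩ := isFn_coe k
  unfold eqn at *
  rw [h] at hp hq ⊢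
  exact (lineFn_eq_zero_iff hab hpq hp hq).symm

/-- The concurrency condition (A), stated at a vertex whose two neighbouring edges lie on a common
minimal region. -/
theorem Strong.concurrent (hs : Δ.Strong) {i j k l : Δ.Sbar} (g : Δ.B) {v u w X : Pt}
    (hv : v ∈ Δ.tri) (hu : u ∈ Δ.tri) (hw : w ∈ Δ.tri) (hX : X ∈ Δ.tri)
    (hij : i ≠ j) (hki : k ≠ i) (hlj : l ≠ j)
    (iv : Δ.eqn i v = 0) (jv : Δ.eqn j v = 0) (iu : Δ.eqn i u = 0) (ku : Δ.eqn k u = 0)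
    (jw : Δ.eqn j w = 0) (lw : Δ.eqn l w = 0)
    (hvu : ∀ n, ¬ Opp (Δ.eqn n v) (Δ.eqn n u)) (hvw : ∀ n, ¬ Opp (Δ.eqn n v) (Δ.eqn n w))
    (gv : Δ.fn g v = 0) (huw : Opp (Δ.fn g u) (Δ.fn g w)) (kX : Δ.eqn k X = 0)
    (gX : Δ.fn g X = 0) : Δ.eqn l X = 0 := by
  by_cases hkl : k = l
  · rwa [← hkl]
  have nuv : u ≠ v := by rintro rfl; exact huw.ne_left gv
  have nwv : w ≠ v := by rintro rfl; exact huw.ne_right gv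
  have nuw : u ≠ w := by rintro rfl; rcases huw with h | h <;> linarith
  have iw : Δ.eqn i w ≠ 0 := fun h => hij (eqn_two hv hw nwv.symm iv h jv jw)
  have ju : Δ.eqn j u ≠ 0 := fun h => hij (eqn_two hv hu nuv.symm iv iu jv h)
  obtain ⟨z, ⟨s, t, hs0, ht0, hst, hz⟩, gz⟩ := exists_zero huw
  have hzT : z ∈ Δ.tri := hz ▸ Δ.convex_tri hu hw hs0.le ht0.le hst
  have ez : ∀ n, Δ.eqn n z = s * Δ.eqn n u + t * Δ.eqn n w := fun n => by
    rw [← hz, affine_combo _ hst]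
  have key : ∀ n, ¬ Opp (Δ.eqn n u) (Δ.eqn n w) ∧ (Δ.eqn n u ≠ 0 ∨ Δ.eqn n w ≠ 0) := fun n => by
    constructor
    · intro h
      have h1 := hvu n
      have h2 := hvw n
      have nv : Δ.eqn n v = 0 := by unfold Opp at *; grind
      rcases eqn_conc n i j hv nv iv jv with rfl | rfl | h3
      · exact h.ne_left iu
      · exact h.ne_right jw
      · exact hij h3
    · by_contra! h
      rcases eqn_conc n i k hu h.1 iu ku with rfl | rfl | h3
      · exact iw h.2
      · rcases eqn_conc n j l hw h.2 jw lw with rfl | rfl | h3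
        · exact ju h.1
        · exact hkl rfl
        · exact hlj h3.symm
      · exact hki h3.symm
  have hn : ∀ n, Δ.eqn n z ≠ 0 ∧ 0 ≤ Δ.eqn n u * Δ.eqn n z ∧ 0 ≤ Δ.eqn n w * Δ.eqn n z ∧
      0 ≤ Δ.eqn n v * Δ.eqn n z := fun n => by
    obtain ⟨h1, h2⟩ := key n
    have h3 := hvu n
    have h4 := hvw n
    rw [ez]
    generalize Δ.eqn n u = a at *
    generalize Δ.eqn n w = b at *
    generalize Δ.eqn n v = c at *
    clear ez
    have hab : (0 ≤ a ∧ 0 ≤ b ∧ 0 ≤ c ∧ 0 < s * a + t * b) ∨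
        (a ≤ 0 ∧ b ≤ 0 ∧ c ≤ 0 ∧ s * a + t * b < 0) := by
      have h5 := mul_pos hs0 ht0
      rcases lt_trichotomy a 0 with ha | ha | ha <;> rcases lt_trichotomy b 0 with hb | hb | hb
      · exact Or.inr ⟨ha.le, hb.le, by unfold Opp at *; grind, by nlinarith⟩
      · exact Or.inr ⟨ha.le, hb.le, by unfold Opp at *; grind, by nlinarith⟩
      · exact (h1 (Or.inr ⟨ha, hb⟩)).elim
      · exact Or.inr ⟨ha.le, hb.le, by unfold Opp at *; grind, by nlinarith⟩
      · exact (h2.elim (· ha) (· hb)).elim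
      · exact Or.inl ⟨ha.ge, hb.le, by unfold Opp at *; grind, by nlinarith⟩
      · exact (h1 (Or.inl ⟨ha, hb⟩)).elim
      · exact Or.inl ⟨ha.le, hb.ge, by unfold Opp at *; grind, by nlinarith⟩
      · exact Or.inl ⟨ha.le, hb.le, by unfold Opp at *; grind, by nlinarith⟩
    rcases hab with ⟨ha, hb, hc, h⟩ | ⟨ha, hb, hc, h⟩
    · exact ⟨h.ne', mul_nonneg ha h.le, mul_nonneg hb h.le, mul_nonneg hc h.le⟩
    · exact ⟨h.ne, mul_nonneg_of_nonpos_of_nonpos ha h.le,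
        mul_nonneg_of_nonpos_of_nonpos hb h.le, mul_nonneg_of_nonpos_of_nonpos hc h.le⟩
  have h0 : ∀ n, Δ.eqn n z ≠ 0 := fun n => (hn n).1
  have cu : u ∈ closedCell Δ.eqn z := fun n => (hn n).2.1
  have cw : w ∈ closedCell Δ.eqn z := fun n => (hn n).2.2.1
  have cv : v ∈ closedCell Δ.eqn z := fun n => (hn n).2.2.2
  have hT := closedCell_subset_tri hzT h0
  obtain ⟨x, cx, kx, ix, nux, Vu, Vx⟩ := exists_next hzT h0 cu cv nuv hki.symm iv iu ku
  obtain ⟨y, cy, ly, jy, nwy, Vw, Vy⟩ := exists_next hzT h0 cw cv nwv hlj.symm jv jw lw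
  have Vv := isRegionVertex_closedCell hzT h0 cv cu cw nuv.symm nwv.symm hij iv iu jv jw
  by_cases hxy : x = y
  · subst hxy
    by_cases gx : Δ.fn g x = 0
    · rwa [block_eqn_unique k g hX (hT cx) kX kx gX gx]
    · have h1 := not_opp_block hzT h0 cu cx nux ku kx g
      have h2 := not_opp_block hzT h0 cw cx nwy lw ly g
      exfalso; unfold Opp at *; grind
  have kw : Δ.eqn k w ≠ 0 := fun h => by
    rcases eqn_conc k j l hw h jw lw with rfl | h3 | h3
    · exact ju ku
    · exact hkl h3
    · exact hlj h3.symm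
  have lu : Δ.eqn l u ≠ 0 := fun h => by
    rcases eqn_conc l i k hu h iu ku with rfl | h3 | h3
    · exact iw lw
    · exact hkl h3.symm
    · exact hki h3.symm
  have nxv : x ≠ v := by rintro rfl; exact ix iv
  have nxw : x ≠ w := by rintro rfl; exact kw kx
  have nvy : v ≠ y := by rintro rfl; exact jy jv
  have nuy : u ≠ y := by rintro rfl; exact lu ly
  obtain ⟨q, hqg, hqk, hql⟩ := hs _ (isMinRegion_closedCell hzT h0) x u v w y
    (by simp [nux.symm, nxv, nxw, hxy, nuv, nuw, nuy, nwv.symm, nvy, nwy])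
    ⟨nux.symm, Vx, Vu, segment_subset_frontier h0 cx cu kx ku⟩
    ⟨nuv, Vu, Vv, segment_subset_frontier h0 cu cv iu iv⟩
    ⟨nwv.symm, Vv, Vw, segment_subset_frontier h0 cv cw jv jw⟩
    ⟨nwy, Vw, Vy, segment_subset_frontier h0 cw cy lw ly⟩
    g g.2 (((isFn_coe_B g).2.2 v hv).1 gv)
    ⟨z, ((isFn_coe_B g).2.2 z hzT).1 gz, by
      rw [interior_closedCell h0]; exact self_mem_cell h0⟩
    ⟨X, hX, (mem_affineSpan_iff k nux.symm kx ku).2 kX, ((isFn_coe_B g).2.2 X hX).1 gX⟩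
  rw [mem_affineSpan_iff k nux.symm kx ku] at hqk
  rw [mem_affineSpan_iff l nwy lw ly] at hql
  rwa [block_eqn_unique k g hX ((isFn_coe_B g).1 hqg) kX hqk gX
    ((isFn_coe_B g).eq_zero_of_mem hqg)]

/-- The system of lines carrying the segments of a strong triangle blocking arrangement. -/
def lineSystem (hs : Δ.Strong) : LineSystem Δ.tri Δ.Sbar Δ.B where
  conv := Δ.convex_tri
  L := Δ.eqn
  G g := Δ.fn g
  proper i := i.1 ∉ triEdges Δ.x1 Δ.x2 Δ.x3
  two _ _ p q hpq h1 h2 h3 h4 := eqn_two p.2 q.2 (fun e => hpq (Subtype.ext e)) h1 h2 h3 h4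
  conc i j k p h1 h2 h3 := eqn_conc i j k p.2 h1 h2 h3
  block_ex i j p hij hi h1 h2 := by
    obtain ⟨b, ⟨hb, hpb⟩, -⟩ := Δ.block_exists i i.2 j j.2 (fun e => hij (Subtype.ext e))
      (fun h => hi h.1) p ((isFn_coe i).mem h1) ((isFn_coe j).mem h2)
    exact ⟨⟨b, hb⟩, (isFn_coe_B ⟨b, hb⟩).eq_zero_of_mem hpb⟩
  block_un i j g h p hij h1 h2 h3 h4 := Subtype.ext <|
    Δ.block_unique i i.2 j j.2 (fun e => hij (Subtype.ext e)) p ((isFn_coe i).mem h1)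
      ((isFn_coe j).mem h2) g g.2 h h.2 ((isFn_coe_B g).mem h3) ((isFn_coe_B h).mem h4)
  second i g p h1 h2 := by
    obtain ⟨j, hij, hj⟩ := exists_second i g ((isFn_coe i).mem h1) ((isFn_coe_B g).mem h2)
    exact ⟨j, hij, eqn_eq_zero j hj⟩
  gl i g p q hpq h1 h2 h3 h4 := hpq (Subtype.ext (block_eqn_unique i g p.2 q.2 h1 h2 h3 h4))
  sep_proper i p q h hi := not_opp_edge hi (isFn_coe i) p.2 q.2 h
  strong _ _ _ _ g v u w X hij hki hlj iv jv iu ku jw lw hvu hvw gv huw kX gX :=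
    hs.concurrent g v.2 u.2 w.2 X.2 hij hki hlj iv jv iu ku jw lw hvu hvw gv huw kX gX

variable (Δ) in
/-- An edge of the triangle, as an initial segment. -/
def edge12 : Δ.Sbar := ⟨segment ℝ Δ.x1 Δ.x2, Or.inr (by simp [triEdges])⟩

variable (Δ) in
/-- An edge of the triangle, as an initial segment. -/
def edge23 : Δ.Sbar := ⟨segment ℝ Δ.x2 Δ.x3, Or.inr (by simp [triEdges])⟩

variable (Δ) in
/-- An edge of the triangle, as an initial segment. -/
def edge31 : Δ.Sbar := ⟨segment ℝ Δ.x3 Δ.x1, Or.inr (by simp [triEdges])⟩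

theorem x1_mem : Δ.x1 ∈ Δ.tri := subset_convexHull _ _ (by simp)

theorem x2_mem : Δ.x2 ∈ Δ.tri := subset_convexHull _ _ (by simp)

theorem x3_mem : Δ.x3 ∈ Δ.tri := subset_convexHull _ _ (by simp)

theorem lineSystem_tri (hs : Δ.Strong) :
    (lineSystem hs).Tri ⟨_, x1_mem⟩ ⟨_, x2_mem⟩ ⟨_, x3_mem⟩ Δ.edge23 Δ.edge31 Δ.edge12 where
  pA h := Δ.area_ne_zero <| by
    rw [← lineFn_rotate]; exact Δ.isFn_23.eq_zero_of_mem ((isFn_coe Δ.edge23).mem h)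
  pB := eqn_eq_zero _ (left_mem_segment _ _ _)
  pC := eqn_eq_zero _ (right_mem_segment _ _ _)
  qA := eqn_eq_zero _ (right_mem_segment _ _ _)
  qB h := Δ.area_ne_zero <| by
    rw [← lineFn_rotate, ← lineFn_rotate]
    exact Δ.isFn_31.eq_zero_of_mem ((isFn_coe Δ.edge31).mem h)
  qC := eqn_eq_zero _ (left_mem_segment _ _ _)
  rA := eqn_eq_zero _ (left_mem_segment _ _ _)
  rB := eqn_eq_zero _ (right_mem_segment _ _ _)
  rC h := Δ.area_ne_zero <| Δ.isFn_12.eq_zero_of_mem ((isFn_coe Δ.edge12).mem h)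

theorem exists_coeffs {q : Pt} (hq : q ∈ Δ.tri) : ∃ α β γ : ℝ, 0 ≤ α ∧ 0 ≤ β ∧ 0 ≤ γ ∧
    α + β + γ = 1 ∧ q = α • Δ.x1 + β • Δ.x2 + γ • Δ.x3 := by
  have hA := Δ.area_ne_zero
  have aux : ∀ {x : ℝ}, 0 ≤ lineFn Δ.x1 Δ.x2 Δ.x3 * x → 0 ≤ x / lineFn Δ.x1 Δ.x2 Δ.x3 :=
    fun {x} hx => by
      rw [← mul_div_mul_left _ _ hA]; exact div_nonneg hx (mul_self_nonneg _)
  obtain ⟨e, h⟩ := bary hA q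
  exact ⟨_, _, _, aux (Δ.nonneg_23 hq), aux (Δ.nonneg_31 hq), aux (Δ.nonneg_12 hq), h, e⟩

/-- A blocking segment through a corner separates the other two corners. -/
theorem opp_of_block {b : Δ.B} {a c d : Pt} (hab : a ∈ b.1) (hc : Δ.fn b c ≠ 0) (hd : Δ.fn b d ≠ 0)
    (h : ∀ q ∈ Δ.tri, ∃ α β γ : ℝ, 0 ≤ β ∧ 0 ≤ γ ∧ α + β + γ = 1 ∧ q = α • a + β • c + γ • d) :
    Opp (Δ.fn b c) (Δ.fn b d) := by
  have hf := isFn_coe_B b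
  have ha := hf.eq_zero_of_mem hab
  obtain ⟨p, hp, hpa⟩ : ∃ p ∈ b.1, p ≠ a := by
    obtain ⟨-, ⟨p, q, hp, hq, hpq, -⟩, -⟩ := id hf
    by_cases hpa : p = a
    · exact ⟨q, hq, fun e => hpq (hpa.trans e.symm)⟩
    · exact ⟨p, hp, hpa⟩
  obtain ⟨α, β, γ, hβ, hγ, hs, e⟩ := h p (hf.1 hp)
  have h0 := hf.eq_zero_of_mem hp
  rw [e, affine_combo3 _ _ _ _ hs, ha] at h0
  by_contra hno
  have hz : β = 0 ∧ γ = 0 := by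
    rcases lt_or_gt_of_ne hc with h1 | h1 <;> rcases lt_or_gt_of_ne hd with h2 | h2
    · constructor <;> nlinarith
    · exact (hno (Or.inr ⟨h1, h2⟩)).elim
    · exact (hno (Or.inl ⟨h1, h2⟩)).elim
    · constructor <;> nlinarith
  obtain ⟨rfl, rfl⟩ := hz
  have : α = 1 := by linarith
  exact hpa (by rw [e, this]; simp)

theorem lineSystem_bl_x1 (hs : Δ.Strong) (h : ∃ b ∈ Δ.B, Δ.x1 ∈ b) :
    (lineSystem hs).Bl ⟨_, x1_mem⟩ ⟨_, x2_mem⟩ ⟨_, x3_mem⟩ := by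
  obtain ⟨b, hb, h1⟩ := h
  have ht := lineSystem_tri hs
  have hz := (isFn_coe_B ⟨b, hb⟩).eq_zero_of_mem h1
  refine ⟨⟨b, hb⟩, hz, opp_of_block (b := ⟨b, hb⟩) h1 (fun h0 => ?_) (fun h0 => ?_) fun q hq => ?_⟩
  · exact (lineSystem hs).gl _ ⟨b, hb⟩ _ _ ht.ne_AB ht.rA ht.rB hz h0
  · exact (lineSystem hs).gl _ ⟨b, hb⟩ _ _ ht.rotate.rotate.ne_AB.symm ht.qA ht.qC hz h0
  · obtain ⟨α, β, γ, -, h2, h3, h4, e⟩ := exists_coeffs hq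
    exact ⟨α, β, γ, h2, h3, h4, e⟩

theorem lineSystem_bl_x3 (hs : Δ.Strong) (h : ∃ b ∈ Δ.B, Δ.x3 ∈ b) :
    (lineSystem hs).Bl ⟨_, x3_mem⟩ ⟨_, x1_mem⟩ ⟨_, x2_mem⟩ := by
  obtain ⟨b, hb, h1⟩ := h
  have ht := lineSystem_tri hs
  have hz := (isFn_coe_B ⟨b, hb⟩).eq_zero_of_mem h1
  refine ⟨⟨b, hb⟩, hz, opp_of_block (b := ⟨b, hb⟩) h1 (fun h0 => ?_) (fun h0 => ?_) fun q hq => ?_⟩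
  · exact (lineSystem hs).gl _ ⟨b, hb⟩ _ _ ht.rotate.rotate.ne_AB ht.qC ht.qA hz h0
  · exact (lineSystem hs).gl _ ⟨b, hb⟩ _ _ ht.rotate.ne_AB.symm ht.pC ht.pB hz h0
  · obtain ⟨α, β, γ, h1, h2, -, h4, e⟩ := exists_coeffs hq
    exact ⟨γ, α, β, h1, h2, by linarith, by rw [e]; abel⟩

theorem not_mem_triEdges {s : Set Pt} (hs : s ∈ Δ.S) : s ∉ triEdges Δ.x1 Δ.x2 Δ.x3 := fun h => by
  obtain ⟨a, b, -, rfl, -, -, hab⟩ := Δ.seg_wf s (Or.inl hs)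
  have hm : (1 / 2 : ℝ) • a + (1 / 2 : ℝ) • b ∈ openSegment ℝ a b :=
    ⟨1 / 2, 1 / 2, by norm_num, by norm_num, by norm_num, rfl⟩
  exact hab _ hm (Δ.mem_bdry_iff.2 ⟨_, h, openSegment_subset_segment _ _ _ hm⟩)

/-- A proper initial segment meeting a side separates the endpoints of the side. -/
theorem opp_of_mem_segment {s : Set Pt} (hs : s ∈ Δ.S) {e e' : Δ.Sbar}
    (he : e.1 ∈ triEdges Δ.x1 Δ.x2 Δ.x3) (he' : e'.1 ∈ triEdges Δ.x1 Δ.x2 Δ.x3)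
    {e'' : Δ.Sbar} (he'' : e''.1 ∈ triEdges Δ.x1 Δ.x2 Δ.x3) (h1 : e ≠ e') (h2 : e ≠ e'')
    {a b p : Pt} (hae : a ∈ e.1) (hae' : a ∈ e'.1) (hbe : b ∈ e.1) (hbe' : b ∈ e''.1)
    (hp : p ∈ segment ℝ a b) (hps : p ∈ s) : Opp (Δ.fn s a) (Δ.fn s b) := by
  let m : Δ.Sbar := ⟨s, Or.inl hs⟩
  have hne : ∀ c : Δ.Sbar, c.1 ∈ triEdges Δ.x1 Δ.x2 Δ.x3 → m ≠ c := fun c hc h =>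
    not_mem_triEdges hs (by rw [← h] at hc; exact hc)
  have ha : Δ.eqn m a ≠ 0 := fun h => by
    rcases eqn_conc m e e' ((isFn_coe e).1 hae) h (eqn_eq_zero e hae) (eqn_eq_zero e' hae') with
      h | h | h
    exacts [hne e he h, hne e' he' h, h1 h]
  have hb : Δ.eqn m b ≠ 0 := fun h => by
    rcases eqn_conc m e e'' ((isFn_coe e).1 hbe) h (eqn_eq_zero e hbe) (eqn_eq_zero e'' hbe') with
      h | h | h
    exacts [hne e he h, hne e'' he'' h, h2 h]
  have h0 := eqn_eq_zero m hps
  obtain ⟨α, β, hα, hβ, hαβ, rfl⟩ := hp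
  rw [affine_combo _ hαβ] at h0
  by_contra hno
  change ¬ Opp (Δ.eqn m a) (Δ.eqn m b) at hno
  rcases hα.eq_or_lt with rfl | hα'
  · obtain rfl : β = 1 := by linarith
    exact hb (by linarith)
  rcases lt_or_gt_of_ne ha with h3 | h3 <;> rcases lt_or_gt_of_ne hb with h4 | h4
  · have := mul_neg_of_pos_of_neg hα' h3; have := mul_nonpos_of_nonneg_of_nonpos hβ h4.le; linarith
  · exact hno (Or.inr ⟨h3, h4⟩)
  · exact hno (Or.inl ⟨h3, h4⟩)
  · have := mul_pos hα' h3; have := mul_nonneg hβ h4.le; linarith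

theorem inn_of_notMem {X : Pt} (hX : X ∈ Δ.tri) (h : ∀ e ∈ triEdges Δ.x1 Δ.x2 Δ.x3, X ∉ e) :
    Inn (⟨_, x1_mem⟩ : Δ.tri) ⟨_, x2_mem⟩ ⟨_, x3_mem⟩ ⟨X, hX⟩ := by
  obtain ⟨α, β, γ, h1, h2, h3, h4, e⟩ := exists_coeffs hX
  refine ⟨α, β, γ, h1.lt_of_ne ?_, h2.lt_of_ne ?_, h3.lt_of_ne ?_, h4, e⟩
  · rintro rfl
    exact h (segment ℝ Δ.x2 Δ.x3) (by simp [triEdges]) ⟨β, γ, h2, h3, by linarith, by rw [e]; simp⟩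
  · rintro rfl
    exact h (segment ℝ Δ.x3 Δ.x1) (by simp [triEdges])
      ⟨γ, α, h3, h1, by linarith, by rw [e]; simp [add_comm]⟩
  · rintro rfl
    exact h (segment ℝ Δ.x1 Δ.x2) (by simp [triEdges]) ⟨α, β, h1, h2, by linarith, by rw [e]; simp⟩

end TBA

/-- Proposition 10: in a strong triangle blocking arrangement with blocking segments through
`x₁` and `x₃`, initial segments `a₁a₂` and `b₁b₂` with `a₁ ∈ x₁x₂`, `b₂ ∈ x₂x₃` and
`a₂, b₁ ∈ x₁x₃` are disjoint. -/
theorem TBA.forbidden_structure_3 (Δ : TBA) (hstrong : Δ.Strong)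
    (hx1 : ∃ b ∈ Δ.B, Δ.x1 ∈ b) (hx3 : ∃ b ∈ Δ.B, Δ.x3 ∈ b)
    (a₁ a₂ b₁ b₂ : Pt)
    (ha₁ : a₁ ∈ segment ℝ Δ.x1 Δ.x2) (hb₂ : b₂ ∈ segment ℝ Δ.x2 Δ.x3)
    (ha₂ : a₂ ∈ segment ℝ Δ.x1 Δ.x3) (hb₁ : b₁ ∈ segment ℝ Δ.x1 Δ.x3)
    (hA : segment ℝ a₁ a₂ ∈ Δ.S) (hB : segment ℝ b₁ b₂ ∈ Δ.S) :
    Disjoint (segment ℝ a₁ a₂) (segment ℝ b₁ b₂) := by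
  rw [Set.disjoint_left]
  intro X hXA hXB
  have ht := TBA.lineSystem_tri hstrong
  let _ := Fintype.ofFinite Δ.Sbar
  let _ := Fintype.ofFinite Δ.B
  have hnc := Blocking.LineSystem.noCross_of_bl ht (TBA.lineSystem_bl_x1 hstrong hx1)
    (TBA.lineSystem_bl_x3 hstrong hx3)
  have t12 : Δ.edge12.1 ∈ triEdges Δ.x1 Δ.x2 Δ.x3 := by simp [triEdges, TBA.edge12]
  have t23 : Δ.edge23.1 ∈ triEdges Δ.x1 Δ.x2 Δ.x3 := by simp [triEdges, TBA.edge23]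
  have t31 : Δ.edge31.1 ∈ triEdges Δ.x1 Δ.x2 Δ.x3 := by simp [triEdges, TBA.edge31]
  have n1 := ht.ne_pq
  have n2 := ht.rotate.ne_pq
  have n3 := ht.rotate.rotate.ne_pq
  have l := left_mem_segment ℝ (E := Pt)
  have r := right_mem_segment ℝ (E := Pt)
  rw [segment_symm ℝ Δ.x1 Δ.x3] at ha₂ hb₁
  have A12 := TBA.opp_of_mem_segment hA t12 t31 t23 n2.symm n3 (l _ _) (r _ _) (r _ _) (l _ _)
    ha₁ (l _ _)
  have A31 := TBA.opp_of_mem_segment hA t31 t23 t12 n1.symm n2 (l _ _) (r _ _) (r _ _) (l _ _)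
    ha₂ (r _ _)
  have B23 := TBA.opp_of_mem_segment hB t23 t12 t31 n3.symm n1 (l _ _) (r _ _) (r _ _) (l _ _)
    hb₂ (r _ _)
  have B31 := TBA.opp_of_mem_segment hB t31 t23 t12 n1.symm n2 (l _ _) (r _ _) (r _ _) (l _ _)
    hb₁ (l _ _)
  have hne : segment ℝ a₁ a₂ ≠ segment ℝ b₁ b₂ := fun h => by
    rw [h] at A12 A31
    unfold Blocking.Opp at *; grind
  let m : Δ.Sbar := ⟨_, Or.inl hA⟩
  let n : Δ.Sbar := ⟨_, Or.inl hB⟩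
  have hX : X ∈ Δ.tri := (TBA.isFn_coe m).1 hXA
  have hi := TBA.inn_of_notMem hX fun e he hXe =>
    Δ.no_three_concurrent _ (Or.inl hA) _ (Or.inl hB) e (Or.inr he) hne
      (fun h => TBA.not_mem_triEdges hA (by rw [h]; exact he))
      (fun h => TBA.not_mem_triEdges hB (by rw [h]; exact he)) ⟨X, hXA, hXB, hXe⟩
  rcases hnc m n ⟨X, hX⟩ (fun h => hne (congrArg Subtype.val h)) (TBA.eqn_eq_zero m hXA)
    (TBA.eqn_eq_zero n hXB) hi with ⟨-, h1, h2⟩ | ⟨⟨h1, h2⟩, -⟩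
  · change Blocking.Opp (Δ.fn (segment ℝ b₁ b₂) Δ.x1) (Δ.fn (segment ℝ b₁ b₂) Δ.x2) at h1
    unfold Blocking.Opp at *; grind
  · change Blocking.Opp (Δ.fn (segment ℝ a₁ a₂) Δ.x3) (Δ.fn (segment ℝ a₁ a₂) Δ.x2) at h2
    unfold Blocking.Opp at *; grind
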